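/- Let Γ' be a finite-index subgroup of SL(2,ℤ) with −I ∉ Γ' and let k ≥ 3 be odd. Then dim S_k(Γ') = ((k−1)/12)·ν₀(Γ') + (⌊k/3⌋ − (k−1)/3)·ν₃(Γ') − ν_∞^reg(Γ')/2, and dim M_k(Γ') = dim S_k(Γ') + ν_∞^reg(Γ'). Moreover, if −I ∈ Γ' and k is odd, then M_k(Γ') = {0}. -/

import Mathlib

open Matrix CongruenceSubgroup UpperHalfPlane OnePoint
open scoped MatrixGroups

/-- The subgroup `{±I}` of `SL(2, ℤ)`, realised as the (cyclic) subgroup generated by `-I`. -/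
def plusMinusOne : Subgroup SL(2, ℤ) := Subgroup.zpowers (-1 : SL(2, ℤ))

instance : plusMinusOne.Normal := by
  constructor
  rintro x ⟨n, rfl⟩ g
  have h : Commute g (-1 : SL(2, ℤ)) := by
    ext i j
    simp [mul_neg, neg_mul]
  have : g * (-1 : SL(2, ℤ)) ^ n * g⁻¹ = (-1) ^ n := by
    rw [(h.zpow_right n).eq, mul_assoc, mul_inv_cancel, mul_one]
  rw [this]
  exact ⟨n, rfl⟩

/-- `ν₀(Γ')`: the index of the image of `Γ'` in `PSL(2, ℤ) = SL(2, ℤ)/{±I}`. -/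
noncomputable def nuZero (Γ' : Subgroup SL(2, ℤ)) : ℕ :=
  (Subgroup.map (QuotientGroup.mk' plusMinusOne) Γ').index

/-- The action of `SL(2, ℤ)` on the set of cusps `ℚ ∪ {∞}` by fractional linear
transformations. -/
def slOnePoint (γ : SL(2, ℤ)) (x : OnePoint ℚ) : OnePoint ℚ :=
  match x with
  | ∞ => if (γ 1 0 : ℚ) = 0 then ∞ else ((γ 0 0 : ℚ) / (γ 1 0 : ℚ) : ℚ)
  | (q : ℚ) => if (γ 1 0 : ℚ) * q + (γ 1 1 : ℚ) = 0 then ∞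
      else (((γ 0 0 : ℚ) * q + (γ 0 1 : ℚ)) / ((γ 1 0 : ℚ) * q + (γ 1 1 : ℚ)) : ℚ)

/-- A cusp `s ∈ ℚ ∪ {∞}` of a subgroup `Γ'` (with `−I ∉ Γ'`) is *regular* if the stabiliser
of `s` in `Γ'` is generated by a parabolic element of trace `+2` (an element `≠ 1` of trace
`+2`, i.e. one conjugate in `SL(2, ℝ)` to `(1 h; 0 1)` with `h > 0`). -/
def IsRegularCusp (Γ' : Subgroup SL(2, ℤ)) (s : OnePoint ℚ) : Prop :=
  ∃ γ : SL(2, ℤ), γ ≠ 1 ∧ γ 0 0 + γ 1 1 = 2 ∧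
    {g : SL(2, ℤ) | g ∈ Γ' ∧ slOnePoint g s = s} = (Subgroup.zpowers γ : Set SL(2, ℤ))

/-- `ν_∞^reg(Γ')`: the number of `Γ'`-orbits of regular cusps. -/
noncomputable def numRegularCuspOrbits (Γ' : Subgroup SL(2, ℤ)) : ℕ :=
  Nat.card {O : Set (OnePoint ℚ) // ∃ s : OnePoint ℚ, IsRegularCusp Γ' s ∧
    O = {y | ∃ γ ∈ Γ', slOnePoint γ s = y}}

/-- The natural homomorphism `SL(2, ℤ) →* PSL(2, ℝ)`. -/
noncomputable def toPSL : SL(2, ℤ) →* (SL(2, ℝ) ⧸ Subgroup.center SL(2, ℝ)) :=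
  (QuotientGroup.mk' (Subgroup.center SL(2, ℝ))).comp
    (Matrix.SpecialLinearGroup.map (Int.castRingHom ℝ))

/-- A point `z ∈ ℍ` is an elliptic point of order `n` for a subgroup `Γ'` of `SL(2, ℤ)` if
the stabiliser of `z` in the image of `Γ'` in `PSL(2, ℝ)` — equivalently, the image in
`PSL(2, ℝ)` of the stabiliser `Γ' ⊓ Stab(z)` (since `−I` acts trivially on `ℍ`) — is a
cyclic group of order `n`. -/
def IsEllipticPointOfOrder (Γ' : Subgroup SL(2, ℤ)) (n : ℕ) (z : ℍ) : Prop :=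
  IsCyclic (Subgroup.map toPSL (Γ' ⊓ MulAction.stabilizer SL(2, ℤ) z)) ∧
  Nat.card (Subgroup.map toPSL (Γ' ⊓ MulAction.stabilizer SL(2, ℤ) z)) = n

/-- `ν_n(Γ')`: the number of `Γ'`-orbits of elliptic points of order `n` in `ℍ`. -/
noncomputable def numEllipticOrbits (Γ' : Subgroup SL(2, ℤ)) (n : ℕ) : ℕ :=
  Nat.card {O : Set ℍ // ∃ z : ℍ, IsEllipticPointOfOrder Γ' n z ∧
    O = {w : ℍ | ∃ γ ∈ Γ', γ • z = w}}

section VectorValued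

open ModularGroup
open scoped Manifold ModularForm

/-- The automorphy factor `c z + d` of `γ = (a b; c d)`. -/
noncomputable def autFactor (γ : SL(2, ℤ)) (z : ℍ) : ℂ := (γ 1 0 : ℂ) * z + (γ 1 1 : ℂ)

lemma autFactor_eq_denom (γ : SL(2, ℤ)) (z : ℍ) : autFactor γ z = denom γ z :=
  (denom_apply γ z).symm

lemma autFactor_ne_zero (γ : SL(2, ℤ)) (z : ℍ) : autFactor γ z ≠ 0 := by
  rw [autFactor_eq_denom]; exact denom_ne_zero _ _

lemma autFactor_mul (γ δ : SL(2, ℤ)) (z : ℍ) :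
    autFactor (γ * δ) z = autFactor γ (δ • z) * autFactor δ z := by
  simp only [autFactor_eq_denom]
  rw [map_mul, map_mul, denom_cocycle _ _ z.im_ne_zero]
  congr 2
  simp [UpperHalfPlane.coe_smul_of_det_pos]

@[simp] lemma autFactor_one (z : ℍ) : autFactor 1 z = 1 := by simp [autFactor]

@[simp] lemma autFactor_neg (γ : SL(2, ℤ)) (z : ℍ) : autFactor (-γ) z = -autFactor γ z := by
  simp [autFactor]; ring

@[simp] lemma autFactor_T (z : ℍ) : autFactor T z = 1 := by simp [autFactor, T]

lemma slash_eq_autFactor (f : ℍ → ℂ) (k : ℤ) (γ : SL(2, ℤ)) (z : ℍ) :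
    (f ∣[k] γ) z = f (γ • z) * autFactor γ z ^ (-k) := by
  rw [ModularForm.SL_slash_apply, autFactor_eq_denom]

lemma neg_one_smul_uhp (z : ℍ) : (-1 : SL(2, ℤ)) • z = z := by
  rw [ModularGroup.SL_neg_smul, one_smul]

variable (X : Type) [MulAction SL(2, ℤ) X]

/-- Families of holomorphic functions on `ℍ`, indexed by an `SL(2, ℤ)`-set `X`, transforming
equivariantly in weight `k`. -/
def equivariantFamily (k : ℤ) : Submodule ℂ (X → ℍ → ℂ) where
  carrier := {F | (∀ x, MDiff (F x)) ∧
    ∀ (γ : SL(2, ℤ)) x z, F (γ • x) (γ • z) = autFactor γ z ^ k * F x z}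
  add_mem' hF hG := ⟨fun x ↦ (hF.1 x).add (hG.1 x), fun γ x z ↦ by
    simp only [Pi.add_apply, hF.2, hG.2]; ring⟩
  zero_mem' := ⟨fun _ ↦ mdifferentiable_const, by simp⟩
  smul_mem' c F hF := ⟨fun x ↦ (hF.1 x).const_smul c, fun γ x z ↦ by
    simp only [Pi.smul_apply, hF.2, smul_eq_mul]; ring⟩

/-- Equivariant families that are bounded at `i∞`. -/
def formFamily (k : ℤ) : Submodule ℂ (X → ℍ → ℂ) where
  carrier := {F | F ∈ equivariantFamily X k ∧ ∀ x, IsBoundedAtImInfty (F x)}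
  add_mem' hF hG := ⟨add_mem hF.1 hG.1, fun x ↦ (hF.2 x).add (hG.2 x)⟩
  zero_mem' := ⟨zero_mem _, fun _ ↦ Filter.const_boundedAtFilter _ (0 : ℂ)⟩
  smul_mem' c _ hF := ⟨Submodule.smul_mem _ c hF.1, fun x ↦ (hF.2 x).smul c⟩

/-- Equivariant families that vanish at `i∞`. -/
def cuspFamily (k : ℤ) : Submodule ℂ (X → ℍ → ℂ) where
  carrier := {F | F ∈ equivariantFamily X k ∧ ∀ x, IsZeroAtImInfty (F x)}
  add_mem' hF hG := ⟨add_mem hF.1 hG.1, fun x ↦ (hF.2 x).add (hG.2 x)⟩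
  zero_mem' := ⟨zero_mem _, fun _ ↦ Filter.zero_zeroAtFilter _⟩
  smul_mem' c _ hF := ⟨Submodule.smul_mem _ c hF.1, fun x ↦ (hF.2 x).smul c⟩

lemma cuspFamily_le_formFamily (k : ℤ) : cuspFamily X k ≤ formFamily X k :=
  fun _ hF ↦ ⟨hF.1, fun x ↦ (hF.2 x).isBoundedAtImInfty⟩

section Coset

variable {Γ : Subgroup SL(2, ℤ)} {k : ℤ}

/-- The family of translates of a `Γ`-invariant function, indexed by `SL(2, ℤ) ⧸ Γ`. -/
noncomputable def cosetFamily (f : ℍ → ℂ) (x : SL(2, ℤ) ⧸ Γ) (z : ℍ) : ℂ :=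
  (f ∣[k] (x.out : SL(2, ℤ))⁻¹) z

lemma cosetFamily_mk {f : ℍ → ℂ} (hf : ∀ γ ∈ Γ, f ∣[k] γ = f) (g : SL(2, ℤ)) :
    cosetFamily (k := k) f (g : SL(2, ℤ) ⧸ Γ) = f ∣[k] g⁻¹ := by
  obtain ⟨h, hh⟩ := QuotientGroup.mk_out_eq_mul Γ g
  funext z
  rw [cosetFamily, hh, _root_.mul_inv_rev, SlashAction.slash_mul, hf _ (inv_mem h.2)]

lemma cosetFamily_mem {f : ℍ → ℂ} (hf : ∀ γ ∈ Γ, f ∣[k] γ = f) (hol : MDiff f) :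
    cosetFamily (k := k) f ∈ equivariantFamily (SL(2, ℤ) ⧸ Γ) k := by
  refine ⟨fun x ↦ hol.slash k _, fun γ x z ↦ ?_⟩
  induction x using QuotientGroup.induction_on with
  | H g =>
    rw [show γ • (g : SL(2, ℤ) ⧸ Γ) = ((γ * g : SL(2, ℤ)) : SL(2, ℤ) ⧸ Γ) from rfl,
      cosetFamily_mk hf, cosetFamily_mk hf, _root_.mul_inv_rev, SlashAction.slash_mul,
      slash_eq_autFactor _ _ γ⁻¹, inv_smul_smul]
    have h := autFactor_mul γ⁻¹ γ z
    rw [inv_mul_cancel, autFactor_one] at h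
    rw [eq_inv_of_mul_eq_one_left h.symm, _root_.inv_zpow, _root_.zpow_neg, inv_inv]
    ring

lemma slash_eq_of_mem_equivariantFamily {F : (SL(2, ℤ) ⧸ Γ) → ℍ → ℂ}
    (hF : F ∈ equivariantFamily (SL(2, ℤ) ⧸ Γ) k) (g : SL(2, ℤ)) :
    F ((1 : SL(2, ℤ)) : SL(2, ℤ) ⧸ Γ) ∣[k] g = F ((g⁻¹ : SL(2, ℤ)) : SL(2, ℤ) ⧸ Γ) := by
  funext z
  have := hF.2 g ((g⁻¹ : SL(2, ℤ)) : SL(2, ℤ) ⧸ Γ) z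
  rw [show g • ((g⁻¹ : SL(2, ℤ)) : SL(2, ℤ) ⧸ Γ) = ((g * g⁻¹ : SL(2, ℤ)) : SL(2, ℤ) ⧸ Γ) from rfl,
    mul_inv_cancel] at this
  rw [slash_eq_autFactor, this, mul_comm, ← mul_assoc, ← zpow_add₀ (autFactor_ne_zero g z)]
  simp

lemma slash_eq_self_of_mem_equivariantFamily {F : (SL(2, ℤ) ⧸ Γ) → ℍ → ℂ}
    (hF : F ∈ equivariantFamily (SL(2, ℤ) ⧸ Γ) k) {g : SL(2, ℤ)} (hg : g ∈ Γ) :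
    F ((1 : SL(2, ℤ)) : SL(2, ℤ) ⧸ Γ) ∣[k] g = F ((1 : SL(2, ℤ)) : SL(2, ℤ) ⧸ Γ) := by
  rw [slash_eq_of_mem_equivariantFamily hF]
  congr 1
  rw [QuotientGroup.eq]
  simpa using hg

lemma cosetFamily_one {F : (SL(2, ℤ) ⧸ Γ) → ℍ → ℂ}
    (hF : F ∈ equivariantFamily (SL(2, ℤ) ⧸ Γ) k) (g : SL(2, ℤ)) :
    cosetFamily (k := k) (F ((1 : SL(2, ℤ)) : SL(2, ℤ) ⧸ Γ)) (g : SL(2, ℤ) ⧸ Γ) =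
      F (g : SL(2, ℤ) ⧸ Γ) := by
  rw [cosetFamily_mk fun γ hγ ↦ slash_eq_self_of_mem_equivariantFamily hF hγ,
    slash_eq_of_mem_equivariantFamily hF, inv_inv]

lemma nonempty_modularForm_equiv [Γ.FiniteIndex] :
    Nonempty (ModularForm Γ k ≃ₗ[ℂ] formFamily (SL(2, ℤ) ⧸ Γ) k) := by
  have inv (f : ModularForm Γ k) : ∀ γ ∈ Γ, (f : ℍ → ℂ) ∣[k] γ = f := fun γ hγ ↦
    f.slash_action_eq' _ ⟨γ, hγ, rfl⟩
  let φ : ModularForm Γ k →ₗ[ℂ] formFamily (SL(2, ℤ) ⧸ Γ) k :=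
    { toFun := fun f ↦ ⟨cosetFamily (k := k) f, cosetFamily_mem (inv f) f.holo',
        fun x ↦ ModularFormClass.bdd_at_infty_slash f _⟩
      map_add' := fun f g ↦ by
        ext x z
        simp [cosetFamily, SlashAction.add_slash]
      map_smul' := fun c f ↦ by
        ext x z
        simp [cosetFamily, slash_eq_autFactor]; ring }
  refine ⟨LinearEquiv.ofBijective φ ⟨fun f g h ↦ ?_, fun F ↦ ?_⟩⟩
  · have := congr_fun (Subtype.ext_iff.mp h) ((1 : SL(2, ℤ)) : SL(2, ℤ) ⧸ Γ)
    simp only [φ, LinearMap.coe_mk, AddHom.coe_mk, cosetFamily_mk (inv f), cosetFamily_mk (inv g)]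
      at this
    exact DFunLike.coe_injective (by simpa using this)
  · refine ⟨⟨⟨F.1 ((1 : SL(2, ℤ)) : SL(2, ℤ) ⧸ Γ), ?_⟩, F.2.1.1 _, fun {c} hc ↦ ?_⟩, ?_⟩
    · rintro _ ⟨γ, hγ, rfl⟩
      exact slash_eq_self_of_mem_equivariantFamily F.2.1 hγ
    · rw [Subgroup.IsArithmetic.isCusp_iff_isCusp_SL2Z] at hc
      rw [OnePoint.isBoundedAt_iff_forall_SL2Z hc]
      intro γ _
      simp only [slash_eq_of_mem_equivariantFamily F.2.1]
      exact F.2.2 _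
    · ext x z
      induction x using QuotientGroup.induction_on with
      | H g =>
        exact congr_fun (cosetFamily_one F.2.1 g) z

lemma nonempty_cuspForm_equiv [Γ.FiniteIndex] :
    Nonempty (CuspForm Γ k ≃ₗ[ℂ] cuspFamily (SL(2, ℤ) ⧸ Γ) k) := by
  have inv (f : CuspForm Γ k) : ∀ γ ∈ Γ, (f : ℍ → ℂ) ∣[k] γ = f := fun γ hγ ↦
    f.slash_action_eq' _ ⟨γ, hγ, rfl⟩
  let φ : CuspForm Γ k →ₗ[ℂ] cuspFamily (SL(2, ℤ) ⧸ Γ) k :=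
    { toFun := fun f ↦ ⟨cosetFamily (k := k) f, cosetFamily_mem (inv f) f.holo',
        fun x ↦ CuspFormClass.zero_at_infty_slash f _⟩
      map_add' := fun f g ↦ by
        ext x z
        simp [cosetFamily, SlashAction.add_slash]
      map_smul' := fun c f ↦ by
        ext x z
        simp [cosetFamily, slash_eq_autFactor]; ring }
  refine ⟨LinearEquiv.ofBijective φ ⟨fun f g h ↦ ?_, fun F ↦ ?_⟩⟩
  · have := congr_fun (Subtype.ext_iff.mp h) ((1 : SL(2, ℤ)) : SL(2, ℤ) ⧸ Γ)
    simp only [φ, LinearMap.coe_mk, AddHom.coe_mk, cosetFamily_mk (inv f), cosetFamily_mk (inv g)]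
      at this
    exact DFunLike.coe_injective (by simpa using this)
  · refine ⟨⟨⟨F.1 ((1 : SL(2, ℤ)) : SL(2, ℤ) ⧸ Γ), ?_⟩, F.2.1.1 _, fun {c} hc ↦ ?_⟩, ?_⟩
    · rintro _ ⟨γ, hγ, rfl⟩
      exact slash_eq_self_of_mem_equivariantFamily F.2.1 hγ
    · rw [Subgroup.IsArithmetic.isCusp_iff_isCusp_SL2Z] at hc
      rw [OnePoint.isZeroAt_iff_forall_SL2Z hc]
      intro γ _
      simp only [slash_eq_of_mem_equivariantFamily F.2.1]
      exact F.2.2 _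
    · ext x z
      induction x using QuotientGroup.induction_on with
      | H g =>
        exact congr_fun (cosetFamily_one F.2.1 g) z

lemma finrank_modularForm_eq [Γ.FiniteIndex] :
    Module.finrank ℂ (ModularForm Γ k) = Module.finrank ℂ (formFamily (SL(2, ℤ) ⧸ Γ) k) :=
  nonempty_modularForm_equiv.some.finrank_eq

lemma finrank_cuspForm_eq [Γ.FiniteIndex] :
    Module.finrank ℂ (CuspForm Γ k) = Module.finrank ℂ (cuspFamily (SL(2, ℤ) ⧸ Γ) k) :=
  nonempty_cuspForm_equiv.some.finrank_eq

lemma formFamily_eq_bot_of_neg [Γ.FiniteIndex] (hk : k < 0) :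
    formFamily (SL(2, ℤ) ⧸ Γ) k = ⊥ := by
  obtain ⟨e⟩ := nonempty_modularForm_equiv (Γ := Γ) (k := k)
  have : Subsingleton (ModularForm Γ k) := subsingleton_of_forall_eq 0 fun f ↦
    ModularForm.isZero_of_neg_weight hk f
  have := e.symm.injective.subsingleton
  exact (Submodule.subsingleton_iff_eq_bot).mp this

end Coset

end VectorValued

section CosetSum

open ModularGroup Filter Topology
open scoped Manifold ModularForm

lemma mdifferentiable_tsum {ι : Type} {f : ι → ℍ → ℂ} (hf : ∀ i, MDiff (f i))
    (h : ∀ A B : ℝ, 0 < B → ∃ u : ι → ℝ, Summable u ∧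
      ∀ i, ∀ z ∈ verticalStrip A B, z.im ≤ A → ‖f i z‖ ≤ u i) :
    MDiff (fun z ↦ ∑' i, f i z) := by
  intro τ
  rw [UpperHalfPlane.mdifferentiableAt_iff]
  set A : ℝ := |τ.re| + τ.im + 1
  set B : ℝ := τ.im / 2
  have hB : 0 < B := half_pos τ.im_pos
  obtain ⟨u, hu, hfu⟩ := h A B hB
  let U : Set ℂ := {w | |w.re| < A} ∩ {w | B < w.im} ∩ {w | w.im < A}
  have hU : IsOpen U := by
    refine ((isOpen_lt ?_ ?_).inter (isOpen_lt ?_ ?_)).inter (isOpen_lt ?_ ?_) <;> fun_prop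
  have hpos {w : ℂ} (hw : w ∈ U) : 0 < w.im := hB.trans hw.1.2
  have key : DifferentiableOn ℂ (fun w : ℂ ↦ ∑' i, (f i ∘ ofComplex) w) U := by
    refine Complex.differentiableOn_tsum_of_summable_norm hu (fun i ↦ ?_) hU fun i w hw ↦ ?_
    · exact (UpperHalfPlane.mdifferentiable_iff.mp (hf i)).mono fun w hw ↦ hpos hw
    · simp only [Function.comp_apply, ofComplex_apply_of_im_pos (hpos hw)]
      exact hfu i _ ⟨hw.1.1.le, hw.1.2.le⟩ hw.2.le
  refine (key.differentiableAt (hU.mem_nhds ⟨⟨?_, ?_⟩, ?_⟩))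
  · show |τ.re| < A
    have := τ.im_pos
    simp only [A]; linarith
  · show B < τ.im
    exact half_lt_self τ.im_pos
  · show τ.im < A
    have := abs_nonneg τ.re
    simp only [A]; linarith

lemma summable_norm_zpow_neg {k : ℤ} (hk : 3 ≤ k) :
    Summable fun p : Fin 2 → ℤ ↦ ‖p‖ ^ (-k) := by
  have : (2 : ℝ) < (k : ℝ) := by exact_mod_cast (by omega : (2 : ℤ) < k)
  refine (EisensteinSeries.summable_one_div_norm_rpow this).congr fun p ↦ ?_
  rw [← Real.rpow_intCast]; push_cast; rfl

/-- A matrix in `SL(2, ℤ)` with bottom row `p`, when the entries of `p` are coprime. -/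
noncomputable def rowMatrix (p : Fin 2 → ℤ) : SL(2, ℤ) :=
  open Classical in if h : IsCoprime (p 0) (p 1) then (h.exists_SL2_row 1).choose else 1

lemma rowMatrix_apply {p : Fin 2 → ℤ} (h : IsCoprime (p 0) (p 1)) (i : Fin 2) :
    rowMatrix p 1 i = p i := by
  have := (h.exists_SL2_row 1).choose_spec
  rw [rowMatrix, dif_pos h]
  fin_cases i
  exacts [this.1, this.2]

lemma eq_T_zpow_mul {γ δ : SL(2, ℤ)} (h : ∀ i, γ 1 i = δ 1 i) : ∃ n : ℤ, γ = T ^ n * δ := by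
  have e : ∀ i, (γ * δ⁻¹) 1 i = (1 : SL(2, ℤ)) 1 i := by
    intro i
    calc (γ * δ⁻¹) 1 i = ∑ j, γ 1 j * (δ⁻¹ : SL(2, ℤ)) j i := Matrix.mul_apply
      _ = ∑ j, δ 1 j * (δ⁻¹ : SL(2, ℤ)) j i := by simp only [h]
      _ = (δ * δ⁻¹) 1 i := Matrix.mul_apply.symm
      _ = _ := by rw [mul_inv_cancel]
  refine ⟨(γ * δ⁻¹) 0 1, ?_⟩
  rw [← mul_inv_eq_iff_eq_mul]
  have hdet := (γ * δ⁻¹).det_coe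
  have e0 := e 0
  have e1 := e 1
  generalize γ * δ⁻¹ = M at *
  rw [Matrix.det_fin_two] at hdet
  simp at e0 e1
  simp only [e0, e1, mul_one, mul_zero, sub_zero] at hdet
  ext i j
  rw [coe_T_zpow]
  fin_cases i <;> fin_cases j <;> simp [e0, e1, hdet]

lemma apply_eq_of_row_eq {g : SL(2, ℤ) → ℂ} (hg : ∀ δ, g (T * δ) = g δ) {γ δ : SL(2, ℤ)}
    (h : ∀ i, γ 1 i = δ 1 i) : g γ = g δ := by
  obtain ⟨n, rfl⟩ := eq_T_zpow_mul h
  have hn (n : ℕ) (δ) : g (T ^ n * δ) = g δ := by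
    induction n generalizing δ with
    | zero => simp
    | succ n ih => rw [pow_succ, mul_assoc, ih, hg]
  obtain ⟨m, rfl | rfl⟩ := n.eq_nat_or_neg
  · simpa using hn m δ
  · rw [← hn m (T ^ (-(m : ℤ)) * δ)]
    simp

/-- The term of the coset sum attached to the bottom row `p`. -/
noncomputable def cosetTerm (g : SL(2, ℤ) → ℂ) (p : Fin 2 → ℤ) : ℂ :=
  open Classical in if IsCoprime (p 0) (p 1) then g (rowMatrix p) else 0

/-- The sum over `⟨T⟩ \ SL(2, ℤ)` of a left `T`-invariant function. -/
noncomputable def cosetSum (g : SL(2, ℤ) → ℂ) : ℂ := ∑' p : Fin 2 → ℤ, cosetTerm g p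

lemma cosetTerm_of_not {g : SL(2, ℤ) → ℂ} {p : Fin 2 → ℤ} (h : ¬ IsCoprime (p 0) (p 1)) :
    cosetTerm g p = 0 := if_neg h

lemma cosetTerm_of_isCoprime {g : SL(2, ℤ) → ℂ} {p : Fin 2 → ℤ} (h : IsCoprime (p 0) (p 1)) :
    cosetTerm g p = g (rowMatrix p) := if_pos h

/-- Right multiplication by `γ` on row vectors. -/
def vecMulEquiv (γ : SL(2, ℤ)) : (Fin 2 → ℤ) ≃ (Fin 2 → ℤ) where
  toFun p := p ᵥ* (γ : Matrix (Fin 2) (Fin 2) ℤ)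
  invFun p := p ᵥ* ((γ⁻¹ : SL(2, ℤ)) : Matrix (Fin 2) (Fin 2) ℤ)
  left_inv p := by
    exact (vecMul_vecMul _ _ _).trans
      ((congrArg (p ᵥ* ·) (congrArg Subtype.val (mul_inv_cancel γ))).trans (vecMul_one p))
  right_inv p := by
    exact (vecMul_vecMul _ _ _).trans
      ((congrArg (p ᵥ* ·) (congrArg Subtype.val (inv_mul_cancel γ))).trans (vecMul_one p))

lemma cosetSum_mul_right {g : SL(2, ℤ) → ℂ} (hg : ∀ δ, g (T * δ) = g δ) (γ : SL(2, ℤ)) :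
    cosetSum (fun δ ↦ g (δ * γ)) = cosetSum g := by
  rw [cosetSum, cosetSum, ← (vecMulEquiv γ).tsum_eq (cosetTerm g)]
  refine tsum_congr fun p ↦ ?_
  by_cases h : IsCoprime (p 0) (p 1)
  · have h' : IsCoprime (vecMulEquiv γ p 0) (vecMulEquiv γ p 1) := h.vecMulSL γ
    rw [cosetTerm_of_isCoprime h, cosetTerm_of_isCoprime h']
    refine apply_eq_of_row_eq hg fun i ↦ ?_
    rw [rowMatrix_apply h']
    simp [vecMulEquiv, Matrix.mul_apply, vecMul, dotProduct, rowMatrix_apply h]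
  · have h' : ¬ IsCoprime (vecMulEquiv γ p 0) (vecMulEquiv γ p 1) := fun h' ↦ h <| by
      have := h'.vecMulSL γ⁻¹
      change IsCoprime ((vecMulEquiv γ).symm (vecMulEquiv γ p) 0)
        ((vecMulEquiv γ).symm (vecMulEquiv γ p) 1) at this
      simpa using this
    rw [cosetTerm_of_not h, cosetTerm_of_not h']

lemma cosetSum_eq_add {g : SL(2, ℤ) → ℂ} (hg : ∀ δ, g (T * δ) = g δ)
    (hs : Summable (cosetTerm g)) :
    cosetSum g = g 1 + g (-1) + ∑' p : Fin 2 → ℤ, if p 0 = 0 then 0 else cosetTerm g p := by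
  classical
  have hr : Summable fun p : Fin 2 → ℤ ↦ if p 0 = 0 then 0 else cosetTerm g p := by
    refine (hs.indicator {p | p 0 ≠ 0}).congr fun p ↦ ?_
    by_cases h : p 0 = 0 <;> simp [h]
  have key := ((hasSum_ite_eq (![0, 1] : Fin 2 → ℤ) (g 1)).add
    (hasSum_ite_eq (![0, -1] : Fin 2 → ℤ) (g (-1)))).add hr.hasSum
  rw [← key.tsum_eq]
  refine tsum_congr fun p ↦ ?_
  have ext_iff (d : ℤ) : p = ![0, d] ↔ p 0 = 0 ∧ p 1 = d := by
    simp [funext_iff, Fin.forall_fin_two]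
  by_cases h0 : p 0 = 0
  · by_cases hc : IsCoprime (p 0) (p 1)
    · rw [cosetTerm_of_isCoprime hc]
      have hrow := rowMatrix_apply hc
      rw [h0, isCoprime_zero_left, Int.isUnit_iff] at hc
      rcases hc with h1 | h1
      · rw [apply_eq_of_row_eq hg (δ := 1) fun i ↦ by
          rw [hrow]; fin_cases i <;> simp [h0, h1]]
        simp [ext_iff, h0, h1]
      · rw [apply_eq_of_row_eq hg (δ := -1) fun i ↦ by
          rw [hrow]; fin_cases i <;> simp [h0, h1]]
        simp [ext_iff, h0, h1]
    · rw [cosetTerm_of_not hc]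
      rw [h0, isCoprime_zero_left, Int.isUnit_iff, not_or] at hc
      simp [ext_iff, h0, hc]
  · simp [ext_iff, h0]

lemma autFactor_rowMatrix {p : Fin 2 → ℤ} (h : IsCoprime (p 0) (p 1)) (z : ℍ) :
    autFactor (rowMatrix p) z = p 0 * z + p 1 := by
  simp [autFactor, rowMatrix_apply h]

lemma exists_le_norm_autFactor (A : ℝ) {B : ℝ} (hB : 0 < B) : ∃ r : ℝ, 0 < r ∧
    ∀ p : Fin 2 → ℤ, IsCoprime (p 0) (p 1) → ∀ z ∈ verticalStrip A B,
      1 ≤ ‖p‖ ∧ r * ‖p‖ ≤ ‖autFactor (rowMatrix p) z‖ := by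
  refine ⟨EisensteinSeries.r ⟨⟨A, B⟩, hB⟩, EisensteinSeries.r_pos _, fun p hp z hz ↦ ?_⟩
  have hp0 : p ≠ 0 := by
    rintro rfl
    exact not_isCoprime_zero_zero hp
  constructor
  · rw [EisensteinSeries.norm_eq_max_natAbs]
    have : p 0 ≠ 0 ∨ p 1 ≠ 0 := by
      by_contra! h
      exact hp0 (funext fun i ↦ by fin_cases i <;> simp [h])
    have : 1 ≤ max (p 0).natAbs (p 1).natAbs := by
      rcases this with h | h
      · exact le_max_of_le_left (Int.natAbs_pos.mpr h)
      · exact le_max_of_le_right (Int.natAbs_pos.mpr h)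
    exact_mod_cast this
  · rw [autFactor_rowMatrix hp]
    exact (mul_le_mul_of_nonneg_right (EisensteinSeries.r_lower_bound_on_verticalStrip z hB hz)
      (norm_nonneg _)).trans (EisensteinSeries.r_mul_max_le z hp0)

lemma im_smul_eq_autFactor (γ : SL(2, ℤ)) (z : ℍ) :
    (γ • z).im = z.im / ‖autFactor γ z‖ ^ 2 := by
  rw [ModularGroup.im_smul_eq_div_normSq, autFactor_eq_denom, ← Complex.normSq_eq_norm_sq]

lemma im_le_norm_autFactor {γ : SL(2, ℤ)} (h : γ 1 0 ≠ 0) (z : ℍ) :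
    z.im ≤ ‖autFactor γ z‖ := by
  have h1 : (autFactor γ z).im = γ 1 0 * z.im := by simp [autFactor]
  have h2 : (1 : ℝ) ≤ |(γ 1 0 : ℝ)| := by exact_mod_cast Int.one_le_abs h
  calc z.im ≤ |(γ 1 0 : ℝ)| * z.im := le_mul_of_one_le_left z.im_pos.le h2
    _ = |(autFactor γ z).im| := by rw [h1, abs_mul, abs_of_pos z.im_pos]
    _ ≤ _ := Complex.abs_im_le_norm _

end CosetSum

section Poincare

open ModularGroup Filter Topology
open scoped Manifold ModularForm

variable {X : Type} [MulAction SL(2, ℤ) X]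

lemma apply_T_zpow {F : X → ℍ → ℂ} (hF : ∀ x z, F (T • x) (T • z) = F x z) (n : ℤ) (x : X)
    (z : ℍ) : F (T ^ n • x) (T ^ n • z) = F x z := by
  have hn (n : ℕ) (x z) : F (T ^ n • x) (T ^ n • z) = F x z := by
    induction n generalizing x z with
    | zero => simp
    | succ n ih => rw [pow_succ, mul_smul, mul_smul, ih, hF]
  obtain ⟨m, rfl | rfl⟩ := n.eq_nat_or_neg
  · simpa using hn m x z
  · rw [← hn m (T ^ (-(m : ℤ)) • x)]
    simp

lemma T_zpow_mul_smul {N : ℕ} (hT : ∀ x : X, T ^ N • x = x) (n : ℤ) (x : X) :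
    T ^ ((N : ℤ) * n) • x = x := by
  have h : T ^ N ∈ MulAction.stabilizer SL(2, ℤ) x := hT x
  rw [_root_.zpow_mul, zpow_natCast]
  exact zpow_mem h n

lemma isZeroAtImInfty_of_strip {f : ℍ → ℂ} {N : ℕ} (hN : 0 < N)
    (hper : ∀ (n : ℤ) z, f (T ^ ((N : ℤ) * n) • z) = f z)
    (h : Tendsto f (atImInfty ⊓ 𝓟 (verticalStrip N 1)) (𝓝 0)) : IsZeroAtImInfty f := by
  rw [isZeroAtImInfty_iff]
  intro ε hε
  have h1 := h.eventually (Metric.closedBall_mem_nhds (0 : ℂ) hε)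
  rw [Filter.eventually_inf_principal] at h1
  obtain ⟨A, hA⟩ := (atImInfty_mem _).mp h1
  refine ⟨max A 1, fun z hz ↦ ?_⟩
  obtain ⟨n, hn⟩ := ModularGroup_T_zpow_mem_verticalStrip z hN
  have := hA (T ^ ((N : ℤ) * n) • z) ((le_max_left _ _).trans (hz.trans hn.2))
    ⟨hn.1, (le_max_right _ _).trans (hz.trans hn.2)⟩
  rw [hper, dist_zero_right] at this
  exact this

/-- Conditions on a family of functions ensuring that its Poincaré series converges. -/
structure IsSeed (ψ : X → ℍ → ℂ) : Prop where
  mdiff : ∀ x, MDiff (ψ x)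
  T_smul : ∀ x z, ψ (T • x) (T • z) = ψ x z
  bdd : ∀ B : ℝ, ∃ C : ℝ, 0 ≤ C ∧ ∀ x z, z.im ≤ B → ‖ψ x z‖ ≤ C

/-- The Poincaré series of weight `k` attached to a seed. -/
noncomputable def poincareSeries (k : ℤ) (ψ : X → ℍ → ℂ) (x : X) (z : ℍ) : ℂ :=
  cosetSum fun δ ↦ ψ (δ • x) (δ • z) * autFactor δ z ^ (-k)

variable {ψ : X → ℍ → ℂ} {k : ℤ}

lemma norm_zpow_neg_le {k : ℤ} (hk : 0 ≤ k) {a : ℝ} {w : ℂ} (ha : 0 < a) (haw : a ≤ ‖w‖) :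
    ‖w ^ (-k)‖ ≤ a ^ (-k) := by
  obtain ⟨n, rfl⟩ := Int.eq_ofNat_of_zero_le hk
  rw [norm_zpow, _root_.zpow_neg, _root_.zpow_neg, zpow_natCast, zpow_natCast]
  gcongr

lemma IsSeed.summand_T (hψ : IsSeed ψ) (k : ℤ) (x : X) (z : ℍ) (δ : SL(2, ℤ)) :
    ψ ((T * δ) • x) ((T * δ) • z) * autFactor (T * δ) z ^ (-k) =
      ψ (δ • x) (δ • z) * autFactor δ z ^ (-k) := by
  rw [mul_smul, mul_smul, hψ.T_smul, autFactor_mul, autFactor_T, one_mul]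

lemma IsSeed.exists_bound (hψ : IsSeed ψ) (hk : 3 ≤ k) (A : ℝ) {B : ℝ} (hB : 0 < B) (A' : ℝ) :
    ∃ u : (Fin 2 → ℤ) → ℝ, Summable u ∧ ∀ p x, ∀ z ∈ verticalStrip A B, z.im ≤ A' →
      ‖cosetTerm (fun δ ↦ ψ (δ • x) (δ • z) * autFactor δ z ^ (-k)) p‖ ≤ u p := by
  obtain ⟨r, hr, hle⟩ := exists_le_norm_autFactor A hB
  obtain ⟨C, hC, hCψ⟩ := hψ.bdd (A' / r ^ 2)
  refine ⟨fun p ↦ C * (r ^ (-k) * ‖p‖ ^ (-k)), ((summable_norm_zpow_neg hk).mul_left _).mul_left _,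
    fun p x z hz hzA ↦ ?_⟩
  by_cases hp : IsCoprime (p 0) (p 1)
  · obtain ⟨h1, h2⟩ := hle p hp z hz
    have h3 : r ≤ ‖autFactor (rowMatrix p) z‖ := (le_mul_of_one_le_right hr.le h1).trans h2
    rw [cosetTerm_of_isCoprime hp, norm_mul]
    refine mul_le_mul (hCψ _ _ ?_) ?_ (norm_nonneg _) hC
    · rw [im_smul_eq_autFactor]
      have := z.im_pos.le.trans hzA
      gcongr
    · rw [← mul_zpow]
      exact norm_zpow_neg_le (by omega) (by positivity) h2
  · rw [cosetTerm_of_not hp, norm_zero]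
    positivity

lemma IsSeed.summable (hψ : IsSeed ψ) (hk : 3 ≤ k) (x : X) (z : ℍ) :
    Summable (cosetTerm (fun δ ↦ ψ (δ • x) (δ • z) * autFactor δ z ^ (-k))) := by
  obtain ⟨u, hu, h⟩ := hψ.exists_bound hk |z.re| z.im_pos z.im
  exact hu.of_norm_bounded fun p ↦ h p x z ⟨le_rfl, le_rfl⟩ le_rfl

lemma IsSeed.mdifferentiable (hψ : IsSeed ψ) (hk : 3 ≤ k) (x : X) :
    MDiff (poincareSeries k ψ x) := by
  refine mdifferentiable_tsum (f := fun p z ↦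
    cosetTerm (fun δ ↦ ψ (δ • x) (δ • z) * autFactor δ z ^ (-k)) p) (fun p ↦ ?_) fun A B hB ↦ ?_
  · by_cases hp : IsCoprime (p 0) (p 1)
    · simp only [cosetTerm_of_isCoprime hp, ← slash_eq_autFactor]
      exact (hψ.mdiff _).slash k _
    · simp only [cosetTerm_of_not hp]
      exact mdifferentiable_const
  · obtain ⟨u, hu, h⟩ := hψ.exists_bound hk A hB A
    exact ⟨u, hu, fun p z hz hz' ↦ h p x z hz hz'⟩

lemma IsSeed.poincareSeries_mem (hψ : IsSeed ψ) (hk : 3 ≤ k) :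
    poincareSeries k ψ ∈ equivariantFamily X k := by
  refine ⟨hψ.mdifferentiable hk, fun γ x z ↦ ?_⟩
  have h := cosetSum_mul_right (g := fun δ ↦ ψ (δ • x) (δ • z) * autFactor δ z ^ (-k)) (hψ.summand_T k x z) γ
  rw [poincareSeries, poincareSeries, ← h, cosetSum, cosetSum, ← tsum_mul_left]
  refine tsum_congr fun p ↦ ?_
  by_cases hp : IsCoprime (p 0) (p 1)
  · rw [cosetTerm_of_isCoprime hp, cosetTerm_of_isCoprime hp, mul_smul, mul_smul, autFactor_mul,
      mul_zpow, _root_.zpow_neg (autFactor γ z)]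
    have := zpow_ne_zero k (autFactor_ne_zero γ z)
    field_simp
  · rw [cosetTerm_of_not hp, cosetTerm_of_not hp, mul_zero]

lemma IsSeed.poincareSeries_eq_add (hψ : IsSeed ψ) (hk : 3 ≤ k) (x : X) (z : ℍ) :
    poincareSeries k ψ x z = ψ x z + (-1) ^ k * ψ ((-1 : SL(2, ℤ)) • x) z +
      ∑' p : Fin 2 → ℤ, if p 0 = 0 then 0 else
        cosetTerm (fun δ ↦ ψ (δ • x) (δ • z) * autFactor δ z ^ (-k)) p := by
  rw [poincareSeries, cosetSum_eq_add (hψ.summand_T k x z) (hψ.summable hk x z)]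
  congr 2
  · simp
  · rw [neg_one_smul_uhp, autFactor_neg, autFactor_one, mul_comm]
    congr 1
    rw [_root_.zpow_neg, ← _root_.inv_zpow]
    norm_num

lemma IsSeed.tendsto_tsum (hψ : IsSeed ψ) (hk : 3 ≤ k) (x : X) (N : ℝ) :
    Tendsto (fun z : ℍ ↦ ∑' p : Fin 2 → ℤ, if p 0 = 0 then 0 else
        cosetTerm (fun δ ↦ ψ (δ • x) (δ • z) * autFactor δ z ^ (-k)) p)
      (atImInfty ⊓ 𝓟 (verticalStrip N 1)) (𝓝 0) := by
  obtain ⟨r, hr, hle⟩ := exists_le_norm_autFactor N one_pos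
  obtain ⟨C, hC, hCψ⟩ := hψ.bdd 1
  have hbd {p : Fin 2 → ℤ} (hp : IsCoprime (p 0) (p 1)) (h0 : p 0 ≠ 0) {z : ℍ}
      (hz : z ∈ verticalStrip N 1) : ‖ψ (rowMatrix p • x) (rowMatrix p • z)‖ ≤ C := by
    refine hCψ _ _ ?_
    have h1 := im_le_norm_autFactor (γ := rowMatrix p) (by rwa [rowMatrix_apply hp]) z
    have h2 : 1 ≤ z.im := hz.2
    rw [im_smul_eq_autFactor, div_le_one (pow_pos (norm_pos_iff.mpr (autFactor_ne_zero _ _)) 2)]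
    nlinarith
  have hev : ∀ᶠ z in atImInfty ⊓ 𝓟 (verticalStrip N 1), z ∈ verticalStrip N 1 :=
    Filter.mem_inf_of_right (mem_principal_self _)
  suffices h : Tendsto (fun z : ℍ ↦ ∑' p : Fin 2 → ℤ, if p 0 = 0 then 0 else
      cosetTerm (fun δ ↦ ψ (δ • x) (δ • z) * autFactor δ z ^ (-k)) p)
      (atImInfty ⊓ 𝓟 (verticalStrip N 1)) (𝓝 (∑' _ : Fin 2 → ℤ, 0)) by
    rwa [tsum_zero] at h
  refine tendsto_tsum_of_dominated_convergence
    (bound := fun p ↦ C * (r ^ (-k) * ‖p‖ ^ (-k)))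
    (((summable_norm_zpow_neg hk).mul_left _).mul_left _) (fun p ↦ ?_) ?_
  · by_cases h0 : p 0 = 0
    · simpa [h0] using tendsto_const_nhds
    by_cases hp : IsCoprime (p 0) (p 1)
    · simp only [h0, if_false, cosetTerm_of_isCoprime hp]
      have him : Tendsto (fun z : ℍ ↦ C * z.im ^ (-k)) (atImInfty ⊓ 𝓟 (verticalStrip N 1))
          (𝓝 0) := by
        have : Tendsto (fun z : ℍ ↦ z.im) atImInfty atTop := tendsto_comap
        have h3 := (tendsto_zpow_atTop_zero (𝕜 := ℝ) (n := -k) (by omega)).comp this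
        simpa using (h3.mono_left inf_le_left).const_mul C
      refine squeeze_zero_norm' ?_ him
      filter_upwards [hev] with z hz
      rw [norm_mul]
      refine mul_le_mul (hbd hp h0 hz) (norm_zpow_neg_le (by omega) z.im_pos ?_)
        (norm_nonneg _) hC
      exact im_le_norm_autFactor (by rwa [rowMatrix_apply hp]) z
    · simpa [cosetTerm_of_not hp] using tendsto_const_nhds
  · filter_upwards [hev] with z hz p
    by_cases h0 : p 0 = 0
    · simp only [h0, if_true, norm_zero]
      positivity
    by_cases hp : IsCoprime (p 0) (p 1)
    · simp only [h0, if_false, cosetTerm_of_isCoprime hp]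
      obtain ⟨h1, h2⟩ := hle p hp z hz
      rw [norm_mul, ← mul_zpow]
      exact mul_le_mul (hbd hp h0 hz) (norm_zpow_neg_le (by omega) (by positivity) h2)
        (norm_nonneg _) hC
    · simp only [h0, if_false, cosetTerm_of_not hp, norm_zero]
      positivity

lemma IsSeed.isZeroAtImInfty_sub (hψ : IsSeed ψ) (hk : 3 ≤ k) {N : ℕ} (hN : 0 < N)
    (hT : ∀ x : X, T ^ N • x = x) (x : X) :
    IsZeroAtImInfty fun z ↦
      poincareSeries k ψ x z - (ψ x z + (-1) ^ k * ψ ((-1 : SL(2, ℤ)) • x) z) := by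
  refine isZeroAtImInfty_of_strip hN (fun n z ↦ ?_) ?_
  · have h1 : ∀ x z, poincareSeries k ψ (T • x) (T • z) = poincareSeries k ψ x z := fun x z ↦ by
      rw [(hψ.poincareSeries_mem hk).2, autFactor_T, _root_.one_zpow, one_mul]
    have e (F : X → ℍ → ℂ) (hF : ∀ x z, F (T • x) (T • z) = F x z) (x) :
        F x (T ^ ((N : ℤ) * n) • z) = F x z := by
      conv_lhs => rw [← T_zpow_mul_smul hT n x]
      exact apply_T_zpow hF _ x z
    rw [e _ h1, e _ hψ.T_smul, e _ hψ.T_smul]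
  · simp only [hψ.poincareSeries_eq_add hk, add_sub_cancel_left]
    exact hψ.tendsto_tsum hk x N

end Poincare

section QExpansions

open ModularGroup Filter Topology Asymptotics
open scoped Manifold ModularForm

/-- The local parameter `exp (2πiz/N)` on the upper half-plane. -/
noncomputable def qLocal (N : ℕ) (z : ℍ) : ℂ := Function.Periodic.qParam N z

/-- Holomorphic functions on `ℍ` of period `N` that are bounded at `i∞`. -/
structure IsQSeries (N : ℕ) (f : ℍ → ℂ) : Prop where
  vadd : ∀ z, f ((N : ℝ) +ᵥ z) = f z
  mdiff : MDiff f
  bdd : IsBoundedAtImInfty f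

/-- The `n`-th Fourier coefficient of a function of period `N`. -/
noncomputable def qCoeff (N n : ℕ) (f : ℍ → ℂ) : ℂ := (qExpansion N f).coeff n

variable {N : ℕ}

lemma qLocal_ne_zero (z : ℍ) : qLocal N z ≠ 0 := Function.Periodic.qParam_ne_zero _

lemma mdifferentiable_qLocal : MDiff (qLocal N) := by
  rw [UpperHalfPlane.mdifferentiable_iff]
  have h : Differentiable ℂ (Function.Periodic.qParam N) :=
    Function.Periodic.differentiable_qParam
  refine h.differentiableOn.congr fun z hz ↦ ?_
  simp [qLocal, ofComplex_apply_of_im_pos hz]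

lemma qLocal_vadd_nat (hN : 0 < N) (j : ℕ) (z : ℍ) :
    qLocal N ((j : ℝ) +ᵥ z) = Complex.exp (2 * Real.pi * Complex.I / N) ^ j * qLocal N z := by
  simp only [qLocal, Function.Periodic.qParam, coe_vadd, ← Complex.exp_nat_mul, ← Complex.exp_add]
  congr 1
  push_cast
  have : (N : ℂ) ≠ 0 := by exact_mod_cast hN.ne'
  field_simp

lemma exp_two_pi_div_pow (hN : 0 < N) : Complex.exp (2 * Real.pi * Complex.I / N) ^ N = 1 :=
  (Complex.isPrimitiveRoot_exp N hN.ne').pow_eq_one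

lemma qLocal_vadd (hN : 0 < N) (z : ℍ) : qLocal N ((N : ℝ) +ᵥ z) = qLocal N z := by
  rw [qLocal_vadd_nat hN, exp_two_pi_div_pow hN, one_mul]

lemma qLocal_pow_self (hN : 0 < N) (z : ℍ) : qLocal N z ^ N = qLocal 1 z := by
  simp only [qLocal, Function.Periodic.qParam, ← Complex.exp_nat_mul]
  congr 1
  push_cast
  have : (N : ℂ) ≠ 0 := by exact_mod_cast hN.ne'
  field_simp

lemma tendsto_qLocal (hN : 0 < N) : Tendsto (qLocal N) atImInfty (𝓝 0) :=
  qParam_tendsto_atImInfty (by exact_mod_cast hN)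

lemma norm_qLocal (z : ℍ) : ‖qLocal N z‖ = Real.exp (-2 * Real.pi * z.im / N) :=
 by
  simpa [qLocal] using Function.Periodic.norm_qParam N (z : ℂ)

namespace IsQSeries

variable {f g : ℍ → ℂ}

lemma of_vadd_one (h : ∀ z, f ((1 : ℝ) +ᵥ z) = f z) (n : ℕ) (z : ℍ) : f ((n : ℝ) +ᵥ z) = f z := by
  induction n with
  | zero => simp
  | succ n ih =>
    push_cast
    rw [add_comm, add_vadd, h, ih]

lemma periodic (hf : IsQSeries N f) : Function.Periodic (f ∘ ofComplex) (N : ℝ) := by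
  intro w
  by_cases! hw : 0 < w.im
  · have : 0 < (w + (N : ℝ)).im := by simp [hw]
    simp only [Function.comp_apply, ofComplex_apply_of_im_pos this, ofComplex_apply_of_im_pos hw]
    convert! hf.vadd ⟨w, hw⟩ using 2
    ext
    simp [add_comm]
  · have : (w + (N : ℝ)).im ≤ 0 := by simpa using hw
    rw [Function.comp_apply, Function.comp_apply, ofComplex_apply_of_im_nonpos this,
      ofComplex_apply_of_im_nonpos hw]

lemma add (hf : IsQSeries N f) (hg : IsQSeries N g) : IsQSeries N (f + g) :=
  ⟨fun z ↦ by simp [hf.vadd, hg.vadd], hf.mdiff.add hg.mdiff, hf.bdd.add hg.bdd⟩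

lemma smul (hf : IsQSeries N f) (c : ℂ) : IsQSeries N (c • f) :=
  ⟨fun z ↦ by simp [hf.vadd], hf.mdiff.const_smul c, hf.bdd.smul c⟩

lemma mul (hf : IsQSeries N f) (hg : IsQSeries N g) : IsQSeries N (f * g) :=
  ⟨fun z ↦ by simp [hf.vadd, hg.vadd], hf.mdiff.mul hg.mdiff, hf.bdd.mul hg.bdd⟩

lemma const (c : ℂ) : IsQSeries N fun _ ↦ c :=
  ⟨fun _ ↦ rfl, mdifferentiable_const, Filter.const_boundedAtFilter _ c⟩

lemma zero : IsQSeries N 0 := const 0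

lemma sum {ι : Type*} {s : Finset ι} {F : ι → ℍ → ℂ} (h : ∀ i ∈ s, IsQSeries N (F i)) :
    IsQSeries N (∑ i ∈ s, F i) := by
  classical
  induction s using Finset.induction_on with
  | empty => simpa using zero
  | insert a s ha ih =>
    rw [Finset.sum_insert ha]
    exact (h a (by simp)).add (ih fun i hi ↦ h i (by simp [hi]))

lemma localParam (hN : 0 < N) : IsQSeries N (qLocal N) :=
  ⟨qLocal_vadd hN, mdifferentiable_qLocal, (tendsto_qLocal hN).isBigO_one ℝ⟩

lemma pow (hf : IsQSeries N f) (n : ℕ) : IsQSeries N (f ^ n) := by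
  induction n with
  | zero => exact const 1
  | succ n ih => rw [pow_succ]; exact ih.mul hf

section

variable (hN : 0 < N)
include hN

lemma analyticAt (hf : IsQSeries N f) : AnalyticAt ℂ (cuspFunction N f) 0 :=
  analyticAt_cuspFunction_zero (by exact_mod_cast hN) hf.periodic hf.mdiff hf.bdd

lemma hasSum (hf : IsQSeries N f) (z : ℍ) :
    HasSum (fun n ↦ qCoeff N n f * qLocal N z ^ n) (f z) :=
  z.hasSum_qExpansion (by exact_mod_cast hN) hf.periodic hf.mdiff hf.bdd

lemma qCoeff_unique (hf : IsQSeries N f) {c : ℕ → ℂ}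
    (h : ∀ z, HasSum (fun n ↦ c n * qLocal N z ^ n) (f z)) (n : ℕ) : qCoeff N n f = c n := by
  have hN' : (0 : ℝ) < N := by exact_mod_cast hN
  have h1 := (hasFPowerSeriesOnBall_cuspFunction hN' (hf.analyticAt hN) h).hasFPowerSeriesAt
  have h2 := (hasFPowerSeriesOnBall_cuspFunction hN' (hf.analyticAt hN)
    (hf.hasSum hN)).hasFPowerSeriesAt
  simpa using congr_arg (FormalMultilinearSeries.coeff · n) (h2.eq_formalMultilinearSeries h1)

lemma qCoeff_add (hf : IsQSeries N f) (hg : IsQSeries N g) (n : ℕ) :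
    qCoeff N n (f + g) = qCoeff N n f + qCoeff N n g := by
  simp [qCoeff, qExpansion_add (hf.analyticAt hN) (hg.analyticAt hN)]

lemma qCoeff_smul (hf : IsQSeries N f) (c : ℂ) (n : ℕ) :
    qCoeff N n (c • f) = c * qCoeff N n f := by
  simp [qCoeff, qExpansion_smul (hf.analyticAt hN)]

lemma qCoeff_mul (hf : IsQSeries N f) (hg : IsQSeries N g) (n : ℕ) :
    qCoeff N n (f * g) =
      ∑ p ∈ Finset.HasAntidiagonal.antidiagonal n, qCoeff N p.1 f * qCoeff N p.2 g := by
  simp only [qCoeff, qExpansion_mul (hf.analyticAt hN) (hg.analyticAt hN), PowerSeries.coeff_mul]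

omit hN in
lemma qCoeff_zero (n : ℕ) : qCoeff N n 0 = 0 := by simp [qCoeff, qExpansion_zero]

lemma qCoeff_sum {ι : Type*} {s : Finset ι} {F : ι → ℍ → ℂ} (h : ∀ i ∈ s, IsQSeries N (F i))
    (n : ℕ) : qCoeff N n (∑ i ∈ s, F i) = ∑ i ∈ s, qCoeff N n (F i) := by
  classical
  induction s using Finset.induction_on with
  | empty => simpa using qCoeff_zero n
  | insert a s ha ih =>
    rw [Finset.sum_insert ha, Finset.sum_insert ha,
      (h a (by simp)).qCoeff_add hN (sum fun i hi ↦ h i (by simp [hi])),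
      ih fun i hi ↦ h i (by simp [hi])]

/-- A function with the same first `M` Fourier coefficients as a polynomial in `q`. -/
lemma qCoeff_of_eq (hf : IsQSeries N f) (hg : IsQSeries N g) {M : ℕ} {c : ℕ → ℂ}
    (h : ∀ z, f z = ∑ n ∈ Finset.range M, c n * qLocal N z ^ n +
      qLocal N z ^ M * g z) {n : ℕ} (hn : n < M) : qCoeff N n f = c n := by
  rw [hf.qCoeff_unique hN (c := fun n ↦ if n < M then c n else qCoeff N (n - M) g) (fun z ↦ ?_),
    if_pos hn]
  have hsum : ∑ n ∈ Finset.range M, (if n < M then c n else qCoeff N (n - M) g) * qLocal N z ^ n =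
      ∑ n ∈ Finset.range M, c n * qLocal N z ^ n :=
    Finset.sum_congr rfl fun n hn ↦ by simp only [if_pos (Finset.mem_range.mp hn)]
  rw [← hasSum_nat_add_iff' M, h z, hsum, add_sub_cancel_left]
  refine ((hg.hasSum hN z).mul_left (qLocal N z ^ M)).congr_fun fun m ↦ ?_
  rw [if_neg (by omega), Nat.add_sub_cancel, pow_add]
  ring

lemma exists_eq_pow_mul (hf : IsQSeries N f) {M : ℕ} (h : ∀ n < M, qCoeff N n f = 0) :
    ∃ g, IsQSeries N g ∧ ∀ z, f z = qLocal N z ^ M * g z := by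
  have h0 (z : ℍ) := pow_ne_zero M (qLocal_ne_zero (N := N) z)
  have key (z : ℍ) : f z = qLocal N z ^ M * (f z / qLocal N z ^ M) :=
    (mul_div_cancel₀ _ (h0 z)).symm
  refine ⟨fun z ↦ f z / qLocal N z ^ M, ⟨fun z ↦ ?_, ?_, ?_⟩, key⟩
  · rw [hf.vadd, qLocal_vadd hN]
  · have hinv : MDiff fun z ↦ (qLocal N z ^ M)⁻¹ := by
      have h1 := (mdifferentiable_qLocal (N := N)).pow M
      rw [UpperHalfPlane.mdifferentiable_iff] at h1 ⊢
      exact h1.inv fun z hz ↦ h0 _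
    exact hf.mdiff.mul hinv
  · refine isBoundedAtImInfty_of_hasSum_qExpansion (h := N) (c := fun n ↦ qCoeff N (n + M) f)
      (by exact_mod_cast hN) fun z ↦ ?_
    have h1 := (hasSum_nat_add_iff' M).mpr (hf.hasSum hN z)
    rw [Finset.sum_eq_zero fun n hn ↦ by rw [h n (Finset.mem_range.mp hn), zero_mul], sub_zero]
      at h1
    refine (h1.div_const (qLocal N z ^ M)).congr_fun fun n ↦ ?_
    rw [pow_add, ← mul_assoc, mul_div_assoc, div_self (h0 z), mul_one]
    rfl

lemma qCoeff_zero_eq_zero_iff (hf : IsQSeries N f) : qCoeff N 0 f = 0 ↔ IsZeroAtImInfty f := by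
  rw [qCoeff, qExpansion_coeff_zero (by exact_mod_cast hN) (hf.analyticAt hN) hf.periodic]
  refine ⟨fun h ↦ ?_, fun h ↦ h.valueAtInfty_eq_zero⟩
  have := exp_decay_sub_atImInfty (by exact_mod_cast hN) hf.periodic hf.mdiff hf.bdd
  simp only [h, sub_zero] at this
  refine this.trans_tendsto ?_
  have h2 := (tendsto_qLocal hN).norm
  simpa [norm_qLocal] using h2

end

end IsQSeries

lemma exists_isQSeries_of_tendsto {f : ℍ → ℂ} (hN : 0 < N) (h1 : ∀ z, f ((N : ℝ) +ᵥ z) = f z)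
    (h2 : MDiff f) (h3 : Tendsto (fun z ↦ f z * qLocal N z) atImInfty (𝓝 0)) : IsQSeries N f := by
  have hg : IsQSeries N fun z ↦ f z * qLocal N z :=
    ⟨fun z ↦ by rw [h1, qLocal_vadd hN], h2.mul mdifferentiable_qLocal, h3.isBigO_one ℝ⟩
  obtain ⟨g, hg1, hg2⟩ := hg.exists_eq_pow_mul hN (M := 1) fun n hn ↦ by
    obtain rfl : n = 0 := by omega
    exact (hg.qCoeff_zero_eq_zero_iff hN).mpr h3
  convert hg1
  funext z
  have := hg2 z
  rw [pow_one, mul_comm] at this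
  exact mul_left_cancel₀ (qLocal_ne_zero z) this

end QExpansions

section Eigen

open ModularGroup Filter Topology
open scoped Manifold ModularForm

/-- The standard primitive `N`-th root of unity. -/
noncomputable def zetaN (N : ℕ) : ℂ := Complex.exp (2 * Real.pi * Complex.I / N)

lemma zetaN_ne_zero (N : ℕ) : zetaN N ≠ 0 := Complex.exp_ne_zero _

lemma zetaN_pow_self {N : ℕ} (hN : 0 < N) : zetaN N ^ N = 1 := exp_two_pi_div_pow hN

lemma zetaN_isPrimitiveRoot {N : ℕ} (hN : 0 < N) : IsPrimitiveRoot (zetaN N) N :=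
  Complex.isPrimitiveRoot_exp N hN.ne'

variable (X : Type) [MulAction SL(2, ℤ) X]

/-- Functions on `X` that are odd under `-1`. -/
def oddFunctions : Submodule ℂ (X → ℂ) where
  carrier := {v | ∀ x, v ((-1 : SL(2, ℤ)) • x) = -v x}
  add_mem' hv hw x := by simp [hv x, hw x]; ring
  zero_mem' x := by simp
  smul_mem' c v hv x := by simp [hv x]

/-- Odd functions `v` with `v (T • x) * ζ ^ n = v x`. -/
def eigenFunctions (N n : ℕ) : Submodule ℂ (X → ℂ) where
  carrier := {v | v ∈ oddFunctions X ∧ ∀ x, v (T • x) * zetaN N ^ n = v x}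
  add_mem' hv hw := ⟨add_mem hv.1 hw.1, fun x ↦ by simp [add_mul, hv.2 x, hw.2 x]⟩
  zero_mem' := ⟨zero_mem _, fun x ↦ by simp⟩
  smul_mem' c v hv := ⟨Submodule.smul_mem _ c hv.1, fun x ↦ by simp [mul_assoc, hv.2 x]⟩

variable {X}

/-- The projection onto `eigenFunctions X N n`. -/
noncomputable def eigenProj (N n : ℕ) : (X → ℂ) →ₗ[ℂ] (X → ℂ) where
  toFun v x := (N : ℂ)⁻¹ * ∑ j ∈ Finset.range N, zetaN N ^ (n * j) * v (T ^ j • x)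
  map_add' v w := by
    ext x
    simp [mul_add, Finset.sum_add_distrib]
  map_smul' c v := by
    ext x
    simp only [Pi.smul_apply, smul_eq_mul, RingHom.id_apply, Finset.mul_sum]
    exact Finset.sum_congr rfl fun j _ ↦ by ring

lemma eigenProj_apply (N n : ℕ) (v : X → ℂ) (x : X) : eigenProj N n v x =
    (N : ℂ)⁻¹ * ∑ j ∈ Finset.range N, zetaN N ^ (n * j) * v (T ^ j • x) := rfl

lemma smul_neg_one_comm (γ : SL(2, ℤ)) (x : X) :
    γ • (-1 : SL(2, ℤ)) • x = (-1 : SL(2, ℤ)) • γ • x := by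
  rw [← mul_smul, ← mul_smul, mul_neg, neg_mul, mul_one, one_mul]

variable {N : ℕ} (hN : 0 < N) (hT : ∀ x : X, T ^ N • x = x)

include hN hT in
lemma eigenProj_mem (n : ℕ) {v : X → ℂ} (hv : v ∈ oddFunctions X) :
    eigenProj N n v ∈ eigenFunctions X N n := by
  refine ⟨fun x ↦ ?_, fun x ↦ ?_⟩
  · simp only [eigenProj_apply, smul_neg_one_comm, hv _, mul_neg, Finset.sum_neg_distrib]
  · rw [eigenProj_apply, eigenProj_apply, mul_assoc]
    congr 1
    have h := Finset.sum_range_succ' (fun j ↦ zetaN N ^ (n * j) * v (T ^ j • x)) N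
    rw [Finset.sum_range_succ, hT, mul_comm n N, pow_mul, zetaN_pow_self hN] at h
    simp only [one_pow, one_mul, mul_zero, pow_zero, one_smul] at h
    rw [add_right_cancel h, Finset.sum_mul]
    refine Finset.sum_congr rfl fun j _ ↦ ?_
    rw [pow_succ, mul_smul, mul_add, pow_add, mul_one]
    ring

lemma eigenFunctions_apply_pow {m : ℕ} {w : X → ℂ} (hw : w ∈ eigenFunctions X N m) (j : ℕ)
    (x : X) : w (T ^ j • x) = (zetaN N ^ m)⁻¹ ^ j * w x := by
  induction j generalizing x with
  | zero => simp
  | succ j ih =>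
    rw [pow_succ, mul_smul, ih, ← hw.2 x, pow_succ]
    have := pow_ne_zero m (zetaN_ne_zero N)
    field_simp

include hN in
lemma eigenProj_eq_self {n : ℕ} {w : X → ℂ} (hw : w ∈ eigenFunctions X N n) :
    eigenProj N n w = w := by
  funext x
  have : (N : ℂ) ≠ 0 := by exact_mod_cast hN.ne'
  have h0 := zetaN_ne_zero N
  simp only [eigenProj_apply, eigenFunctions_apply_pow hw, pow_mul, ← mul_assoc, ← mul_pow,
    mul_inv_cancel₀ (pow_ne_zero n h0), one_pow, one_mul, Finset.sum_const, Finset.card_range,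
    nsmul_eq_mul, inv_mul_cancel₀ this]

lemma geom_sum_zetaN_eq_zero {N : ℕ} (hN : 0 < N) {n m : ℕ} (h : ¬n ≡ m [MOD N]) :
    ∑ j ∈ Finset.range N, (zetaN N ^ n * (zetaN N ^ m)⁻¹) ^ j = 0 := by
  have h1 : zetaN N ^ n * (zetaN N ^ m)⁻¹ ≠ 1 := fun h1 ↦ h <| by
    rw [mul_inv_eq_one₀ (pow_ne_zero m (zetaN_ne_zero N))] at h1
    have h2 := zetaN_isPrimitiveRoot hN
    rwa [(h2.isOfFinOrder hN.ne').pow_eq_pow_iff_modEq, ← h2.eq_orderOf] at h1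
  rw [geom_sum_eq h1, mul_pow, inv_pow, pow_right_comm, pow_right_comm _ m, zetaN_pow_self hN]
  simp

include hN in
lemma eigenProj_eq_zero {n m : ℕ} (h : ¬n ≡ m [MOD N]) {w : X → ℂ}
    (hw : w ∈ eigenFunctions X N m) : eigenProj N n w = 0 := by
  funext x
  simp only [eigenProj_apply, eigenFunctions_apply_pow hw, pow_mul, ← mul_assoc, ← mul_pow,
    ← Finset.sum_mul, geom_sum_zetaN_eq_zero hN h, zero_mul, mul_zero, Pi.zero_apply]

lemma not_modEq_add {N s m n : ℕ} (hn : n < N) (hm : m < N) (h : n ≠ m) :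
    ¬s + n ≡ s + m [MOD N] := fun h' ↦
  h (Nat.ModEq.eq_of_lt_of_lt (Nat.ModEq.add_left_cancel' s h') hn hm)

include hN in
lemma sum_eigenProj (s : ℕ) (v : X → ℂ) :
    ∑ n ∈ Finset.range N, eigenProj N (s + n) v = v := by
  funext x
  have h0 : (N : ℂ) ≠ 0 := by exact_mod_cast hN.ne'
  rw [Finset.sum_apply]
  simp only [eigenProj_apply]
  rw [← Finset.mul_sum, Finset.sum_comm, Finset.sum_eq_single 0]
  · simp [h0]
  · intro j hj hj0
    have h1 := geom_sum_zetaN_eq_zero hN (n := j) (m := 0) fun h ↦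
      hj0 (h.eq_of_lt_of_lt (Finset.mem_range.mp hj) hN)
    rw [pow_zero, inv_one, mul_one] at h1
    simp only [pow_add, mul_comm _ j, pow_mul, mul_assoc]
    rw [← Finset.mul_sum, ← Finset.sum_mul, h1]
    simp
  · intro h
    exact absurd (Finset.mem_range.mpr hN) h

include hN in
/-- The components of a sum of eigenfunctions with distinct eigenvalues. -/
lemma eigenProj_sum (s : ℕ) {w : ℕ → X → ℂ} (hw : ∀ m < N, w m ∈ eigenFunctions X N (s + m))
    {n : ℕ} (hn : n < N) : eigenProj N (s + n) (∑ m ∈ Finset.range N, w m) = w n := by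
  rw [map_sum, Finset.sum_eq_single n]
  · exact eigenProj_eq_self hN (hw n hn)
  · intro m hm hmn
    rw [Finset.mem_range] at hm
    exact eigenProj_eq_zero hN (not_modEq_add hn hm hmn.symm) (hw m hm)
  · intro h
    exact absurd (Finset.mem_range.mpr hn) h

lemma exists_T_pow_smul_eq (X : Type) [MulAction SL(2, ℤ) X] [Finite X] :
    ∃ N : ℕ, 0 < N ∧ ∀ x : X, T ^ N • x = x := by
  have h := isOfFinOrder_of_finite (MulAction.toPermHom SL(2, ℤ) X T)
  obtain ⟨N, hN, h⟩ := isOfFinOrder_iff_pow_eq_one.mp h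
  refine ⟨N, hN, fun x ↦ ?_⟩
  rw [← map_pow] at h
  exact DFunLike.congr_fun h x

end Eigen

section Coefficients

open ModularGroup Filter Topology
open scoped Manifold ModularForm

variable {X : Type} [MulAction SL(2, ℤ) X] {k : ℤ} {F : X → ℍ → ℂ}

lemma apply_neg_one_smul (hk : Odd k) (hF : F ∈ equivariantFamily X k) (x : X) :
    F ((-1 : SL(2, ℤ)) • x) = -F x := by
  funext z
  have := hF.2 (-1) x z
  rw [neg_one_smul_uhp, autFactor_neg, autFactor_one, hk.neg_one_zpow, neg_one_mul] at this
  exact this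

lemma apply_T_smul (hF : F ∈ equivariantFamily X k) (x : X) (z : ℍ) :
    F (T • x) (T • z) = F x z := by
  rw [hF.2, autFactor_T, _root_.one_zpow, one_mul]

variable {N : ℕ} (hN : 0 < N) (hT : ∀ x : X, T ^ N • x = x)

include hT in
lemma vadd_of_apply_T_smul (hF : ∀ x z, F (T • x) (T • z) = F x z) (x : X) (z : ℍ) :
    F x ((N : ℝ) +ᵥ z) = F x z := by
  have := apply_T_zpow hF N x z
  rw [UpperHalfPlane.modular_T_zpow_smul, zpow_natCast, hT] at this
  exact_mod_cast this

include hT in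
lemma isQSeries_of_mem (hF : F ∈ formFamily X k) (x : X) : IsQSeries N (F x) :=
  ⟨vadd_of_apply_T_smul hT (apply_T_smul hF.1) x, hF.1.1 x, hF.2 x⟩

include hN hT in
lemma qCoeff_mem_eigenFunctions (hk : Odd k) (hF : F ∈ formFamily X k) (n : ℕ) :
    (fun x ↦ qCoeff N n (F x)) ∈ eigenFunctions X N n := by
  refine ⟨fun x ↦ ?_, fun x ↦ ?_⟩
  · have := (isQSeries_of_mem hT hF x).qCoeff_smul hN (-1) n
    rw [neg_one_smul, neg_one_mul] at this
    simp only [apply_neg_one_smul hk hF.1, this]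
  · refine ((isQSeries_of_mem hT hF x).qCoeff_unique hN
      (c := fun n ↦ qCoeff N n (F (T • x)) * zetaN N ^ n) (fun z ↦ ?_) n).symm
    have h := (isQSeries_of_mem hT hF (T • x)).hasSum hN (T • z)
    rw [apply_T_smul hF.1] at h
    refine h.congr_fun fun n ↦ ?_
    have h2 := qLocal_vadd_nat hN 1 z
    rw [Nat.cast_one, pow_one, ← UpperHalfPlane.modular_T_smul] at h2
    rw [h2, mul_pow, zetaN, mul_assoc]

variable (X k) in
/-- The sum of the `N` Fourier coefficients starting from the `s`-th one. -/
noncomputable def coeffSum (s : ℕ) : formFamily X k →ₗ[ℂ] (X → ℂ) where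
  toFun F := ∑ n ∈ Finset.range N, fun x ↦ qCoeff N (s + n) (F.1 x)
  map_add' F G := by
    rw [← Finset.sum_add_distrib]
    refine Finset.sum_congr rfl fun n _ ↦ funext fun x ↦ ?_
    exact (isQSeries_of_mem hT F.2 x).qCoeff_add hN (isQSeries_of_mem hT G.2 x) _
  map_smul' c F := by
    rw [Finset.smul_sum]
    refine Finset.sum_congr rfl fun n _ ↦ funext fun x ↦ ?_
    exact (isQSeries_of_mem hT F.2 x).qCoeff_smul hN c _

lemma coeffSum_apply (s : ℕ) (F : formFamily X k) : coeffSum X k hN hT s F =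
    ∑ n ∈ Finset.range N, fun x ↦ qCoeff N (s + n) (F.1 x) := rfl

lemma coeffSum_mem (hk : Odd k) (s : ℕ) (F : formFamily X k) :
    coeffSum X k hN hT s F ∈ oddFunctions X := by
  rw [coeffSum_apply]
  exact Submodule.sum_mem _ fun n _ ↦ (qCoeff_mem_eigenFunctions hN hT hk F.2 (s + n)).1

lemma eigenProj_coeffSum (hk : Odd k) (s : ℕ) (F : formFamily X k) {n : ℕ} (hn : n < N) :
    eigenProj N (s + n) (coeffSum X k hN hT s F) = fun x ↦ qCoeff N (s + n) (F.1 x) :=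
  eigenProj_sum hN s (fun m _ ↦ qCoeff_mem_eigenFunctions hN hT hk F.2 (s + m)) hn

lemma qCoeff_eq_zero_of_coeffSum_eq_zero (hk : Odd k) {s : ℕ} {F : formFamily X k}
    (h : coeffSum X k hN hT s F = 0) {n : ℕ} (hn : n < N) (x : X) :
    qCoeff N (s + n) (F.1 x) = 0 := by
  have := eigenProj_coeffSum hN hT hk s F hn
  rw [h, map_zero] at this
  exact (congr_fun this x).symm

end Coefficients

section Discriminant

open ModularGroup Filter Topology Asymptotics
open scoped Manifold ModularForm

variable {X : Type} [MulAction SL(2, ℤ) X] {k l : ℤ} {F G : X → ℍ → ℂ}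

lemma mul_mem_equivariantFamily (hF : F ∈ equivariantFamily X k) (hG : G ∈ equivariantFamily X l) :
    F * G ∈ equivariantFamily X (k + l) := by
  refine ⟨fun x ↦ (hF.1 x).mul (hG.1 x), fun γ x z ↦ ?_⟩
  simp only [Pi.mul_apply, hF.2, hG.2, zpow_add₀ (autFactor_ne_zero γ z)]
  ring

lemma mul_mem_formFamily (hF : F ∈ formFamily X k) (hG : G ∈ formFamily X l) :
    F * G ∈ formFamily X (k + l) :=
  ⟨mul_mem_equivariantFamily hF.1 hG.1, fun x ↦ (hF.2 x).mul (hG.2 x)⟩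

lemma apply_smul_of_slash_eq {f : ℍ → ℂ} {k : ℤ} {γ : SL(2, ℤ)} (h : f ∣[k] γ = f) (z : ℍ) :
    f (γ • z) = autFactor γ z ^ k * f z := by
  have h1 := congr_fun h z
  rw [slash_eq_autFactor] at h1
  rw [← h1, mul_comm, mul_assoc, ← zpow_add₀ (autFactor_ne_zero γ z), neg_add_cancel, zpow_zero,
    mul_one]

lemma modularForm_mem_formFamily (f : ModularForm 𝒮ℒ k) :
    (fun _ ↦ ⇑f : X → ℍ → ℂ) ∈ formFamily X k := by
  refine ⟨⟨fun _ ↦ f.holo', fun γ _ z ↦ ?_⟩, fun _ ↦ ModularFormClass.bdd_at_infty f⟩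
  exact apply_smul_of_slash_eq (f.slash_action_eq' _ ⟨γ, rfl⟩) z

lemma discriminant_mem_formFamily :
    (fun _ ↦ ModularForm.discriminant : X → ℍ → ℂ) ∈ formFamily X 12 := by
  refine ⟨⟨fun _ ↦ CuspForm.discriminant.holo', fun γ _ z ↦ ?_⟩,
    fun _ ↦ ModularForm.discriminant_isZeroAtImInfty.boundedAtFilter⟩
  exact apply_smul_of_slash_eq (CuspForm.discriminant.slash_action_eq' _ ⟨γ, rfl⟩) z

lemma isQSeries_discriminant : IsQSeries 1 ModularForm.discriminant := by
  refine ⟨fun z ↦ ?_, CuspForm.discriminant.holo',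
    ModularForm.discriminant_isZeroAtImInfty.boundedAtFilter⟩
  have h := apply_smul_of_slash_eq ModularForm.discriminant_T_invariant z
  rw [autFactor_T, _root_.one_zpow, one_mul, UpperHalfPlane.modular_T_smul] at h
  exact_mod_cast h

lemma exists_discriminant_eq : ∃ g : ℍ → ℂ, IsQSeries 1 g ∧
    ∀ z, ModularForm.discriminant z = qLocal 1 z * (1 + qLocal 1 z * g z) := by
  have hΔ := isQSeries_discriminant
  obtain ⟨g, hg, h⟩ := hΔ.exists_eq_pow_mul one_pos (M := 1) fun n hn ↦ by
    obtain rfl : n = 0 := by omega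
    exact (hΔ.qCoeff_zero_eq_zero_iff one_pos).mpr ModularForm.discriminant_isZeroAtImInfty
  have hg1 : qCoeff 1 0 g = 1 := by
    have h1 : qCoeff 1 1 ModularForm.discriminant = 1 := by
      simpa [qCoeff] using ModularForm.discriminant_qExpansion_coeff_one
    rw [← h1, eq_comm]
    refine hΔ.qCoeff_unique one_pos (c := fun n ↦ if n = 0 then 0 else qCoeff 1 (n - 1) g)
      (fun z ↦ ?_) 1
    rw [← hasSum_nat_add_iff' 1, h]
    simp only [Finset.range_one, Finset.sum_singleton, if_true, zero_mul, sub_zero, pow_one]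
    refine ((hg.hasSum one_pos z).mul_left (qLocal 1 z)).congr_fun fun n ↦ ?_
    rw [if_neg n.succ_ne_zero, Nat.add_sub_cancel, pow_succ]
    ring
  have hg' : IsQSeries 1 (g + fun _ ↦ (-1 : ℂ)) := hg.add (.const _)
  obtain ⟨D, hD, h'⟩ := hg'.exists_eq_pow_mul one_pos (M := 1) fun n hn ↦ by
    obtain rfl : n = 0 := by omega
    rw [hg.qCoeff_add one_pos (.const _), hg1]
    have : qCoeff 1 0 (fun _ : ℍ ↦ (-1 : ℂ)) = -1 :=
      IsQSeries.qCoeff_of_eq one_pos (.const _) .zero (M := 1) (c := fun _ ↦ -1)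
        (fun z ↦ by simp) one_pos
    rw [this, add_neg_cancel]
  refine ⟨D, hD, fun z ↦ ?_⟩
  have := h' z
  simp only [Pi.add_apply, pow_one] at this
  rw [h, pow_one, ← this]
  ring

lemma IsQSeries.of_one {N : ℕ} {f : ℍ → ℂ} (hf : IsQSeries 1 f) : IsQSeries N f :=
  ⟨IsQSeries.of_vadd_one (fun z ↦ by simpa using hf.vadd z) N, hf.mdiff, hf.bdd⟩

variable {N : ℕ} (hN : 0 < N) (hT : ∀ x : X, T ^ N • x = x)

include hN hT in
/-- Multiplication by the discriminant turns prescribed polar parts into prescribed Fourier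
coefficients. -/
lemma mul_discriminant_mem (hF : F ∈ equivariantFamily X k) {c : ℕ → X → ℂ}
    (h : ∀ x, IsBoundedAtImInfty fun z ↦
      F x z - (qLocal 1 z)⁻¹ * ∑ m ∈ Finset.range N, c m x * qLocal N z ^ m) :
    (fun x ↦ F x * ModularForm.discriminant) ∈ formFamily X (k + 12) ∧
      ∀ m < N, ∀ x, qCoeff N m (F x * ModularForm.discriminant) = c m x := by
  obtain ⟨D, hD, hΔ⟩ := exists_discriminant_eq
  have hc x : IsQSeries N fun z ↦ ∑ m ∈ Finset.range N, c m x * qLocal N z ^ m := by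
    have := IsQSeries.sum (s := Finset.range N) (N := N) fun m _ ↦
      ((IsQSeries.localParam hN).pow m).smul (c m x)
    have h2 : ∑ m ∈ Finset.range N, c m x • qLocal N ^ m =
        fun z ↦ ∑ m ∈ Finset.range N, c m x * qLocal N z ^ m := by ext; simp
    rwa [h2] at this
  have hq x : IsQSeries N fun z ↦
      F x z - (qLocal 1 z)⁻¹ * ∑ m ∈ Finset.range N, c m x * qLocal N z ^ m := by
    refine ⟨fun z ↦ ?_, (hF.1 x).sub
      ((mdifferentiable_qLocal.inv qLocal_ne_zero).mul (hc x).mdiff), h x⟩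
    rw [vadd_of_apply_T_smul hT (apply_T_smul hF), qLocal_vadd hN, (IsQSeries.of_one
      (IsQSeries.localParam one_pos)).vadd]
  have h1 : IsQSeries N (qLocal 1) := (IsQSeries.localParam one_pos).of_one
  have key x : ∃ g, IsQSeries N g ∧ ∀ z, F x z * ModularForm.discriminant z =
      ∑ m ∈ Finset.range N, c m x * qLocal N z ^ m + qLocal N z ^ N * g z := by
    refine ⟨_, ((hq x).mul ((IsQSeries.const 1).add (h1.mul hD.of_one))).add (hD.of_one.mul (hc x)),
      fun z ↦ ?_⟩
    have h0 := qLocal_ne_zero (N := 1) z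
    simp only [Pi.add_apply, Pi.mul_apply, hΔ, qLocal_pow_self hN]
    field_simp
    ring
  choose g hg hg' using key
  have hF' x : IsQSeries N (F x * ModularForm.discriminant) := by
    have h2 := (hc x).add (((IsQSeries.localParam hN).pow N).mul (hg x))
    convert h2 using 1
    funext z
    exact hg' x z
  exact ⟨⟨mul_mem_equivariantFamily hF discriminant_mem_formFamily.1, fun x ↦ (hF' x).bdd⟩,
    fun m hm x ↦ (hF' x).qCoeff_of_eq hN (hg x) (c := fun m ↦ c m x) (hg' x) hm⟩

variable (X k) in
/-- Multiplication by the discriminant. -/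
noncomputable def mulDiscriminant : formFamily X k →ₗ[ℂ] formFamily X (k + 12) where
  toFun F := ⟨fun x ↦ F.1 x * ModularForm.discriminant,
    mul_mem_formFamily F.2 discriminant_mem_formFamily⟩
  map_add' _ _ := Subtype.ext <| funext fun _ ↦ add_mul _ _ _
  map_smul' c F := Subtype.ext <| funext fun x ↦ smul_mul_assoc c (F.1 x) _

lemma mulDiscriminant_apply (F : formFamily X k) (x : X) (z : ℍ) :
    (mulDiscriminant X k F).1 x z = F.1 x z * ModularForm.discriminant z := rfl

lemma mulDiscriminant_injective : Function.Injective (mulDiscriminant X k) := by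
  intro F G h
  refine Subtype.ext <| funext fun x ↦ funext fun z ↦ ?_
  have h1 : (mulDiscriminant X k F).1 x z = (mulDiscriminant X k G).1 x z := by rw [h]
  exact mul_right_cancel₀ (ModularForm.discriminant_ne_zero z) h1

include hN hT in
lemma exists_mulDiscriminant_eq (F : formFamily X (k + 12))
    (h : ∀ n < N, ∀ x, qCoeff N n (F.1 x) = 0) : ∃ G, mulDiscriminant X k G = F := by
  have hΔ := ModularForm.discriminant_ne_zero
  refine ⟨⟨fun x z ↦ F.1 x z / ModularForm.discriminant z, ⟨fun x ↦ ?_, fun γ x z ↦ ?_⟩,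
    fun x ↦ ?_⟩, Subtype.ext <| funext fun x ↦ funext fun z ↦
      (mulDiscriminant_apply _ x z).trans (div_mul_cancel₀ _ (hΔ z))⟩
  · exact (F.2.1.1 x).div CuspForm.discriminant.holo' hΔ
  · have h1 := F.2.1.2 γ x z
    have h2 := (discriminant_mem_formFamily (X := X)).1.2 γ x z
    have h3 := autFactor_ne_zero γ z
    beta_reduce at h2 ⊢
    rw [h1, h2, zpow_add₀ h3]
    have := hΔ z
    have := zpow_ne_zero 12 h3
    field_simp
  · obtain ⟨g, hg, hg'⟩ := (isQSeries_of_mem hT F.2 x).exists_eq_pow_mul hN fun n hn ↦ h n hn x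
    have h1 : (fun z ↦ qLocal 1 z) =O[atImInfty] ModularForm.discriminant := by
      refine IsBigO.trans (isBigO_of_le _ fun z ↦ ?_) ModularForm.exp_isBigO_discriminant
      rw [norm_qLocal]
      simp [abs_of_pos (Real.exp_pos _)]
    have h3 : g =O[atImInfty] fun _ ↦ (1 : ℂ) :=
      hg.bdd.trans (isBigO_const_const (1 : ℝ) one_ne_zero _)
    have h2 := (h1.mul h3).mul (isBigO_refl (fun z ↦ (ModularForm.discriminant z)⁻¹) atImInfty)
    refine (h2.congr (g₂ := fun _ ↦ (1 : ℂ)) (fun z ↦ ?_) fun z ↦ ?_).trans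
      (isBigO_const_const (1 : ℂ) (one_ne_zero (α := ℝ)) _)
    · beta_reduce
      rw [hg', qLocal_pow_self hN, div_eq_mul_inv]
    · simp [hΔ z]

variable [Finite X]

include hN hT in
lemma finrank_formFamily_add_twelve (hk : Odd k) [Module.Finite ℂ (formFamily X k)] :
    Module.Finite ℂ (formFamily X (k + 12)) ∧ Module.finrank ℂ (formFamily X (k + 12)) =
      Module.finrank ℂ (formFamily X k) +
        Module.finrank ℂ (LinearMap.range (coeffSum X (k + 12) hN hT 0)) := by
  have hk' : Odd (k + 12) := hk.add_even (by decide)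
  have hker : LinearMap.range (mulDiscriminant X k) =
      LinearMap.ker (coeffSum X (k + 12) hN hT 0) := by
    ext F
    rw [LinearMap.mem_range, LinearMap.mem_ker]
    refine ⟨?_, fun h ↦ exists_mulDiscriminant_eq hN hT F fun n hn x ↦ ?_⟩
    · rintro ⟨G, rfl⟩
      rw [coeffSum_apply]
      refine Finset.sum_eq_zero fun n hn ↦ funext fun x ↦ ?_
      obtain ⟨D, hD, hΔ⟩ := exists_discriminant_eq
      have hG := isQSeries_of_mem hT G.2 x
      have h1 : IsQSeries N (qLocal 1) := (IsQSeries.localParam one_pos).of_one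
      rw [Pi.zero_apply, zero_add]
      refine (isQSeries_of_mem hT (mulDiscriminant X k G).2 x).qCoeff_of_eq hN (c := fun _ ↦ 0)
        (hG.mul ((IsQSeries.const 1).add (h1.mul hD.of_one))) (fun z ↦ ?_)
        (Finset.mem_range.mp hn)
      rw [mulDiscriminant_apply, hΔ, qLocal_pow_self hN]
      simp only [zero_mul, Finset.sum_const_zero, Pi.add_apply, Pi.mul_apply]
      ring
    · simpa using qCoeff_eq_zero_of_coeffSum_eq_zero hN hT hk' h hn x
  have h1 : IsNoetherian ℂ (formFamily X (k + 12)) := isNoetherian_of_range_eq_ker _ _ hker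
  have h2 := LinearMap.finrank_range_add_finrank_ker (coeffSum X (k + 12) hN hT 0)
  rw [← hker, LinearMap.finrank_range_of_inj mulDiscriminant_injective] at h2
  exact ⟨inferInstance, by omega⟩

lemma finite_formFamily (hneg : ∀ l < 0, formFamily X l = ⊥) (hk : Odd k) :
    Module.Finite ℂ (formFamily X k) := by
  obtain ⟨N, hN, hT⟩ := exists_T_pow_smul_eq X
  obtain ⟨n, hn⟩ : ∃ n : ℕ, k < 12 * n := ⟨k.toNat + 1, by omega⟩
  induction n generalizing k with
  | zero =>
    rw [hneg k (by simpa using hn)]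
    infer_instance
  | succ n ih =>
    have := ih (k := k - 12) (hk.sub_even (by decide)) (by push_cast at hn; omega)
    have := (finrank_formFamily_add_twelve hN hT (k := k - 12) (hk.sub_even (by decide))).1
    rwa [sub_add_cancel] at this

end Discriminant

section Eisenstein

open ModularGroup Filter Topology Asymptotics
open scoped Manifold ModularForm

variable {X : Type} [MulAction SL(2, ℤ) X] {k : ℤ} {N : ℕ}

lemma norm_qLocal_le_one (z : ℍ) : ‖qLocal N z‖ ≤ 1 := by
  rw [norm_qLocal, Real.exp_le_one_iff, neg_mul, neg_mul, neg_div, neg_nonpos]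
  have := z.im_pos
  positivity

lemma qLocal_T_smul (z : ℍ) : qLocal N (T • z) = zetaN N * qLocal N z := by
  rw [UpperHalfPlane.modular_T_smul, qLocal, qLocal, Function.Periodic.qParam,
    Function.Periodic.qParam, zetaN, ← Complex.exp_add, coe_vadd]
  congr 1
  push_cast
  ring

lemma IsSeed.mul_inv_qLocal {ψ : X → ℍ → ℂ} (h : IsSeed ψ) :
    IsSeed fun x z ↦ (qLocal 1 z)⁻¹ * ψ x z := by
  refine ⟨fun x ↦ (mdifferentiable_qLocal.inv qLocal_ne_zero).mul (h.mdiff x), fun x z ↦ ?_,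
    fun B ↦ ?_⟩
  · have h1 : zetaN 1 = 1 := by simpa using zetaN_pow_self one_pos
    rw [h.T_smul, qLocal_T_smul, h1, one_mul]
  · obtain ⟨C, hC, h'⟩ := h.bdd B
    refine ⟨Real.exp (2 * Real.pi * B) * C, by positivity, fun x z hz ↦ ?_⟩
    rw [norm_mul, norm_inv, norm_qLocal, ← Real.exp_neg]
    gcongr
    · have := Real.pi_pos
      simp only [Nat.cast_one, div_one]
      nlinarith
    · exact h' x z hz

variable [Finite X]

lemma isSeed_mul_pow {n : ℕ} {w : X → ℂ} (hw : w ∈ eigenFunctions X N n) :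
    IsSeed fun x z ↦ w x * qLocal N z ^ n := by
  have := Fintype.ofFinite X
  refine ⟨fun x ↦ mdifferentiable_const.mul (mdifferentiable_qLocal.pow n), fun x z ↦ ?_,
    fun B ↦ ⟨∑ x, ‖w x‖, by positivity, fun x z _ ↦ ?_⟩⟩
  · rw [qLocal_T_smul, mul_pow, ← mul_assoc, hw.2]
  · rw [norm_mul, norm_pow]
    calc ‖w x‖ * ‖qLocal N z‖ ^ n ≤ ‖w x‖ * 1 := by
          gcongr
          exact pow_le_one₀ (norm_nonneg _) (norm_qLocal_le_one z)
      _ ≤ _ := by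
          rw [mul_one]
          exact Finset.single_le_sum (f := fun x ↦ ‖w x‖) (fun _ _ ↦ norm_nonneg _)
            (Finset.mem_univ x)

omit [Finite X] in
lemma isSeed_sum {ι : Type*} {s : Finset ι} {ψ : ι → X → ℍ → ℂ} (h : ∀ i ∈ s, IsSeed (ψ i)) :
    IsSeed fun x z ↦ ∑ i ∈ s, ψ i x z := by
  refine ⟨fun x ↦ ?_, fun x z ↦ Finset.sum_congr rfl fun i hi ↦ (h i hi).T_smul x z, fun B ↦ ?_⟩
  · have : MDiff (∑ i ∈ s, ψ i x) := by
      classical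
      induction s using Finset.induction_on with
      | empty => exact (mdifferentiable_const : MDiff fun _ : ℍ ↦ (0 : ℂ))
      | insert a s ha ih =>
        rw [Finset.sum_insert ha]
        exact ((h a (by simp)).mdiff x).add (ih fun i hi ↦ h i (by simp [hi]))
    convert this using 1
    ext z
    simp
  · choose! C hC hCψ using fun i (hi : i ∈ s) ↦ (h i hi).bdd B
    exact ⟨∑ i ∈ s, C i, Finset.sum_nonneg hC, fun x z hz ↦
      norm_sum_le_of_le _ fun i hi ↦ hCψ i hi x z hz⟩

/-- The Poincaré series with an odd seed is asymptotic to twice the seed. -/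
lemma IsSeed.isZeroAtImInfty_sub_two_mul {ψ : X → ℍ → ℂ} (hψ : IsSeed ψ) (hk : 3 ≤ k)
    (hko : Odd k) (hodd : ∀ x z, ψ ((-1 : SL(2, ℤ)) • x) z = -ψ x z) (x : X) :
    IsZeroAtImInfty fun z ↦ poincareSeries k ψ x z - 2 * ψ x z := by
  obtain ⟨N, hN, hT⟩ := exists_T_pow_smul_eq X
  convert hψ.isZeroAtImInfty_sub hk hN hT x using 3 with z
  rw [hodd, hko.neg_one_zpow]
  ring

omit [Finite X] in
lemma qCoeff_zero_const (hN : 0 < N) (c : ℂ) : qCoeff N 0 (fun _ ↦ c) = c :=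
  IsQSeries.qCoeff_of_eq hN (.const _) .zero (M := 1) (c := fun _ ↦ c) (fun z ↦ by simp) one_pos

variable (hN : 0 < N) (hT : ∀ x : X, T ^ N • x = x)

variable (X k) in
/-- The constant terms of the Fourier expansions. -/
noncomputable def constCoeff : formFamily X k →ₗ[ℂ] (X → ℂ) where
  toFun F x := qCoeff N 0 (F.1 x)
  map_add' F G := funext fun x ↦ (isQSeries_of_mem hT F.2 x).qCoeff_add hN
    (isQSeries_of_mem hT G.2 x) 0
  map_smul' c F := funext fun x ↦ (isQSeries_of_mem hT F.2 x).qCoeff_smul hN c 0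

include hN hT in
lemma range_constCoeff (hk : 3 ≤ k) (hko : Odd k) :
    LinearMap.range (constCoeff X k hN hT) = eigenFunctions X N 0 := by
  refine le_antisymm ?_ fun v hv ↦ ?_
  · rintro _ ⟨F, rfl⟩
    exact qCoeff_mem_eigenFunctions hN hT hko F.2 0
  · set ψ : X → ℍ → ℂ := fun x z ↦ ((2⁻¹ : ℂ) • v) x * qLocal N z ^ 0 with hψ
    have hseed : IsSeed ψ := isSeed_mul_pow (Submodule.smul_mem _ (2⁻¹ : ℂ) hv)
    have h2 (x z) : 2 * ψ x z = v x := by simp [hψ]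
    have h0 (x) : IsZeroAtImInfty (poincareSeries k ψ x + fun _ ↦ -v x) := by
      convert hseed.isZeroAtImInfty_sub_two_mul hk hko (fun x z ↦ by simp [hψ, hv.1 x]) x using 3
        with z
      rw [h2, sub_eq_add_neg]
      rfl
    have h1 (x) : IsBoundedAtImInfty (poincareSeries k ψ x) := by
      refine IsBigO.congr_left ((h0 x).boundedAtFilter.add
        (Filter.const_boundedAtFilter atImInfty (v x))) fun z ↦ ?_
      simp
    have hF : poincareSeries k ψ ∈ formFamily X k := ⟨hseed.poincareSeries_mem hk, h1⟩
    refine ⟨⟨_, hF⟩, funext fun x ↦ ?_⟩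
    have h3 := isQSeries_of_mem hT hF x
    have h4 := h3.add (IsQSeries.const (-v x))
    have h5 := (h4.qCoeff_zero_eq_zero_iff hN).mpr (h0 x)
    rw [h3.qCoeff_add hN (.const _), qCoeff_zero_const hN, add_neg_eq_zero] at h5
    exact h5

omit [Finite X] in
lemma finrank_ker_constCoeff : Module.finrank ℂ (LinearMap.ker (constCoeff X k hN hT)) =
    Module.finrank ℂ (cuspFamily X k) := by
  rw [← LinearEquiv.finrank_eq (Submodule.comapSubtypeEquivOfLe (cuspFamily_le_formFamily X k))]
  have : LinearMap.ker (constCoeff X k hN hT) =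
      (cuspFamily X k).comap (formFamily X k).subtype := by
    ext F
    refine ⟨fun h ↦ ⟨F.2.1, fun x ↦ ?_⟩, fun h ↦ funext fun x ↦ ?_⟩
    · exact ((isQSeries_of_mem hT F.2 x).qCoeff_zero_eq_zero_iff hN).mp (congr_fun h x)
    · exact ((isQSeries_of_mem hT F.2 x).qCoeff_zero_eq_zero_iff hN).mpr (h.2 x)
  rw [this]

include hN hT in
lemma range_coeffSum (hk : 3 ≤ k) (hko : Odd k) :
    LinearMap.range (coeffSum X (k + 12) hN hT 0) = oddFunctions X := by
  have hk' : Odd (k + 12) := hko.add_even (by decide)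
  refine le_antisymm ?_ fun v hv ↦ ?_
  · rintro _ ⟨F, rfl⟩
    exact coeffSum_mem hN hT hk' 0 F
  have hw (m : ℕ) : (2⁻¹ : ℂ) • eigenProj N m v ∈ eigenFunctions X N m :=
    Submodule.smul_mem _ _ (eigenProj_mem hN hT m hv)
  have hseed := (isSeed_sum (s := Finset.range N) fun m _ ↦ isSeed_mul_pow (hw m)).mul_inv_qLocal
  have h0 := hseed.isZeroAtImInfty_sub_two_mul hk hko fun x z ↦ by
    simp [(eigenProj_mem hN hT _ hv).1 x]
  obtain ⟨h1, h2⟩ := mul_discriminant_mem hN hT (hseed.poincareSeries_mem hk)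
    (c := fun m ↦ eigenProj N m v) fun x ↦ by
      refine IsBigO.congr_left (h0 x).boundedAtFilter fun z ↦ ?_
      rw [mul_left_comm, Finset.mul_sum]
      simp [mul_assoc]
  refine ⟨⟨_, h1⟩, ?_⟩
  rw [coeffSum_apply]
  conv_rhs => rw [← sum_eigenProj hN 0 v]
  refine Finset.sum_congr rfl fun n hn ↦ funext fun x ↦ ?_
  simp only [zero_add]
  exact h2 n (Finset.mem_range.mp hn) x

include hN hT in
lemma finrank_formFamily_eq_add (hneg : ∀ l < 0, formFamily X l = ⊥) (hk : 3 ≤ k) (hko : Odd k) :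
    Module.finrank ℂ (formFamily X k) =
      Module.finrank ℂ (cuspFamily X k) + Module.finrank ℂ (eigenFunctions X N 0) := by
  have := finite_formFamily hneg hko
  rw [← LinearMap.finrank_range_add_finrank_ker (constCoeff X k hN hT),
    range_constCoeff hN hT hk hko, finrank_ker_constCoeff, add_comm]

lemma finrank_formFamily_add_twelve_eq (hneg : ∀ l < 0, formFamily X l = ⊥) (hk : 3 ≤ k)
    (hko : Odd k) : Module.finrank ℂ (formFamily X (k + 12)) =
      Module.finrank ℂ (formFamily X k) + Module.finrank ℂ (oddFunctions X) := by
  obtain ⟨N, hN, hT⟩ := exists_T_pow_smul_eq X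
  have := finite_formFamily hneg hko
  rw [(finrank_formFamily_add_twelve hN hT hko).2, range_coeffSum hN hT hk hko]

end Eisenstein

section Pairing

open ModularGroup Filter Topology Asymptotics
open scoped Manifold ModularForm

variable {X : Type} [MulAction SL(2, ℤ) X] {k l : ℤ} {N : ℕ}

/-- There is no nonzero cusp form of level one and weight `14`. -/
lemma levelOne_weight_fourteen_eq_zero {f : ℍ → ℂ} (hf : MDiff f)
    (h : ∀ (γ : SL(2, ℤ)) z, f (γ • z) = autFactor γ z ^ (14 : ℤ) * f z)
    (h0 : IsZeroAtImInfty f) : f = 0 := by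
  have hs (γ : SL(2, ℤ)) : f ∣[(14 : ℤ)] γ = f := by
    ext z
    rw [slash_eq_autFactor, h, mul_right_comm, ← zpow_add₀ (autFactor_ne_zero γ z),
      add_neg_cancel, zpow_zero, one_mul]
  let g : CuspForm 𝒮ℒ 14 :=
    { toFun := f
      slash_action_eq' := fun _ ⟨γ, hγ⟩ ↦ hγ ▸ hs γ
      holo' := hf
      zero_at_cusps' := fun {c} hc ↦ by
        rw [Subgroup.IsArithmetic.isCusp_iff_isCusp_SL2Z] at hc
        rw [OnePoint.isZeroAt_iff_forall_SL2Z hc]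
        intro γ _
        rwa [hs] }
  have h1 : Module.rank ℂ (CuspForm 𝒮ℒ 14) = 0 :=
    CuspForm.discriminantEquiv.rank_eq.trans (by
      rw [show (14 : ℤ) - 12 = 2 by norm_num]; exact ModularForm.levelOne_weight_two_rank_zero)
  have h2 : g = 0 := rank_zero_iff_forall_zero.mp h1 g
  exact congrArg (fun g : CuspForm 𝒮ℒ 14 ↦ (g : ℍ → ℂ)) h2

lemma mdifferentiable_finset_sum {ι : Type*} {s : Finset ι} {f : ι → ℍ → ℂ}
    (h : ∀ i ∈ s, MDiff (f i)) : MDiff (∑ i ∈ s, f i) := by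
  classical
  induction s using Finset.induction_on with
  | empty => exact mdifferentiable_const
  | insert i s hi ih =>
    rw [Finset.sum_insert hi]
    exact (h i (by simp)).add (ih fun j hj ↦ h j (by simp [hj]))

lemma sum_mul_eq_zero [Fintype X] (hkl : k + l = 14) {F G : X → ℍ → ℂ} (hF : F ∈ formFamily X k)
    (hG : G ∈ cuspFamily X l) : ∑ x, F x * G x = 0 := by
  refine levelOne_weight_fourteen_eq_zero ?_ (fun γ z ↦ ?_) ?_
  · exact mdifferentiable_finset_sum fun x _ ↦ (hF.1.1 x).mul (hG.1.1 x)
  · have h := (mul_mem_equivariantFamily hF.1 hG.1).2 γ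
    rw [hkl] at h
    simp only [Finset.sum_apply, Finset.mul_sum]
    rw [← Equiv.sum_comp (MulAction.toPerm γ)]
    exact Finset.sum_congr rfl fun x _ ↦ h x z
  · have h (x : X) : IsZeroAtImInfty (F x * G x) := by
      have h1 := (hF.2 x).mul_zeroAtFilter (hG.2 x)
      exact h1
    have : Tendsto (fun z ↦ ∑ x, (F x * G x) z) atImInfty (𝓝 (∑ x : X, 0)) :=
      tendsto_finsetSum _ fun x _ ↦ h x
    rw [Finset.sum_const_zero] at this
    refine Tendsto.congr (fun z ↦ ?_) this
    rw [Finset.sum_apply]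

/-- Eigenfunctions are orthogonal unless their eigenvalues are mutually inverse. -/
lemma sum_mul_eq_zero_of_not_dvd [Fintype X] (hN : 0 < N) {m n : ℕ} {u w : X → ℂ}
    (hu : u ∈ eigenFunctions X N m) (hw : w ∈ eigenFunctions X N n) (h : ¬N ∣ m + n) :
    ∑ x, u x * w x = 0 := by
  have h1 : ∑ x, u x * w x = (∑ x, u x * w x) * zetaN N ^ (m + n) := by
    conv_rhs => rw [← Equiv.sum_comp (MulAction.toPerm (T : SL(2, ℤ))), Finset.sum_mul]
    refine Finset.sum_congr rfl fun x _ ↦ ?_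
    rw [MulAction.toPerm_apply, ← hu.2 x, ← hw.2 x]
    ring
  have h2 : zetaN N ^ (m + n) ≠ 1 := fun h' ↦
    h ((zetaN_isPrimitiveRoot hN).pow_eq_one_iff_dvd _ |>.mp h')
  by_contra h3
  exact h2 (mul_left_cancel₀ h3 (by rw [← h1, mul_one]))

/-- The pairing of `M_k` with `S_(14 - k)` given by the residue theorem. -/
lemma sum_coeffSum_mul_coeffSum [Fintype X] (hN : 0 < N) (hT : ∀ x : X, T ^ N • x = x)
    (hk : Odd k) (hl : Odd l) (hkl : k + l = 14) (F : formFamily X k) (G : formFamily X l)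
    (hG : G.1 ∈ cuspFamily X l) :
    ∑ x, coeffSum X k hN hT 0 F x * coeffSum X l hN hT 1 G x = 0 := by
  have hFq := isQSeries_of_mem hT F.2
  have hGq := isQSeries_of_mem hT G.2
  have h0 := congrArg (qCoeff N N) (sum_mul_eq_zero hkl F.2 hG)
  rw [IsQSeries.qCoeff_sum hN fun x _ ↦ (hFq x).mul (hGq x), IsQSeries.qCoeff_zero] at h0
  simp only [fun x ↦ (hFq x).qCoeff_mul hN (hGq x) N,
    Finset.Nat.sum_antidiagonal_eq_sum_range_succ_mk, Finset.sum_range_succ, Nat.sub_self,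
    fun x ↦ ((hGq x).qCoeff_zero_eq_zero_iff hN).mpr (hG.2 x), mul_zero, add_zero] at h0
  rw [Finset.sum_comm] at h0
  rw [coeffSum_apply, coeffSum_apply]
  simp only [Finset.sum_apply, Finset.sum_mul_sum]
  rw [Finset.sum_comm, ← h0]
  refine Finset.sum_congr rfl fun n hn ↦ ?_
  rw [Finset.mem_range] at hn
  rw [Finset.sum_comm, Finset.sum_eq_single (N - 1 - n)]
  · simp only [zero_add]
    refine Finset.sum_congr rfl fun x _ ↦ ?_
    congr 2
    omega
  · intro m hm hmn
    rw [Finset.mem_range] at hm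
    refine sum_mul_eq_zero_of_not_dvd hN (qCoeff_mem_eigenFunctions hN hT hk F.2 (0 + n))
      (qCoeff_mem_eigenFunctions hN hT hl G.2 (1 + m)) fun ⟨c, hc⟩ ↦ ?_
    have h1 : c ≠ 0 := by rintro rfl; omega
    have h2 : c < 2 := by
      by_contra! h3
      nlinarith
    obtain rfl : c = 1 := by omega
    omega
  · intro h
    exact absurd (Finset.mem_range.mpr (by omega)) h

/-- The complex conjugate of a space of functions. -/
def conjSubmodule {X : Type} (A : Submodule ℂ (X → ℂ)) : Submodule ℂ (X → ℂ) where
  carrier := {u | star u ∈ A}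
  add_mem' hu hw := by simpa using add_mem hu hw
  zero_mem' := by simp
  smul_mem' c u hu := by simpa using Submodule.smul_mem A (star c) hu

lemma finrank_le_finrank_conjSubmodule {X : Type} [Finite X] (A : Submodule ℂ (X → ℂ)) :
    Module.finrank ℂ A ≤ Module.finrank ℂ (conjSubmodule A) := by
  refine Cardinal.toNat_le_toNat ?_ (Module.rank_lt_aleph0 ℂ _)
  refine rank_le_of_surjective_injective (star : ℂ → ℂ)
    (AddMonoidHom.mk' (fun u : A ↦ (⟨star u.1, by simp [conjSubmodule]⟩ : conjSubmodule A))
      fun u w ↦ by ext; simp) star_involutive.surjective ?_ ?_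
  · intro u w h
    exact Subtype.ext (star_injective (congr_arg Subtype.val h))
  · intro c u
    ext x
    simp

lemma finrank_add_le_of_sum_mul_eq_zero {X : Type} [Fintype X] {A B V : Submodule ℂ (X → ℂ)}
    (hA : conjSubmodule A ≤ V) (hB : B ≤ V) (h : ∀ u ∈ A, ∀ w ∈ B, ∑ x, u x * w x = 0) :
    Module.finrank ℂ A + Module.finrank ℂ B ≤ Module.finrank ℂ V := by
  have hd : Disjoint (conjSubmodule A) B := by
    rw [Submodule.disjoint_def]
    intro w hw hw'
    have := h _ hw w hw'
    have h2 : ∑ x, ‖w x‖ ^ 2 = 0 := by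
      have h3 : ((∑ x, ‖w x‖ ^ 2 : ℝ) : ℂ) = 0 := by
        rw [← this]
        push_cast
        refine Finset.sum_congr rfl fun x _ ↦ ?_
        simp [← Complex.conj_mul']
      exact_mod_cast h3
    rw [Finset.sum_eq_zero_iff_of_nonneg fun _ _ ↦ by positivity] at h2
    funext x
    simpa using h2 x (Finset.mem_univ x)
  have h1 := Submodule.finrank_sup_add_finrank_inf_eq (conjSubmodule A) B
  rw [hd.eq_bot, finrank_bot] at h1
  have h2 := Submodule.finrank_mono (sup_le hA hB)
  have h3 := finrank_le_finrank_conjSubmodule A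
  omega

/-- The upper bound coming from the residue theorem. -/
lemma finrank_add_finrank_cuspFamily_le [Finite X] (hneg : ∀ l < 0, formFamily X l = ⊥)
    (hk : Odd k) (hk2 : k < 12) (hl2 : l < 12) (hkl : k + l = 14) :
    Module.finrank ℂ (formFamily X k) + Module.finrank ℂ (cuspFamily X l) ≤
      Module.finrank ℂ (oddFunctions X) := by
  have := Fintype.ofFinite X
  obtain ⟨N, hN, hT⟩ := exists_T_pow_smul_eq X
  have hl : Odd l := by
    obtain ⟨a, ha⟩ := hk
    exact ⟨6 - a, by omega⟩
  have hinj {m : ℤ} (hm : m < 12) (F : formFamily X m) (h : ∀ n < N, ∀ x, qCoeff N n (F.1 x) = 0) :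
      F = 0 := by
    obtain ⟨m, rfl⟩ : ∃ m', m = m' + 12 := ⟨m - 12, by omega⟩
    obtain ⟨G, rfl⟩ := exists_mulDiscriminant_eq hN hT F h
    have := hneg m (by omega)
    have hG : G = 0 := Subtype.ext (by simpa [this] using G.2)
    rw [hG, map_zero]
  have hJ : Function.Injective (coeffSum X k hN hT 0) := by
    rw [injective_iff_map_eq_zero]
    refine fun F hF ↦ hinj hk2 F fun n hn x ↦ ?_
    simpa using qCoeff_eq_zero_of_coeffSum_eq_zero hN hT hk hF hn x
  set J' := (coeffSum X l hN hT 1).comp (Submodule.inclusion (cuspFamily_le_formFamily X l))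
    with hJ'def
  have hJ' : Function.Injective J' := by
    rw [injective_iff_map_eq_zero]
    intro G hG
    refine Submodule.inclusion_injective (cuspFamily_le_formFamily X l) ?_
    rw [map_zero]
    refine hinj hl2 _ fun n hn x ↦ ?_
    rcases n with _ | n
    · refine ((isQSeries_of_mem hT (Submodule.inclusion (cuspFamily_le_formFamily X l) G).2
        x).qCoeff_zero_eq_zero_iff hN).mpr (G.2.2 x)
    · rw [add_comm n]
      exact qCoeff_eq_zero_of_coeffSum_eq_zero hN hT hl hG (by omega) x
  rw [← LinearMap.finrank_range_of_inj hJ, ← LinearMap.finrank_range_of_inj hJ']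
  refine finrank_add_le_of_sum_mul_eq_zero ?_ ?_ ?_
  · rintro u ⟨F, hF⟩ x
    have := coeffSum_mem hN hT hk 0 F x
    rw [hF] at this
    simpa [neg_eq_iff_eq_neg] using congrArg star this
  · rintro _ ⟨G, rfl⟩
    exact coeffSum_mem hN hT hl 1 _
  · rintro _ ⟨F, rfl⟩ _ ⟨G, rfl⟩
    exact sum_coeffSum_mul_coeffSum hN hT hk hl hkl F _ G.2

end Pairing

section TruncExp

open scoped Manifold ComplexConjugate

/-- The function `exp (a z)` minus its Taylor polynomial of degree `n` at `s`. -/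
noncomputable def truncExp (n : ℕ) (a z s : ℂ) : ℂ :=
  Complex.exp (a * z) -
    Complex.exp (a * s) * ∑ j ∈ Finset.range (n + 1), (a * (z - s)) ^ j / j.factorial

lemma norm_truncExp_le (n : ℕ) (a z s : ℂ) : ‖truncExp n a z s‖ ≤
    ‖Complex.exp (a * s)‖ * (‖a * (z - s)‖ ^ (n + 1) * Real.exp ‖a * (z - s)‖) := by
  have h : truncExp n a z s = Complex.exp (a * s) * (Complex.exp (a * (z - s)) -
      ∑ j ∈ Finset.range (n + 1), (a * (z - s)) ^ j / j.factorial) := by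
    rw [truncExp, mul_sub (Complex.exp _), ← Complex.exp_add, ← mul_add, add_sub_cancel]
  rw [h, norm_mul]
  gcongr
  exact Complex.norm_exp_sub_sum_le_norm_mul_exp _ _

lemma truncExp_add_one (n : ℕ) (a z s : ℂ) :
    truncExp n a (z + 1) (s + 1) = Complex.exp a * truncExp n a z s := by
  rw [truncExp, truncExp, add_sub_add_right_eq_sub, mul_add, mul_add, Complex.exp_add,
    Complex.exp_add, mul_one]
  ring

lemma differentiable_truncExp (n : ℕ) (a s : ℂ) : Differentiable ℂ fun z ↦ truncExp n a z s := by
  unfold truncExp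
  fun_prop

lemma hasDerivAt_truncExp (n : ℕ) (a z s : ℂ) : HasDerivAt (truncExp n a z)
    (-(a ^ (n + 1) * (z - s) ^ n / n.factorial * Complex.exp (a * s))) s := by
  have h1 : HasDerivAt (fun s ↦ Complex.exp (a * s)) (Complex.exp (a * s) * a) s := by
    simpa using ((hasDerivAt_id s).const_mul a).cexp
  have h2 : HasDerivAt (fun s ↦ a * (z - s)) (-a) s := by
    simpa using ((hasDerivAt_id s).const_sub z).const_mul a
  have h3 (m : ℕ) : HasDerivAt
      (fun s ↦ ∑ j ∈ Finset.range (m + 1), (a * (z - s)) ^ j / j.factorial)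
      (-a * ∑ j ∈ Finset.range m, (a * (z - s)) ^ j / j.factorial) s := by
    induction m with
    | zero => simpa using hasDerivAt_const s (1 : ℂ)
    | succ m ih =>
      simp only [fun s ↦ Finset.sum_range_succ (fun j ↦ (a * (z - s)) ^ j / (j.factorial : ℂ))
        (m + 1)]
      refine (ih.add ((h2.pow (m + 1)).div_const _)).congr_deriv ?_
      rw [Finset.sum_range_succ, Nat.factorial_succ]
      have h4 : (m.factorial : ℂ) ≠ 0 := by exact_mod_cast m.factorial_ne_zero
      have h5 : (m + 1 : ℂ) ≠ 0 := by exact_mod_cast m.succ_ne_zero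
      push_cast
      field_simp
      ring
  refine ((hasDerivAt_const s (Complex.exp (a * z))).sub (h1.mul (h3 n))).congr_deriv ?_
  rw [Finset.sum_range_succ, mul_pow]
  ring

lemma mdifferentiable_of_differentiable {g : ℂ → ℂ} (hg : Differentiable ℂ g) :
    MDiff fun z : ℍ ↦ g z := by
  rw [UpperHalfPlane.mdifferentiable_iff]
  refine hg.differentiableOn.congr fun z hz ↦ ?_
  simp [ofComplex_apply_of_im_pos hz]

end TruncExp

section EichlerKernel

open ModularGroup Filter Topology Asymptotics
open scoped Manifold ModularForm ComplexConjugate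

variable {X : Type} [MulAction SL(2, ℤ) X] {N : ℕ}

/-- The frequency `-2 π i m / N`. -/
noncomputable def freq (N m : ℕ) : ℂ := -(2 * Real.pi * Complex.I * m / N)

lemma exp_freq_mul (m : ℕ) (z : ℍ) : Complex.exp (freq N m * z) = (qLocal N z ^ m)⁻¹ := by
  rw [qLocal, Function.Periodic.qParam, ← Complex.exp_nat_mul, ← Complex.exp_neg, freq]
  congr 1
  push_cast
  ring

lemma exp_freq_mul_conj (m : ℕ) (z : ℍ) :
    Complex.exp (freq N m * conj (z : ℂ)) = conj (qLocal N z ^ m) := by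
  rw [qLocal, Function.Periodic.qParam, ← Complex.exp_nat_mul, ← Complex.exp_conj, freq]
  congr 1
  simp [Complex.conj_ofNat]
  ring

lemma exp_freq (m : ℕ) : Complex.exp (freq N m) = (zetaN N ^ m)⁻¹ := by
  rw [zetaN, ← Complex.exp_nat_mul, ← Complex.exp_neg, freq]
  congr 1
  ring

lemma norm_freq_le (hN : 0 < N) {m : ℕ} (hm : m ≤ N) : ‖freq N m‖ ≤ 2 * Real.pi := by
  have h1 : (0 : ℝ) < N := by exact_mod_cast hN
  have h2 : (m : ℝ) ≤ N := by exact_mod_cast hm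
  rw [freq, norm_neg, norm_div, norm_mul, norm_mul, norm_mul]
  simp only [Complex.norm_ofNat, Complex.norm_real, Complex.norm_I, Complex.norm_natCast,
    Real.norm_eq_abs, abs_of_pos Real.pi_pos, mul_one]
  rw [div_le_iff₀ h1]
  have := Real.pi_pos
  gcongr

lemma coe_smul_eq_div (γ : SL(2, ℤ)) (z : ℍ) :
    ((γ • z : ℍ) : ℂ) = (γ 0 0 * z + γ 0 1) / autFactor γ z := by
  rw [UpperHalfPlane.coe_specialLinearGroup_apply]
  simp [autFactor]

lemma coe_smul_sub_conj_smul (γ : SL(2, ℤ)) (z w : ℍ) :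
    ((γ • z : ℍ) : ℂ) - conj ((γ • w : ℍ) : ℂ) =
      (z - conj (w : ℂ)) / (autFactor γ z * conj (autFactor γ w)) := by
  have hz := autFactor_ne_zero γ z
  have hw : conj (autFactor γ w) ≠ 0 := by
    simpa using autFactor_ne_zero γ w
  have hdet : (γ 0 0 * γ 1 1 - γ 0 1 * γ 1 0 : ℂ) = 1 := by
    exact_mod_cast (Matrix.det_fin_two _).symm.trans γ.det_coe
  rw [coe_smul_eq_div, coe_smul_eq_div, map_div₀, div_sub_div _ _ hz hw]
  congr 1
  simp only [autFactor, map_add, map_mul, map_intCast]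
  linear_combination (z - conj (w : ℂ)) * hdet

/-- The summand of the Eichler kernel. -/
noncomputable def eichlerSummand (N n : ℕ) (u : ℕ → X → ℂ) (x : X) (z w : ℍ) (δ : SL(2, ℤ)) : ℂ :=
  (∑ i ∈ Finset.range N, u i (δ • x) *
    truncExp n (freq N (1 + i)) (δ • z : ℍ) (conj ((δ • w : ℍ) : ℂ))) * autFactor δ z ^ (n : ℤ)

variable {n : ℕ} {u : ℕ → X → ℂ}

lemma eichlerSummand_T (hu : ∀ i x, u i (T • x) = zetaN N ^ (1 + i) * u i x) (x : X) (z w : ℍ)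
    (δ : SL(2, ℤ)) : eichlerSummand N n u x z w (T * δ) = eichlerSummand N n u x z w δ := by
  have h (z : ℍ) : ((T • z : ℍ) : ℂ) = z + 1 := by
    rw [UpperHalfPlane.modular_T_smul, coe_vadd]
    push_cast
    ring
  simp only [eichlerSummand, mul_smul, autFactor_mul, autFactor_T, one_mul, hu, h, map_add, map_one,
    truncExp_add_one, exp_freq]
  congr 1
  refine Finset.sum_congr rfl fun i _ ↦ ?_
  have := pow_ne_zero (1 + i) (zetaN_ne_zero N)
  field_simp

lemma eichlerSummand_mul (x : X) (z w : ℍ) (δ γ : SL(2, ℤ)) :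
    eichlerSummand N n u (γ • x) (γ • z) (γ • w) δ =
      autFactor γ z ^ (-n : ℤ) * eichlerSummand N n u x z w (δ * γ) := by
  have := zpow_ne_zero n (autFactor_ne_zero γ z)
  simp only [eichlerSummand, mul_smul, autFactor_mul, mul_zpow, _root_.zpow_neg]
  field_simp

lemma mdifferentiable_eichlerSummand (x : X) (w : ℍ) (δ : SL(2, ℤ)) :
    MDiff fun z ↦ eichlerSummand N n u x z w δ := by
  have h : MDiff fun z : ℍ ↦ ∑ i ∈ Finset.range N, u i (δ • x) *
      truncExp n (freq N (1 + i)) z (conj ((δ • w : ℍ) : ℂ)) :=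
    mdifferentiable_of_differentiable (g := fun z ↦ ∑ i ∈ Finset.range N, u i (δ • x) *
      truncExp n (freq N (1 + i)) z (conj ((δ • w : ℍ) : ℂ)))
      (.fun_sum fun i _ ↦ (differentiable_truncExp n _ _).const_mul _)
  have h2 := h.slash (-n : ℤ) δ
  have h3 : (fun z ↦ eichlerSummand N n u x z w δ) = (fun z : ℍ ↦ ∑ i ∈ Finset.range N,
      u i (δ • x) * truncExp n (freq N (1 + i)) z (conj ((δ • w : ℍ) : ℂ))) ∣[(-n : ℤ)] δ := by
    ext z
    rw [slash_eq_autFactor, neg_neg, eichlerSummand]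
  rw [h3]
  exact h2

lemma exists_norm_eichlerSummand_le [Finite X] (hN : 0 < N) (n : ℕ) (u : ℕ → X → ℂ) :
    ∃ K : ℝ, 0 ≤ K ∧ ∀ (x : X) (z w : ℍ) (δ : SL(2, ℤ)),
      ‖eichlerSummand N n u x z w δ‖ ≤ K * (‖(z : ℂ) - conj (w : ℂ)‖ ^ (n + 1) *
        Real.exp (2 * Real.pi * (‖(z : ℂ) - conj (w : ℂ)‖ /
          (‖autFactor δ z‖ * ‖autFactor δ w‖))) *
        (‖autFactor δ z‖⁻¹ * (‖autFactor δ w‖ ^ (n + 1))⁻¹)) := by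
  have := Fintype.ofFinite X
  refine ⟨(∑ i ∈ Finset.range N, ∑ x, ‖u i x‖) * (2 * Real.pi) ^ (n + 1),
    by have := Real.pi_pos; positivity, fun x z w δ ↦ ?_⟩
  set D := ‖(z : ℂ) - conj (w : ℂ)‖
  set a := ‖autFactor δ z‖ with ha
  set b := ‖autFactor δ w‖ with hb
  have ha0 : 0 < a := norm_pos_iff.mpr (autFactor_ne_zero _ _)
  have hb0 : 0 < b := norm_pos_iff.mpr (autFactor_ne_zero _ _)
  have hpi := Real.pi_pos
  have key (i) (hi : i ∈ Finset.range N) : ‖u i (δ • x) *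
      truncExp n (freq N (1 + i)) (δ • z : ℍ) (conj ((δ • w : ℍ) : ℂ))‖ ≤
      (∑ x, ‖u i x‖) * ((2 * Real.pi * (D / (a * b))) ^ (n + 1) *
        Real.exp (2 * Real.pi * (D / (a * b)))) := by
    rw [Finset.mem_range] at hi
    rw [norm_mul]
    have h0 : ‖freq N (1 + i) * (((δ • z : ℍ) : ℂ) - conj ((δ • w : ℍ) : ℂ))‖ ≤
        2 * Real.pi * (D / (a * b)) := by
      rw [coe_smul_sub_conj_smul, norm_mul, norm_div, norm_mul, RCLike.norm_conj]
      gcongr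
      exact norm_freq_le hN (by omega)
    refine mul_le_mul (Finset.single_le_sum (f := fun x ↦ ‖u i x‖) (fun _ _ ↦ norm_nonneg _)
      (Finset.mem_univ _)) ((norm_truncExp_le _ _ _ _).trans ?_) (norm_nonneg _) (by positivity)
    rw [exp_freq_mul_conj, RCLike.norm_conj, norm_pow]
    refine (mul_le_of_le_one_left (by positivity)
      (pow_le_one₀ (norm_nonneg _) (norm_qLocal_le_one _))).trans ?_
    gcongr
  rw [eichlerSummand, norm_mul, zpow_natCast, norm_pow, ← ha]
  calc _ ≤ (∑ i ∈ Finset.range N, (∑ x, ‖u i x‖) * ((2 * Real.pi * (D / (a * b))) ^ (n + 1) *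
        Real.exp (2 * Real.pi * (D / (a * b))))) * a ^ n := by
        gcongr
        exact norm_sum_le_of_le _ key
    _ = _ := by
        rw [← Finset.sum_mul]
        have h4 : (2 * Real.pi * (D / (a * b))) ^ (n + 1) * a ^ n =
            (2 * Real.pi) ^ (n + 1) * (D ^ (n + 1) * (a⁻¹ * (b ^ (n + 1))⁻¹)) := by
          rw [mul_pow, div_pow, mul_pow a b]
          field_simp
          rw [mul_assoc, ← pow_succ]
        linear_combination (∑ i ∈ Finset.range N, ∑ x, ‖u i x‖) *
          Real.exp (2 * Real.pi * (D / (a * b))) * h4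

end EichlerKernel

section EichlerKernel

open ModularGroup Filter Topology Asymptotics
open scoped Manifold ModularForm ComplexConjugate

variable {X : Type} [MulAction SL(2, ℤ) X] {N n : ℕ} {u : ℕ → X → ℂ}

/-- A kernel on `ℍ × ℍ`, holomorphic in the first and antiholomorphic in the second variable. -/
noncomputable def eichlerKernel (N n : ℕ) (u : ℕ → X → ℂ) (x : X) (w z : ℍ) : ℂ :=
  cosetSum (eichlerSummand N n u x z w)

lemma eichlerKernel_smul (hu : ∀ i x, u i (T • x) = zetaN N ^ (1 + i) * u i x) (γ : SL(2, ℤ))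
    (x : X) (w z : ℍ) : eichlerKernel N n u (γ • x) (γ • w) (γ • z) =
      autFactor γ z ^ (-n : ℤ) * eichlerKernel N n u x w z := by
  rw [eichlerKernel, eichlerKernel, ← cosetSum_mul_right (eichlerSummand_T hu x z w) γ, cosetSum,
    cosetSum, ← tsum_mul_left]
  refine tsum_congr fun p ↦ ?_
  by_cases hp : IsCoprime (p 0) (p 1)
  · rw [cosetTerm_of_isCoprime hp, cosetTerm_of_isCoprime hp, eichlerSummand_mul]
  · rw [cosetTerm_of_not hp, cosetTerm_of_not hp, mul_zero]

variable [Finite X]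

lemma exists_norm_cosetTerm_eichlerSummand_le (hN : 0 < N) (n : ℕ) (u : ℕ → X → ℂ) (w : ℍ)
    (A : ℝ) {B : ℝ} (hB : 0 < B) : ∃ C₁ C₂ r : ℝ, 0 ≤ C₁ ∧ 0 ≤ C₂ ∧ 0 < r ∧
      ∀ p : Fin 2 → ℤ, IsCoprime (p 0) (p 1) → ∀ z ∈ verticalStrip A B,
        r ≤ ‖autFactor (rowMatrix p) z‖ ∧ ∀ (x : X) (D E : ℝ), ‖(z : ℂ) - conj (w : ℂ)‖ ≤ D →
          ‖(z : ℂ) - conj (w : ℂ)‖ ≤ E * ‖autFactor (rowMatrix p) z‖ →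
          ‖cosetTerm (eichlerSummand N n u x z w) p‖ ≤
            C₁ * (D ^ (n + 1) * Real.exp (C₂ * E)) * ‖p‖ ^ (-(n + 2 : ℤ)) := by
  obtain ⟨K, hK, hle⟩ := exists_norm_eichlerSummand_le hN n u
  obtain ⟨r₁, hr₁, h₁⟩ := exists_le_norm_autFactor A hB
  obtain ⟨r₂, hr₂, h₂⟩ := exists_le_norm_autFactor |w.re| w.im_pos
  have hpi := Real.pi_pos
  refine ⟨K * (r₁⁻¹ * (r₂ ^ (n + 1))⁻¹), 2 * Real.pi / r₂, r₁, by positivity, by positivity, hr₁,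
    fun p hp z hz ↦ ?_⟩
  obtain ⟨h3, h4⟩ := h₁ p hp z hz
  obtain ⟨-, h5⟩ := h₂ p hp w ⟨le_rfl, le_rfl⟩
  refine ⟨(le_mul_of_one_le_right hr₁.le h3).trans h4, fun x D E hD hE ↦ ?_⟩
  rw [cosetTerm_of_isCoprime hp]
  refine (hle x z w _).trans ?_
  set d := ‖(z : ℂ) - conj (w : ℂ)‖
  set a := ‖autFactor (rowMatrix p) z‖
  set b := ‖autFactor (rowMatrix p) w‖
  have hd : 0 ≤ d := norm_nonneg _
  have ha0 : 0 < a := norm_pos_iff.mpr (autFactor_ne_zero _ _)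
  have hb0 : 0 < b := norm_pos_iff.mpr (autFactor_ne_zero _ _)
  have hp0 : 0 < ‖p‖ := by linarith
  have hb2 : r₂ ≤ b := (le_mul_of_one_le_right hr₂.le h3).trans h5
  have hE' : d / a ≤ E := (div_le_iff₀ ha0).mpr hE
  have hE0 : 0 ≤ E := le_trans (by positivity) hE'
  have hD0 : 0 ≤ D := hd.trans hD
  calc _ ≤ K * (D ^ (n + 1) * Real.exp (2 * Real.pi * (E / r₂)) *
        ((r₁ * ‖p‖)⁻¹ * ((r₂ * ‖p‖) ^ (n + 1))⁻¹)) := by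
        rw [← div_div]
        gcongr
    _ = _ := by
        rw [mul_pow, show -(n + 2 : ℤ) = -((n + 2 : ℕ) : ℤ) by push_cast; ring, _root_.zpow_neg,
          zpow_natCast]
        field_simp
        ring

lemma exists_summable_bound_eichlerSummand (hN : 0 < N) (hn : 1 ≤ n) (u : ℕ → X → ℂ) (w : ℍ)
    (A : ℝ) {B : ℝ} (hB : 0 < B) (A' : ℝ) : ∃ U : (Fin 2 → ℤ) → ℝ, Summable U ∧
      ∀ p x, ∀ z ∈ verticalStrip A B, z.im ≤ A' →
        ‖cosetTerm (eichlerSummand N n u x z w) p‖ ≤ U p := by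
  obtain ⟨C₁, C₂, r, hC₁, hC₂, hr, h⟩ :=
    exists_norm_cosetTerm_eichlerSummand_le hN n u w A hB
  set D : ℝ := |A| + |A'| + ‖(w : ℂ)‖ with hD
  refine ⟨fun p ↦ C₁ * (D ^ (n + 1) * Real.exp (C₂ * (D / r))) * ‖p‖ ^ (-(n + 2 : ℤ)),
    (summable_norm_zpow_neg (by omega)).mul_left _, fun p x z hz hz' ↦ ?_⟩
  by_cases hp : IsCoprime (p 0) (p 1)
  · obtain ⟨h1, h2⟩ := h p hp z hz
    have h3 : ‖(z : ℂ) - conj (w : ℂ)‖ ≤ D := by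
      refine (norm_sub_le _ _).trans ?_
      rw [RCLike.norm_conj, hD]
      gcongr
      refine (Complex.norm_le_abs_re_add_abs_im _).trans (add_le_add (hz.1.trans (le_abs_self A)) ?_)
      change |z.im| ≤ _
      rw [abs_of_pos z.im_pos]
      exact hz'.trans (le_abs_self _)
    refine h2 x D (D / r) h3 (h3.trans ?_)
    rw [div_mul_eq_mul_div, le_div_iff₀ hr]
    gcongr
  · rw [cosetTerm_of_not hp, norm_zero]
    positivity

lemma summable_eichlerSummand (hN : 0 < N) (hn : 1 ≤ n) (u : ℕ → X → ℂ) (x : X) (w z : ℍ) :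
    Summable (cosetTerm (eichlerSummand N n u x z w)) := by
  obtain ⟨U, hU, h⟩ := exists_summable_bound_eichlerSummand hN hn u w |z.re| z.im_pos z.im
  exact hU.of_norm_bounded fun p ↦ h p x z ⟨le_rfl, le_rfl⟩ le_rfl

lemma mdifferentiable_eichlerKernel (hN : 0 < N) (hn : 1 ≤ n) (u : ℕ → X → ℂ) (x : X) (w : ℍ) :
    MDiff (eichlerKernel N n u x w) := by
  refine mdifferentiable_tsum (f := fun p z ↦ cosetTerm (eichlerSummand N n u x z w) p)
    (fun p ↦ ?_) fun A B hB ↦ ?_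
  · by_cases hp : IsCoprime (p 0) (p 1)
    · simp only [cosetTerm_of_isCoprime hp]
      exact mdifferentiable_eichlerSummand x w _
    · simp only [cosetTerm_of_not hp]
      exact mdifferentiable_const
  · obtain ⟨U, hU, h⟩ := exists_summable_bound_eichlerSummand hN hn u w A hB A
    exact ⟨U, hU, fun p z hz hz' ↦ h p x z hz hz'⟩

omit [Finite X] in
lemma hasDerivAt_eichlerSummand {v : ℕ → X → ℂ} (hu : ∀ i x, u i x = conj (v i x)) (x : X)
    (z w : ℍ) (δ : SL(2, ℤ)) :
    HasDerivAt (fun s : ℂ ↦ (∑ i ∈ Finset.range N, u i (δ • x) *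
        truncExp n (freq N (1 + i)) (δ • z : ℍ) ((δ 0 0 * s + δ 0 1) / (δ 1 0 * s + δ 1 1))) *
          autFactor δ z ^ (n : ℤ))
      (-(freq N 1 ^ (n + 1) * (z - conj (w : ℂ)) ^ n / n.factorial) *
        conj ((∑ i ∈ Finset.range N, (((1 + i : ℕ) : ℂ) ^ (n + 1) * v i (δ • x)) *
          qLocal N (δ • w) ^ (1 + i)) * autFactor δ w ^ (-(n + 2 : ℤ)))) (conj (w : ℂ)) := by
  have hz := autFactor_ne_zero δ z
  have hw := autFactor_ne_zero δ w
  have hj : (δ 1 0 : ℂ) * conj (w : ℂ) + δ 1 1 = conj (autFactor δ w) := by simp [autFactor]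
  have hjw : conj (autFactor δ w) ≠ 0 := by simpa using hw
  have hm : ((δ 0 0 : ℂ) * conj (w : ℂ) + δ 0 1) / (δ 1 0 * conj (w : ℂ) + δ 1 1) =
      conj ((δ • w : ℍ) : ℂ) := by
    rw [hj, coe_smul_eq_div]
    simp
  have hdet : (δ 0 0 * δ 1 1 - δ 0 1 * δ 1 0 : ℂ) = 1 := by
    exact_mod_cast (Matrix.det_fin_two _).symm.trans δ.det_coe
  have hmob : HasDerivAt (fun s : ℂ ↦ ((δ 0 0 : ℂ) * s + δ 0 1) / (δ 1 0 * s + δ 1 1))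
      ((conj (autFactor δ w) ^ 2)⁻¹) (conj (w : ℂ)) := by
    have h1 (a b s : ℂ) : HasDerivAt (fun s : ℂ ↦ a * s + b) a s := by
      simpa using ((hasDerivAt_id s).const_mul a).add_const b
    refine ((h1 _ _ _).div (h1 _ _ _) (by rwa [hj])).congr_deriv ?_
    rw [hj, inv_eq_one_div]
    congr 1
    rw [← hj]
    linear_combination hdet
  have key (i : ℕ) := ((HasDerivAt.comp (conj (w : ℂ)) (h₂ := truncExp n (freq N (1 + i))
    (δ • z : ℍ)) (by rw [hm]; exact hasDerivAt_truncExp n _ _ _) hmob).const_mul (u i (δ • x)))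
  refine ((HasDerivAt.fun_sum fun i (_ : i ∈ Finset.range N) ↦ key i).mul_const
    (autFactor δ z ^ (n : ℤ))).congr_deriv ?_
  rw [map_mul, map_sum, Finset.sum_mul, Finset.sum_mul, Finset.mul_sum]
  refine Finset.sum_congr rfl fun i _ ↦ ?_
  have hf : freq N (1 + i) = freq N 1 * ((1 + i : ℕ) : ℂ) := by
    simp only [freq]
    push_cast
    ring
  rw [exp_freq_mul_conj, coe_smul_sub_conj_smul, hf, hu,
    show -(n + 2 : ℤ) = -((n + 2 : ℕ) : ℤ) by push_cast; ring]
  simp only [map_mul, map_pow, _root_.zpow_neg, zpow_natCast, map_inv₀, map_natCast, mul_pow, div_pow]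
  field_simp
  ring

lemma eichlerKernel_eq (hN : 0 < N) (hn : 1 ≤ n) {v : ℕ → X → ℂ}
    (hu : ∀ i x, u i x = conj (v i x)) {ψ : X → ℍ → ℂ} (hψ : IsSeed ψ)
    (hψv : ∀ x z, ψ x z = ∑ i ∈ Finset.range N, (((1 + i : ℕ) : ℂ) ^ (n + 1) * v i x) *
      qLocal N z ^ (1 + i)) (h0 : ∀ x z, poincareSeries (n + 2) ψ x z = 0) (x : X) (w w' z : ℍ) :
    eichlerKernel N n u x w z = eichlerKernel N n u x w' z := by
  classical
  set A : ℝ := |w.re| + |w'.re| + w.im + w'.im + 1 with hA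
  set B : ℝ := min w.im w'.im / 2 with hB
  have hB0 : 0 < B := by have := w.im_pos; have := w'.im_pos; positivity
  set t : Set ℂ := (Complex.re ⁻¹' Set.Ioo (-A) A) ∩ (Complex.im ⁻¹' Set.Ioo (-A) (-B)) with ht
  have hto : IsOpen t :=
    (isOpen_Ioo.preimage Complex.continuous_re).inter (isOpen_Ioo.preimage Complex.continuous_im)
  have htc : Convex ℝ t := ((convex_Ioo _ _).linear_preimage Complex.reLm).inter
    ((convex_Ioo _ _).linear_preimage Complex.imLm)
  have htp : IsPreconnected t := htc.isPreconnected
  have hw : conj (w : ℂ) ∈ t := by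
    have h1 := w.im_pos
    have h2 := w'.im_pos
    have h3 := min_le_left w.im w'.im
    have h4 := neg_abs_le w.re
    have h5 := le_abs_self w.re
    have h6 := abs_nonneg w'.re
    refine ⟨⟨?_, ?_⟩, ?_, ?_⟩ <;> simp <;> linarith
  have hw' : conj (w' : ℂ) ∈ t := by
    have h1 := w.im_pos
    have h2 := w'.im_pos
    have h3 := min_le_right w.im w'.im
    have h4 := neg_abs_le w'.re
    have h5 := le_abs_self w'.re
    have h6 := abs_nonneg w.re
    refine ⟨⟨?_, ?_⟩, ?_, ?_⟩ <;> simp <;> linarith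
  set G : (Fin 2 → ℤ) → ℂ → ℂ := fun p s ↦ cosetTerm (fun δ ↦ (∑ i ∈ Finset.range N, u i (δ • x) *
    truncExp n (freq N (1 + i)) (δ • z : ℍ) ((δ 0 0 * s + δ 0 1) / (δ 1 0 * s + δ 1 1))) *
          autFactor δ z ^ (n : ℤ)) p with hG
  set G' : (Fin 2 → ℤ) → ℂ → ℂ := fun p s ↦ -(freq N 1 ^ (n + 1) * (z - s) ^ n / n.factorial) *
    conj (cosetTerm (fun δ ↦ ψ (δ • x) (δ • ofComplex (conj s)) *
      autFactor δ (ofComplex (conj s)) ^ (-(n + 2 : ℤ))) p) with hG'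
  have hGw (w : ℍ) (p) : G p (conj (w : ℂ)) = cosetTerm (eichlerSummand N n u x z w) p := by
    simp only [hG]
    congr 1
    funext δ
    simp only [eichlerSummand, coe_smul_eq_div δ w, autFactor, map_div₀, map_add, map_mul, map_intCast]
  have hmem {s : ℂ} (hs : s ∈ t) : 0 < (conj s).im := by
    have := hs.2.2
    simp only [Complex.conj_im]
    linarith
  obtain ⟨U, hU, hUle⟩ := hψ.exists_bound (k := n + 2) (by omega) A hB0 A
  have hd (s : ℂ) (hs : s ∈ t) : HasDerivAt (fun s ↦ ∑' p, G p s) 0 s := by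
    have := hasDerivAt_tsum_of_isPreconnected (g := G) (g' := G') (y₀ := conj (w : ℂ)) (y := s)
      (u := fun p ↦ ‖freq N 1‖ ^ (n + 1) * (‖(z : ℂ)‖ + (A + A)) ^ n / n.factorial * U p)
      (hU.mul_left _) hto htp ?_ ?_ hw ?_ hs
    · refine this.congr_deriv ?_
      simp only [hG']
      rw [tsum_mul_left, ← Complex.conj_tsum]
      have h1 := h0 x (ofComplex (conj s))
      rw [poincareSeries, cosetSum] at h1
      rw [h1, map_zero, mul_zero]
    · intro p y hy
      by_cases hp : IsCoprime (p 0) (p 1)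
      · simp only [hG, hG', cosetTerm_of_isCoprime hp, hψv]
        have h1 : conj ((ofComplex (conj y) : ℍ) : ℂ) = y := by
          rw [ofComplex_apply_of_im_pos (hmem hy)]
          simp
        have := hasDerivAt_eichlerSummand (N := N) (n := n) hu x z (ofComplex (conj y)) (rowMatrix p)
        rw [h1] at this
        exact this
      · simp only [hG, hG', cosetTerm_of_not hp, map_zero, mul_zero]
        exact hasDerivAt_const _ _
    · intro p y hy
      have h1 := hUle p x (ofComplex (conj y)) ?_ ?_
      · simp only [hG', norm_mul, norm_neg, norm_div, norm_pow, RCLike.norm_conj,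
          Complex.norm_natCast]
        gcongr
        · refine (norm_sub_le _ _).trans ?_
          gcongr
          refine (Complex.norm_le_abs_re_add_abs_im _).trans ?_
          gcongr
          · exact (abs_lt.mpr hy.1).le
          · exact abs_le.mpr ⟨hy.2.1.le, by have := hy.2.2; have := hy.2.1; linarith⟩
      · rw [ofComplex_apply_of_im_pos (hmem hy)]
        exact ⟨by simpa [UpperHalfPlane.re] using (abs_lt.mpr hy.1).le,
          by have := hy.2.2; simp [UpperHalfPlane.im]; linarith⟩
      · rw [ofComplex_apply_of_im_pos (hmem hy)]
        have := hy.2.1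
        simp [UpperHalfPlane.im]
        linarith
    · simp only [hGw]
      exact summable_eichlerSummand hN hn u x w z
  have := hto.is_const_of_deriv_eq_zero htp
    (fun s hs ↦ (hd s hs).differentiableAt.differentiableWithinAt)
    (fun s hs ↦ (hd s hs).deriv) hw hw'
  simp only [hGw] at this
  exact this

end EichlerKernel

section EichlerGrowth

open ModularGroup Filter Topology Asymptotics
open scoped Manifold ModularForm ComplexConjugate

variable {X : Type} [MulAction SL(2, ℤ) X] [Finite X] {N n : ℕ} {u : ℕ → X → ℂ}

lemma norm_sub_le_mul_im {A : ℝ} {z : ℍ} (hA : 0 ≤ A) (hz : z ∈ verticalStrip A 1) (s : ℂ) :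
    ‖(z : ℂ) - s‖ ≤ (A + 1 + ‖s‖) * z.im := by
  have h1 : 1 ≤ z.im := hz.2
  have h2 : |z.re| ≤ A := hz.1
  calc ‖(z : ℂ) - s‖ ≤ |z.re| + |z.im| + ‖s‖ :=
        (norm_sub_le _ _).trans (add_le_add_left (Complex.norm_le_abs_re_add_abs_im _) _)
    _ ≤ A * z.im + z.im + ‖s‖ * z.im := by
        rw [abs_of_pos z.im_pos]
        gcongr
        · exact h2.trans (le_mul_of_one_le_right hA h1)
        · exact le_mul_of_one_le_right (norm_nonneg _) h1
    _ = _ := by ring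

lemma exists_norm_truncExp_sub_le {A : ℝ} (hA : 0 ≤ A) (n : ℕ) (a s : ℂ) :
    ∃ C, 0 ≤ C ∧ ∀ z : ℍ, z ∈ verticalStrip A 1 →
      ‖truncExp n a z s - Complex.exp (a * z)‖ ≤ C * z.im ^ (n + 1) := by
  refine ⟨‖Complex.exp (a * s)‖ * ∑ j ∈ Finset.range (n + 1), (‖a‖ * (A + 1 + ‖s‖)) ^ j, by positivity,
    fun z hz ↦ ?_⟩
  have h1 : 1 ≤ z.im := hz.2
  rw [truncExp, sub_sub_cancel_left, norm_neg, norm_mul, mul_assoc, Finset.sum_mul]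
  gcongr
  refine norm_sum_le_of_le _ fun j hj ↦ ?_
  rw [norm_div, norm_pow, norm_mul, Complex.norm_natCast]
  calc _ ≤ (‖a‖ * ‖(z : ℂ) - s‖) ^ j := div_le_self (by positivity)
        (by exact_mod_cast j.factorial_pos)
    _ ≤ (‖a‖ * ((A + 1 + ‖s‖) * z.im)) ^ j := by
        gcongr
        exact norm_sub_le_mul_im hA hz s
    _ = (‖a‖ * (A + 1 + ‖s‖)) ^ j * z.im ^ j := by rw [← mul_pow, mul_assoc]
    _ ≤ _ := by
        gcongr
        exact (Finset.mem_range.mp hj).le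

lemma exists_norm_eichlerKernel_sub_le (hN : 0 < N) (hn : 1 ≤ n) (hno : Odd n)
    (hu : ∀ i x, u i (T • x) = zetaN N ^ (1 + i) * u i x)
    (huo : ∀ i x, u i ((-1 : SL(2, ℤ)) • x) = -u i x) {A : ℝ} (hA : 0 ≤ A) (w : ℍ) (x : X) :
    ∃ C, 0 ≤ C ∧ ∀ z ∈ verticalStrip A 1, ‖eichlerKernel N n u x w z -
      2 * ∑ i ∈ Finset.range N, u i x * (qLocal N z ^ (1 + i))⁻¹‖ ≤ C * z.im ^ (n + 1) := by
  obtain ⟨C₁, C₂, r, hC₁, hC₂, hr, h⟩ :=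
    exists_norm_cosetTerm_eichlerSummand_le hN n u w A one_pos
  choose! K hK hKle using fun i ↦ exists_norm_truncExp_sub_le hA n (freq N (1 + i)) (conj (w : ℂ))
  set E : ℝ := A + 1 + ‖(w : ℂ)‖ with hE
  have hE0 : 0 ≤ E := by positivity
  have hsum : Summable fun p : Fin 2 → ℤ ↦ ‖p‖ ^ (-(n + 2 : ℤ)) := summable_norm_zpow_neg (by omega)
  refine ⟨2 * ∑ i ∈ Finset.range N, ‖u i x‖ * K i +
    C₁ * (E ^ (n + 1) * Real.exp (C₂ * E)) * ∑' p : Fin 2 → ℤ, ‖p‖ ^ (-(n + 2 : ℤ)), ?_,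
    fun z hz ↦ ?_⟩
  · have : 0 ≤ ∑' p : Fin 2 → ℤ, ‖p‖ ^ (-(n + 2 : ℤ)) := tsum_nonneg fun p ↦ by positivity
    have := Finset.sum_nonneg fun i (_ : i ∈ Finset.range N) ↦ mul_nonneg (norm_nonneg (u i x)) (hK i)
    positivity
  have hd : ‖(z : ℂ) - conj (w : ℂ)‖ ≤ E * z.im := by
    simpa only [RCLike.norm_conj] using norm_sub_le_mul_im hA hz (conj (w : ℂ))
  have hz0 := z.im_pos
  have h1 : eichlerSummand N n u x z w (-1) = eichlerSummand N n u x z w 1 := by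
    simp only [eichlerSummand, neg_one_smul_uhp, one_smul, huo, neg_mul, Finset.sum_neg_distrib,
      autFactor_neg, autFactor_one, zpow_natCast, hno.neg_one_pow, one_pow, mul_one, mul_neg,
      neg_neg]
  have h2 : eichlerSummand N n u x z w 1 = ∑ i ∈ Finset.range N, u i x *
      truncExp n (freq N (1 + i)) z (conj (w : ℂ)) := by
    simp only [eichlerSummand, one_smul, autFactor_one, zpow_natCast, one_pow, mul_one]
  rw [eichlerKernel, cosetSum_eq_add (eichlerSummand_T hu x z w)
    (summable_eichlerSummand hN hn u x w z), h1, ← two_mul, h2, add_sub_right_comm, ← mul_sub,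
    ← Finset.sum_sub_distrib, add_mul]
  refine (norm_add_le _ _).trans (add_le_add ?_ ?_)
  · rw [norm_mul, Complex.norm_ofNat, mul_assoc, Finset.sum_mul]
    gcongr
    refine norm_sum_le_of_le _ fun i _ ↦ ?_
    rw [← mul_sub, norm_mul, mul_assoc, ← exp_freq_mul]
    gcongr
    exact hKle i z hz
  · rw [mul_assoc, mul_comm (tsum _), ← mul_assoc, ← tsum_mul_left]
    refine tsum_of_norm_bounded (hsum.mul_left _).hasSum fun p ↦ ?_
    split_ifs with hp0
    · rw [norm_zero]; positivity
    by_cases hp : IsCoprime (p 0) (p 1)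
    · have h3 : z.im ≤ ‖autFactor (rowMatrix p) z‖ :=
        im_le_norm_autFactor (by rwa [rowMatrix_apply hp]) z
      refine ((h p hp z hz).2 x (E * z.im) E hd (hd.trans (by gcongr))).trans (le_of_eq ?_)
      rw [mul_pow]
      ring
    · rw [cosetTerm_of_not hp, norm_zero]; positivity

lemma tendsto_mul_qLocal_of_le (hN : 0 < N) {f : ℍ → ℂ} {l : Filter ℍ} (hl : l ≤ atImInfty)
    {C : ℝ} {m : ℕ} (h : ∀ᶠ z in l, ‖f z‖ ≤ C * z.im ^ m) :
    Tendsto (fun z ↦ f z * qLocal N z) l (𝓝 0) := by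
  have hpi := Real.pi_pos
  have h1 := (tendsto_rpow_mul_exp_neg_mul_atTop_nhds_zero m (2 * Real.pi / N)
    (by positivity)).const_mul C
  rw [mul_zero] at h1
  have h2 := h1.comp (tendsto_comap.mono_left hl : Tendsto UpperHalfPlane.im l atTop)
  refine squeeze_zero_norm' ?_ h2
  filter_upwards [h] with z hz
  rw [norm_mul, norm_qLocal]
  simp only [Function.comp_apply, Real.rpow_natCast]
  rw [← mul_assoc]
  refine (mul_le_mul_of_nonneg_right hz (Real.exp_pos _).le).trans (le_of_eq ?_)
  ring_nf

end EichlerGrowth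

section EichlerMap

open ModularGroup Filter Topology Asymptotics
open scoped Manifold ModularForm ComplexConjugate

variable {X : Type} [MulAction SL(2, ℤ) X] [Finite X] {N n : ℕ}

/-- The seed whose Poincaré series is attached to `v`. -/
noncomputable def eichlerSeed (N n : ℕ) (v : X → ℂ) (x : X) (z : ℍ) : ℂ :=
  ∑ i ∈ Finset.range N, (((1 + i : ℕ) : ℂ) ^ (n + 1) * eigenProj N (1 + i) v x) *
    qLocal N z ^ (1 + i)

variable (hN : 0 < N) (hT : ∀ x : X, T ^ N • x = x)

include hN hT in
lemma isSeed_eichlerSeed {v : X → ℂ} (hv : v ∈ oddFunctions X) : IsSeed (eichlerSeed N n v) :=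
  isSeed_sum fun i _ ↦ isSeed_mul_pow (w := (((1 + i : ℕ) : ℂ) ^ (n + 1)) • eigenProj N (1 + i) v)
    (Submodule.smul_mem _ _ (eigenProj_mem hN hT _ hv))

omit [Finite X] in
include hN hT in
lemma eichlerSeed_neg_one_smul {v : X → ℂ} (hv : v ∈ oddFunctions X) (x : X) (z : ℍ) :
    eichlerSeed N n v ((-1 : SL(2, ℤ)) • x) z = -eichlerSeed N n v x z := by
  simp only [eichlerSeed, (eigenProj_mem hN hT _ hv).1 x, mul_neg, neg_mul, Finset.sum_neg_distrib]

omit [Finite X] in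
lemma isZeroAtImInfty_eichlerSeed (hN : 0 < N) (v : X → ℂ) (x : X) :
    IsZeroAtImInfty (eichlerSeed N n v x) := by
  have h : Tendsto (fun z ↦ ∑ i ∈ Finset.range N, (((1 + i : ℕ) : ℂ) ^ (n + 1) *
      eigenProj N (1 + i) v x) * qLocal N z ^ (1 + i)) atImInfty
      (𝓝 (∑ i ∈ Finset.range N, (((1 + i : ℕ) : ℂ) ^ (n + 1) *
        eigenProj N (1 + i) v x) * 0 ^ (1 + i))) :=
    tendsto_finsetSum _ fun i _ ↦ ((tendsto_qLocal hN).pow _).const_mul _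
  rwa [Finset.sum_eq_zero fun i _ ↦ by rw [zero_pow (by omega), mul_zero]] at h

include hN hT in
lemma poincareSeries_eichlerSeed_mem (hn : 1 ≤ n) (hno : Odd n) {v : X → ℂ}
    (hv : v ∈ oddFunctions X) :
    poincareSeries (n + 2) (eichlerSeed N n v) ∈ cuspFamily X (n + 2) := by
  have hs := isSeed_eichlerSeed hN hT (n := n) hv
  refine ⟨hs.poincareSeries_mem (by omega), fun x ↦ ?_⟩
  have h1 := hs.isZeroAtImInfty_sub_two_mul (k := n + 2) (by omega)
    (by exact_mod_cast hno.add_even even_two) (eichlerSeed_neg_one_smul hN hT hv) x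
  have h2 := (isZeroAtImInfty_eichlerSeed (n := n) hN v x).const_mul 2
  have h3 := Tendsto.add h1 h2
  simpa [IsZeroAtImInfty, ZeroAtFilter] using h3

variable (X n) in
/-- The map from odd functions to cusp forms given by Poincaré series. -/
noncomputable def eichlerMap (hn : 1 ≤ n) (hno : Odd n) :
    oddFunctions X →ₗ[ℂ] cuspFamily X (n + 2) where
  toFun v := ⟨poincareSeries (n + 2) (eichlerSeed N n v),
    poincareSeries_eichlerSeed_mem hN hT hn hno v.2⟩
  map_add' v w := by
    ext x z
    have h1 := (isSeed_eichlerSeed hN hT (n := n) v.2).summable (k := n + 2) (by omega) x z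
    have h2 := (isSeed_eichlerSeed hN hT (n := n) w.2).summable (k := n + 2) (by omega) x z
    refine Eq.trans (tsum_congr fun p ↦ ?_) (h1.tsum_add h2)
    by_cases hp : IsCoprime (p 0) (p 1)
    · simp [cosetTerm_of_isCoprime hp, eichlerSeed, mul_add, add_mul, Finset.sum_add_distrib]
    · simp [cosetTerm_of_not hp]
  map_smul' c v := by
    ext x z
    refine Eq.trans (tsum_congr fun p ↦ ?_) tsum_mul_left
    by_cases hp : IsCoprime (p 0) (p 1)
    · simp only [cosetTerm_of_isCoprime hp, eichlerSeed, Finset.mul_sum, Finset.sum_mul]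
      refine Finset.sum_congr rfl fun i _ ↦ ?_
      rw [RingHom.id_apply, SetLike.val_smul, _root_.map_smul, Pi.smul_apply, smul_eq_mul]
      ring
    · simp [cosetTerm_of_not hp]

omit [Finite X] [MulAction SL(2, ℤ) X] in
lemma apply_T_zpow_mul_smul {g : ℍ → ℂ} (h : ∀ z, g ((N : ℝ) +ᵥ z) = g z) (n : ℤ) (z : ℍ) :
    g (T ^ ((N : ℤ) * n) • z) = g z := by
  rw [UpperHalfPlane.modular_T_zpow_smul]
  induction n with
  | zero => simp
  | succ i ih =>
    rw [← ih, ← h ((((N : ℤ) * i : ℤ) : ℝ) +ᵥ z), vadd_vadd]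
    congr 2
    push_cast
    ring
  | pred i ih =>
    rw [← ih, ← h ((((N : ℤ) * (-i - 1) : ℤ) : ℝ) +ᵥ z), vadd_vadd]
    congr 2
    push_cast
    ring

include hN hT in
lemma exists_coeffSum_eq_two_smul_star (hn : 1 ≤ n) (hno : Odd n) {v : X → ℂ}
    (hv : v ∈ oddFunctions X)
    (h0 : ∀ x z, poincareSeries (n + 2) (eichlerSeed N n v) x z = 0) :
    ∃ F : formFamily X (-n + 12), coeffSum X (-n + 12) hN hT 0 F = (2 : ℂ) • star v := by
  have w : ℍ := UpperHalfPlane.I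
  set u : ℕ → X → ℂ := fun i x ↦ conj (eigenProj N (1 + i) v x) with hudef
  have hu (i x) : u i (T • x) = zetaN N ^ (1 + i) * u i x := by
    have h1 := (eigenProj_mem hN hT (1 + i) hv).2 x
    have h2 : conj (zetaN N) * zetaN N = 1 := by
      rw [Complex.conj_mul', Complex.norm_eq_one_of_pow_eq_one (zetaN_pow_self hN) hN.ne']
      simp
    simp only [hudef]
    rw [← h1, map_mul, map_pow, mul_left_comm, ← mul_pow, mul_comm (zetaN N), h2, one_pow, mul_one]
  have huo (i x) : u i ((-1 : SL(2, ℤ)) • x) = -u i x := by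
    simp only [hudef, (eigenProj_mem hN hT (1 + i) hv).1 x, map_neg]
  set Q : X → ℍ → ℂ := fun x ↦ eichlerKernel N n u x w with hQ
  have hQmem : Q ∈ equivariantFamily X (-n) := by
    refine ⟨fun x ↦ mdifferentiable_eichlerKernel hN hn u x w, fun γ x z ↦ ?_⟩
    rw [← eichlerKernel_smul hu γ x w z]
    exact eichlerKernel_eq hN hn (fun _ _ ↦ rfl) (isSeed_eichlerSeed hN hT hv) (fun _ _ ↦ rfl) h0
      _ _ _ _
  have hvadd (x z) : Q x ((N : ℝ) +ᵥ z) = Q x z :=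
    vadd_of_apply_T_smul hT (fun x z ↦ apply_T_smul hQmem x z) x z
  set f : X → ℍ → ℂ := fun x z ↦
    Q x z - 2 * ∑ i ∈ Finset.range N, u i x * (qLocal N z ^ (1 + i))⁻¹ with hf
  have hfvadd (x z) : f x ((N : ℝ) +ᵥ z) = f x z := by
    simp only [hf, hvadd, qLocal_vadd hN]
  have hfm (x) : MDiff (f x) := by
    have h1 : MDiff (∑ i ∈ Finset.range N, fun z ↦ u i x * (qLocal N z ^ (1 + i))⁻¹) :=
      mdifferentiable_finset_sum fun i _ ↦ mdifferentiable_const.mul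
        ((mdifferentiable_qLocal.pow _).inv fun z ↦ pow_ne_zero _ (qLocal_ne_zero z))
    have h2 := (hQmem.1 x).sub ((mdifferentiable_const (c := (2 : ℂ))).mul h1)
    convert h2 using 1
    ext z
    simp [hf]
  have hfb (x) : IsBoundedAtImInfty (f x) := by
    refine (exists_isQSeries_of_tendsto hN (hfvadd x) (hfm x) ?_).bdd
    refine isZeroAtImInfty_of_strip hN (apply_T_zpow_mul_smul (g := fun z ↦ f x z * qLocal N z)
      fun z ↦ ?_) ?_
    · rw [hfvadd, qLocal_vadd hN]
    · obtain ⟨C, -, hC⟩ := exists_norm_eichlerKernel_sub_le hN hn hno hu huo N.cast_nonneg w x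
      exact tendsto_mul_qLocal_of_le hN inf_le_left
        (mem_inf_of_right (mem_principal.mpr hC))
  obtain ⟨h1, h2⟩ := mul_discriminant_mem hN hT hQmem (c := fun m x ↦ 2 * u (N - 1 - m) x) fun x ↦ by
    refine IsBigO.congr_left (hfb x) fun z ↦ ?_
    simp only [hf]
    congr 1
    rw [Finset.mul_sum, Finset.mul_sum, ← Finset.sum_range_reflect]
    refine Finset.sum_congr rfl fun i hi ↦ ?_
    have hi' := Finset.mem_range.mp hi
    have hq := qLocal_ne_zero (N := N) z
    have hp : qLocal 1 z = qLocal N z ^ (1 + (N - 1 - i)) * qLocal N z ^ i := by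
      rw [← qLocal_pow_self hN z, ← pow_add]
      congr 1
      omega
    rw [hp]
    field_simp
  refine ⟨⟨_, h1⟩, ?_⟩
  rw [coeffSum_apply]
  have h3 : ∑ i ∈ Finset.range N, (2 : ℂ) • u i = (2 : ℂ) • star v := by
    rw [← Finset.smul_sum]
    congr 1
    conv_rhs => rw [← sum_eigenProj hN 1 v, star_sum]
    rfl
  rw [← h3, ← Finset.sum_range_reflect (fun i ↦ (2 : ℂ) • u i)]
  refine Finset.sum_congr rfl fun i hi ↦ funext fun x ↦ ?_
  rw [Nat.zero_add]
  exact h2 i (Finset.mem_range.mp hi) x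

/-- The lower bound for the dimension of the space of modular forms provided by the duality. -/
lemma finrank_oddFunctions_le {k : ℤ} (hneg : ∀ l < 0, formFamily X l = ⊥) (hk : Odd k)
    (hk12 : k < 12) : Module.finrank ℂ (oddFunctions X) ≤
      Module.finrank ℂ (formFamily X k) + Module.finrank ℂ (cuspFamily X (14 - k)) := by
  obtain ⟨N, hN, hT⟩ := exists_T_pow_smul_eq X
  obtain ⟨n, hn⟩ : ∃ n : ℕ, k = -n + 12 := ⟨(12 - k).toNat, by omega⟩
  have hno : Odd n := by
    rw [hn] at hk
    rw [← Int.odd_coe_nat]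
    obtain ⟨m, hm⟩ := hk
    exact ⟨5 - m, by omega⟩
  have := finite_formFamily hneg hk
  have hn1 : 1 ≤ n := hno.pos
  have hk' : Odd (n + 2 : ℤ) := by exact_mod_cast hno.add_even even_two
  have hfin := finite_formFamily hneg hk'
  have hfin' : Module.Finite ℂ (cuspFamily X (n + 2)) :=
    Submodule.finiteDimensional_of_le (cuspFamily_le_formFamily X _)
  rw [← LinearMap.finrank_range_add_finrank_ker (eichlerMap X n hN hT hn1 hno), add_comm,
    show 14 - k = n + 2 by omega]
  refine add_le_add ?_ (Submodule.finrank_le _)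
  subst hn
  set B := LinearMap.range (coeffSum X (-n + 12) hN hT 0) with hB
  calc _ = Module.finrank ℂ ((LinearMap.ker (eichlerMap X n hN hT hn1 hno)).map
        (oddFunctions X).subtype) := (Submodule.finrank_map_subtype_eq _ _).symm
    _ ≤ Module.finrank ℂ (conjSubmodule B) := Submodule.finrank_mono ?_
    _ ≤ Module.finrank ℂ (conjSubmodule (conjSubmodule B)) := finrank_le_finrank_conjSubmodule _
    _ = Module.finrank ℂ B := by
        have : conjSubmodule (conjSubmodule B) = B := by
          ext u
          simp [conjSubmodule]
        rw [this]
    _ ≤ _ := LinearMap.finrank_range_le _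
  rintro _ ⟨v, hv, rfl⟩
  obtain ⟨F, hF⟩ := exists_coeffSum_eq_two_smul_star hN hT hn1 hno v.2 fun x z ↦
    (congr_fun (congr_fun (congr_arg Subtype.val (LinearMap.mem_ker.mp hv)) x) z)
  refine ⟨(2⁻¹ : ℂ) • F, ?_⟩
  rw [_root_.map_smul, hF, inv_smul_smul₀ two_ne_zero]
  rfl

end EichlerMap

section EllipticPoint

open ModularGroup Filter Topology
open scoped ComplexConjugate

/-- The elliptic point `exp (π i / 3)`. -/
noncomputable def ellipticRho : ℍ :=
  ⟨⟨1 / 2, √3 / 2⟩, by change 0 < √3 / 2; positivity⟩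

lemma ellipticRho_sq : (ellipticRho : ℂ) ^ 2 = ellipticRho - 1 := by
  have h : √3 * √3 = 3 := Real.mul_self_sqrt (by norm_num)
  apply Complex.ext <;> simp [ellipticRho, sq] <;> linarith

lemma ellipticRho_re : ellipticRho.re = 1 / 2 := rfl

lemma ellipticRho_im : ellipticRho.im = √3 / 2 := rfl

lemma half_le_ellipticRho_im : 1 / 2 ≤ ellipticRho.im := by
  rw [ellipticRho_im]
  gcongr
  exact Real.one_le_sqrt.mpr (by norm_num)

lemma norm_ellipticRho : ‖(ellipticRho : ℂ)‖ = 1 := by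
  have h : √3 * √3 = 3 := Real.mul_self_sqrt (by norm_num)
  rw [← sq_eq_sq₀ (norm_nonneg _) zero_le_one, ← Complex.normSq_eq_norm_sq, Complex.normSq_apply]
  simp only [ellipticRho]
  linarith

/-- A generator of the stabilizer of `ellipticRho`. -/
def ellipticU : SL(2, ℤ) := ⟨!![1, -1; 1, 0], by simp⟩

lemma ellipticU_pow_three : ellipticU ^ 3 = -1 := by
  ext i j; fin_cases i <;> fin_cases j <;> rfl

lemma smul_ellipticRho_iff (γ : SL(2, ℤ)) : γ • ellipticRho = ellipticRho ↔
    γ 0 0 = γ 1 0 + γ 1 1 ∧ γ 0 1 = -γ 1 0 := by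
  have h1 : γ • ellipticRho = ellipticRho ↔
      (γ 0 0 : ℂ) * ellipticRho + γ 0 1 = ellipticRho * autFactor γ ellipticRho := by
    rw [UpperHalfPlane.ext_iff, coe_smul_eq_div, div_eq_iff (autFactor_ne_zero _ _)]
  rw [h1, autFactor, mul_add, mul_left_comm, ← sq, ellipticRho_sq]
  constructor
  · intro h
    have him := congr_arg Complex.im h
    have hre := congr_arg Complex.re h
    have h2 : ellipticRho.im ≠ 0 := ellipticRho.im_ne_zero
    simp at him hre
    have h4 : ((γ 0 0 : ℤ) : ℝ) = γ 1 0 + γ 1 1 := by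
      refine mul_right_cancel₀ h2 ?_
      linarith
    have h5 : ((γ 0 1 : ℤ) : ℝ) = -γ 1 0 := by
      rw [h4, ellipticRho_re] at hre
      linarith
    exact ⟨by exact_mod_cast h4, by exact_mod_cast h5⟩
  · rintro ⟨h2, h3⟩
    rw [h2, h3]
    push_cast
    ring

lemma smul_ellipticRho_iff_mem (γ : SL(2, ℤ)) :
    γ • ellipticRho = ellipticRho ↔ γ ∈ Subgroup.zpowers ellipticU := by
  have hU : ellipticU ∈ MulAction.stabilizer SL(2, ℤ) ellipticRho :=
    (smul_ellipticRho_iff _).mpr ⟨rfl, rfl⟩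
  have hUn (n : ℕ) : ellipticU ^ n • ellipticRho = ellipticRho := pow_mem hU n
  constructor
  · intro h
    obtain ⟨h1, h2⟩ := (smul_ellipticRho_iff γ).mp h
    have hdet : γ 0 0 * γ 1 1 - γ 0 1 * γ 1 0 = 1 := (Matrix.det_fin_two _).symm.trans γ.det_coe
    set c := γ 1 0 with hc
    set d := γ 1 1 with hd
    have hcd : c ^ 2 + c * d + d ^ 2 = 1 := by rw [h1, h2] at hdet; linarith
    have hc1 : c ≤ 1 := by nlinarith [sq_nonneg (c + 2 * d), sq_nonneg (c-1)]
    have hc2 : -1 ≤ c := by nlinarith [sq_nonneg (c + 2 * d), sq_nonneg (c+1)]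
    have hd1 : d ≤ 1 := by nlinarith [sq_nonneg (2 * c + d), sq_nonneg (d-1)]
    have hd2 : -1 ≤ d := by nlinarith [sq_nonneg (2 * c + d), sq_nonneg (d+1)]
    have key : ∃ n : ℕ, (ellipticU ^ n) 1 0 = c ∧ (ellipticU ^ n) 1 1 = d := by
      interval_cases c <;> interval_cases d <;> simp at hcd
      exacts [⟨4, rfl, rfl⟩, ⟨5, rfl, rfl⟩, ⟨3, rfl, rfl⟩, ⟨0, rfl, rfl⟩, ⟨2, rfl, rfl⟩,
        ⟨1, rfl, rfl⟩]
    obtain ⟨n, hn1, hn2⟩ := key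
    obtain ⟨h3, h4⟩ := (smul_ellipticRho_iff _).mp (hUn n)
    refine ⟨n, ?_⟩
    beta_reduce
    rw [zpow_natCast]
    ext i j
    fin_cases i <;> fin_cases j <;> simp only [Fin.mk_one, Fin.zero_eta, Fin.isValue]
    · rw [h3, h1, hn1, hn2]
    · rw [h4, h2, hn1]
    · exact hn1
    · exact hn2
  · intro h
    exact (Subgroup.zpowers_le.mpr hU) h

end EllipticPoint

section PointSeries

open ModularGroup Filter Topology
open scoped ComplexConjugate Manifold

lemma S_mul_apply_one (γ : SL(2, ℤ)) (j : Fin 2) : (S * γ) 1 j = γ 0 j := by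
  have h : (S * γ) 1 j = ((!![0, -1; 1, 0] : Matrix (Fin 2) (Fin 2) ℤ) * (γ : Matrix (Fin 2) (Fin 2) ℤ)) 1 j := rfl
  rw [h, Matrix.mul_apply, Fin.sum_univ_two]
  simp

lemma autFactor_S_mul (γ : SL(2, ℤ)) (z : ℍ) :
    autFactor (S * γ) z = (γ • z : ℍ) * autFactor γ z := by
  rw [coe_smul_eq_div, div_mul_cancel₀ _ (autFactor_ne_zero _ _), autFactor, S_mul_apply_one,
    S_mul_apply_one]

/-- The denominators of the Poincaré series attached to the elliptic point. -/
noncomputable def pointFactor (γ : SL(2, ℤ)) (z : ℍ) : ℂ :=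
  ((γ • z : ℍ) - conj (ellipticRho : ℂ)) * autFactor γ z

lemma pointFactor_mul (γ δ : SL(2, ℤ)) (z : ℍ) :
    pointFactor (γ * δ) z = pointFactor γ (δ • z) * autFactor δ z := by
  rw [pointFactor, pointFactor, mul_smul, autFactor_mul, mul_assoc]

lemma half_le_norm_sub_conj (z : ℍ) : 1 / 2 ≤ ‖(z : ℂ) - conj (ellipticRho : ℂ)‖ := by
  refine le_trans ?_ (Complex.abs_im_le_norm _)
  have h1 := half_le_ellipticRho_im
  have h2 := z.im_pos
  have h3 : ((z : ℂ) - conj (ellipticRho : ℂ)).im = z.im + ellipticRho.im := by simp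
  rw [h3, abs_of_pos (by linarith)]
  linarith

lemma pointFactor_ne_zero (γ : SL(2, ℤ)) (z : ℍ) : pointFactor γ z ≠ 0 := by
  refine mul_ne_zero (norm_pos_iff.mp ?_) (autFactor_ne_zero _ _)
  linarith [half_le_norm_sub_conj (γ • z)]

lemma norm_autFactor_le_pointFactor (γ : SL(2, ℤ)) (z : ℍ) :
    ‖autFactor γ z‖ ≤ 3 * ‖pointFactor γ z‖ ∧ ‖autFactor (S * γ) z‖ ≤ 3 * ‖pointFactor γ z‖ := by
  have h := half_le_norm_sub_conj (γ • z)
  rw [autFactor_S_mul, pointFactor, norm_mul, norm_mul, ← mul_assoc]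
  refine ⟨le_mul_of_one_le_left (norm_nonneg _) (by linarith), ?_⟩
  gcongr
  have h1 := norm_add_le (((γ • z : ℍ) : ℂ) - conj (ellipticRho : ℂ)) (conj (ellipticRho : ℂ))
  rw [sub_add_cancel, RCLike.norm_conj, norm_ellipticRho] at h1
  linarith

lemma isCoprime_row (γ : SL(2, ℤ)) : IsCoprime (γ 1 0) (γ 1 1) :=
  ModularGroup.bottom_row_coprime γ

lemma exists_le_norm_pointFactor (A : ℝ) {B : ℝ} (hB : 0 < B) : ∃ r : ℝ, 0 < r ∧
    ∀ γ : SL(2, ℤ), ∀ z ∈ verticalStrip A B, 1 ≤ ‖γ 0‖ ∧ 1 ≤ ‖γ 1‖ ∧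
      r * ‖γ 0‖ ≤ ‖pointFactor γ z‖ ∧ r * ‖γ 1‖ ≤ ‖pointFactor γ z‖ := by
  obtain ⟨r, hr, h⟩ := exists_le_norm_autFactor A hB
  refine ⟨r / 3, by positivity, fun γ z hz ↦ ?_⟩
  have e (γ : SL(2, ℤ)) : autFactor (rowMatrix (γ 1)) z = autFactor γ z :=
    autFactor_rowMatrix (isCoprime_row γ) z
  have h1 := h (γ 1) (isCoprime_row γ) z hz
  have h2 := h ((S * γ) 1) (isCoprime_row _) z hz
  rw [e] at h1 h2
  have h3 : (S * γ) 1 = γ 0 := funext (S_mul_apply_one γ)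
  rw [h3] at h2
  obtain ⟨h4, h5⟩ := norm_autFactor_le_pointFactor γ z
  exact ⟨h2.1, h1.1, by linarith, by linarith⟩

lemma exists_summable_pointFactor (A : ℝ) {B : ℝ} (hB : 0 < B) (k : ℕ) (hk : 6 ≤ k) :
    ∃ U : SL(2, ℤ) → ℝ, Summable U ∧ ∀ γ, ∀ z ∈ verticalStrip A B,
      ‖(pointFactor γ z)⁻¹‖ ^ k ≤ U γ := by
  obtain ⟨r, hr, h⟩ := exists_le_norm_pointFactor A hB
  have h3 := summable_norm_zpow_neg (k := 3) le_rfl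
  have hs := h3.mul_of_nonneg h3 (fun _ ↦ by positivity) (fun _ ↦ by positivity)
  have hi : Function.Injective fun γ : SL(2, ℤ) ↦ ((γ 0, γ 1) : (Fin 2 → ℤ) × (Fin 2 → ℤ)) := by
    intro γ δ hγ
    obtain ⟨h1, h2⟩ := Prod.ext_iff.mp hγ
    ext i j
    fin_cases i
    exacts [congr_fun h1 j, congr_fun h2 j]
  refine ⟨_, (hs.comp_injective hi).mul_left (r⁻¹ ^ k), fun γ z hz ↦ ?_⟩
  obtain ⟨h0, h1, h2, h3⟩ := h γ z hz
  simp only [Function.comp_apply, norm_inv]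
  have ha : 0 < ‖γ 0‖ := by linarith
  have hb : 0 < ‖γ 1‖ := by linarith
  obtain ⟨m, rfl⟩ := Nat.exists_eq_add_of_le hk
  have h4 : r ≤ ‖pointFactor γ z‖ := (le_mul_of_one_le_right hr.le h0).trans h2
  calc ‖pointFactor γ z‖⁻¹ ^ (6 + m) = ‖pointFactor γ z‖⁻¹ ^ 3 * ‖pointFactor γ z‖⁻¹ ^ 3 *
        ‖pointFactor γ z‖⁻¹ ^ m := by ring
    _ ≤ (r * ‖γ 0‖)⁻¹ ^ 3 * (r * ‖γ 1‖)⁻¹ ^ 3 * r⁻¹ ^ m := by gcongr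
    _ = _ := by
        rw [_root_.zpow_neg, _root_.zpow_neg]
        norm_cast
        simp only [_root_.mul_inv_rev, mul_pow, inv_pow, pow_add]
        ring

lemma mdifferentiable_pointFactor (γ : SL(2, ℤ)) : MDiff (pointFactor γ) := by
  have h := mdifferentiable_of_differentiable (g := fun z : ℂ ↦ ((γ 0 0 : ℂ) * z + γ 0 1) -
    conj (ellipticRho : ℂ) * (γ 1 0 * z + γ 1 1)) (by fun_prop)
  convert h using 1
  ext z
  rw [pointFactor, coe_smul_eq_div, sub_mul, div_mul_cancel₀ _ (autFactor_ne_zero _ _), autFactor]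

variable {X : Type} [MulAction SL(2, ℤ) X]

/-- The Poincaré series attached to the elliptic point. -/
noncomputable def pointSeries (k : ℕ) (u : X → ℂ) (x : X) (z : ℍ) : ℂ :=
  ∑' γ : SL(2, ℤ), u (γ • x) * (pointFactor γ z)⁻¹ ^ k

lemma pointSeries_smul (k : ℕ) (u : X → ℂ) (γ : SL(2, ℤ)) (x : X) (z : ℍ) :
    pointSeries k u (γ • x) (γ • z) = autFactor γ z ^ k * pointSeries k u x z := by
  rw [pointSeries, pointSeries, ← (Equiv.mulRight γ).tsum_eq fun δ ↦ u (δ • x) * _, ← tsum_mul_left]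
  refine tsum_congr fun δ ↦ ?_
  rw [Equiv.coe_mulRight, pointFactor_mul, mul_smul, _root_.mul_inv_rev, mul_pow]
  have := autFactor_ne_zero γ z
  simp only [inv_pow]
  field_simp

variable [Finite X]

omit [MulAction SL(2, ℤ) X] in
lemma exists_norm_le_of_finite (u : X → ℂ) : ∃ C : ℝ, 0 ≤ C ∧ ∀ x, ‖u x‖ ≤ C := by
  have := Fintype.ofFinite X
  exact ⟨∑ x, ‖u x‖, by positivity,
    fun x ↦ Finset.single_le_sum (f := fun x ↦ ‖u x‖) (fun _ _ ↦ norm_nonneg _) (Finset.mem_univ x)⟩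

lemma exists_summable_pointSeries {k : ℕ} (hk : 6 ≤ k) (u : X → ℂ) (A : ℝ) {B : ℝ} (hB : 0 < B) :
    ∃ U : SL(2, ℤ) → ℝ, Summable U ∧ ∀ γ, ∀ x, ∀ z ∈ verticalStrip A B,
      ‖u (γ • x) * (pointFactor γ z)⁻¹ ^ k‖ ≤ U γ := by
  obtain ⟨U, hU, h⟩ := exists_summable_pointFactor A hB k hk
  obtain ⟨C, hC, hCu⟩ := exists_norm_le_of_finite u
  refine ⟨fun γ ↦ C * U γ, hU.mul_left C, fun γ x z hz ↦ ?_⟩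
  rw [norm_mul, norm_pow]
  exact mul_le_mul (hCu _) (h γ z hz) (by positivity) hC

lemma pointSeries_mem {k : ℕ} (hk : 6 ≤ k) (u : X → ℂ) : pointSeries k u ∈ formFamily X k := by
  have hM (x : X) : MDiff (pointSeries k u x) := by
    refine mdifferentiable_tsum (fun γ ↦ ?_) fun A B hB ↦ ?_
    · rw [UpperHalfPlane.mdifferentiable_iff]
      exact ((((UpperHalfPlane.mdifferentiable_iff.mp (mdifferentiable_pointFactor γ)).inv
        fun z _ ↦ pointFactor_ne_zero γ _).pow k).const_mul _)
    · obtain ⟨U, hU, h⟩ := exists_summable_pointSeries hk u A hB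
      exact ⟨U, hU, fun γ z hz _ ↦ h γ x z hz⟩
  have hE : pointSeries k u ∈ equivariantFamily X k :=
    ⟨hM, fun γ x z ↦ by rw [pointSeries_smul, zpow_natCast]⟩
  refine ⟨hE, fun x ↦ ?_⟩
  obtain ⟨N, hN, hT⟩ := exists_T_pow_smul_eq X
  have hv (z : ℍ) : pointSeries k u x ((N : ℝ) +ᵥ z) = pointSeries k u x z :=
    vadd_of_apply_T_smul hT (apply_T_smul hE) x z
  refine (exists_isQSeries_of_tendsto hN hv (hM x) ?_).bdd
  obtain ⟨U, hU, h⟩ := exists_summable_pointSeries hk u N one_pos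
  refine isZeroAtImInfty_of_strip hN (apply_T_zpow_mul_smul
    (g := fun z ↦ pointSeries k u x z * qLocal N z) fun z ↦ ?_) ?_
  · rw [hv, qLocal_vadd hN]
  · refine tendsto_mul_qLocal_of_le hN inf_le_left (C := ∑' γ, U γ) (m := 0)
      (mem_inf_of_right (mem_principal.mpr fun z hz ↦ ?_))
    simp only [pow_zero, mul_one, Set.mem_ofPred_eq]
    exact tsum_of_norm_bounded hU.hasSum fun γ ↦ h γ x z hz

end PointSeries

section EllipticEvaluation

open ModularGroup Filter Topology
open scoped ComplexConjugate Manifold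

lemma ellipticU_smul : ellipticU • ellipticRho = ellipticRho :=
  (smul_ellipticRho_iff _).mpr ⟨rfl, rfl⟩

lemma autFactor_ellipticU : autFactor ellipticU ellipticRho = ellipticRho := by
  simp [autFactor, ellipticU]

lemma ellipticRho_pow_six : (ellipticRho : ℂ) ^ 6 = 1 := by
  have h := ellipticRho_sq
  linear_combination (ellipticRho ^ 4 + ellipticRho ^ 3 - ellipticRho - 1 : ℂ) * h

lemma pow_ellipticRho_of_smul_eq {γ : SL(2, ℤ)} (h : γ • ellipticRho = ellipticRho) :
    pointFactor γ ellipticRho =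
      ((ellipticRho : ℂ) - conj (ellipticRho : ℂ)) * autFactor γ ellipticRho := by
  rw [pointFactor, h]

lemma normSq_pointFactor (γ : SL(2, ℤ)) : ‖pointFactor γ ellipticRho‖ ^ 2 =
    ‖(ellipticRho : ℂ) - conj (ellipticRho : ℂ)‖ ^ 2 +
      ‖((γ • ellipticRho : ℍ) - ellipticRho : ℂ)‖ ^ 2 * ‖autFactor γ ellipticRho‖ ^ 2 := by
  have h := im_smul_eq_autFactor γ ellipticRho
  have h0 : ‖autFactor γ ellipticRho‖ ^ 2 ≠ 0 :=
    pow_ne_zero 2 (norm_ne_zero_iff.mpr (autFactor_ne_zero _ _))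
  rw [eq_div_iff h0] at h
  rw [pointFactor, norm_mul, mul_pow]
  have h1 : ‖((γ • ellipticRho : ℍ) : ℂ) - conj (ellipticRho : ℂ)‖ ^ 2 =
      ‖((γ • ellipticRho : ℍ) - ellipticRho : ℂ)‖ ^ 2 +
        4 * ((γ • ellipticRho).im * ellipticRho.im) := by
    simp only [← Complex.normSq_eq_norm_sq, Complex.normSq_apply, Complex.sub_re, Complex.sub_im,
      Complex.conj_re, Complex.conj_im, coe_im, coe_re]
    ring
  have h2 : ‖(ellipticRho : ℂ) - conj (ellipticRho : ℂ)‖ ^ 2 = 4 * ellipticRho.im ^ 2 := by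
    simp only [← Complex.normSq_eq_norm_sq, Complex.normSq_apply, Complex.sub_re, Complex.sub_im,
      Complex.conj_re, Complex.conj_im, coe_im, coe_re]
    ring
  rw [h1, h2]
  linear_combination 4 * ellipticRho.im * h

lemma ellipticRho_sub_conj_ne_zero : (ellipticRho : ℂ) - conj (ellipticRho : ℂ) ≠ 0 := by
  refine norm_pos_iff.mp ?_
  linarith [half_le_norm_sub_conj ellipticRho]

/-- The ratio governing the terms of the point series at the elliptic point. -/
noncomputable def pointRatio (γ : SL(2, ℤ)) : ℂ :=
  ((ellipticRho : ℂ) - conj (ellipticRho : ℂ)) * (pointFactor γ ellipticRho)⁻¹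

lemma norm_pointRatio_le (γ : SL(2, ℤ)) : ‖pointRatio γ‖ ≤ 1 := by
  have h := normSq_pointFactor γ
  have h0 := norm_pos_iff.mpr (pointFactor_ne_zero γ ellipticRho)
  rw [pointRatio, norm_mul, norm_inv, ← div_eq_mul_inv, div_le_one h0]
  refine le_of_sq_le_sq ?_ h0.le
  rw [h]
  exact le_add_of_nonneg_right (by positivity)

lemma norm_pointRatio_lt {γ : SL(2, ℤ)} (hγ : γ • ellipticRho ≠ ellipticRho) :
    ‖pointRatio γ‖ < 1 := by
  have h := normSq_pointFactor γ
  have h0 := norm_pos_iff.mpr (pointFactor_ne_zero γ ellipticRho)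
  rw [pointRatio, norm_mul, norm_inv, ← div_eq_mul_inv, div_lt_one h0]
  refine lt_of_pow_lt_pow_left₀ 2 h0.le ?_
  rw [h]
  have h1 : 0 < ‖((γ • ellipticRho : ℍ) - ellipticRho : ℂ)‖ :=
    norm_pos_iff.mpr (sub_ne_zero.mpr fun h ↦ hγ (UpperHalfPlane.ext h))
  have h2 := norm_pos_iff.mpr (autFactor_ne_zero γ ellipticRho)
  exact lt_add_of_pos_right _ (by positivity)

variable (X : Type) [MulAction SL(2, ℤ) X]

/-- The space of possible values at the elliptic point of families of weight `k`. -/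
noncomputable def pointFunctions (k : ℕ) : Submodule ℂ (X → ℂ) where
  carrier := {v | ∀ x, v (ellipticU • x) = (ellipticRho : ℂ) ^ k * v x}
  add_mem' hv hw x := by rw [Pi.add_apply, Pi.add_apply, hv x, hw x, mul_add]
  zero_mem' x := by simp
  smul_mem' c v hv x := by rw [Pi.smul_apply, Pi.smul_apply, hv x, smul_eq_mul, smul_eq_mul]; ring

variable {X}

lemma isOfFinOrder_ellipticU : IsOfFinOrder ellipticU :=
  isOfFinOrder_iff_pow_eq_one.mpr ⟨6, by norm_num, by
    rw [show 6 = 3 * 2 from rfl, pow_mul, ellipticU_pow_three, neg_one_sq]⟩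

lemma autFactor_ellipticU_pow (n : ℕ) :
    autFactor (ellipticU ^ n) ellipticRho = (ellipticRho : ℂ) ^ n := by
  induction n with
  | zero => rw [pow_zero, autFactor_one, pow_zero]
  | succ n ih => rw [pow_succ, autFactor_mul, ellipticU_smul, ih, autFactor_ellipticU, pow_succ]

lemma pointFunctions_apply {k : ℕ} {v : X → ℂ} (hv : v ∈ pointFunctions X k) {γ : SL(2, ℤ)}
    (hγ : γ • ellipticRho = ellipticRho) (x : X) :
    v (γ • x) = autFactor γ ellipticRho ^ k * v x := by
  rw [smul_ellipticRho_iff_mem, ← isOfFinOrder_ellipticU.mem_powers_iff_mem_zpowers] at hγ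
  obtain ⟨n, rfl⟩ := hγ
  beta_reduce
  rw [autFactor_ellipticU_pow]
  induction n with
  | zero => simp
  | succ n ih => rw [pow_succ', mul_smul, hv, ih]; ring

lemma pointFunctions_add_six (k : ℕ) : pointFunctions X (k + 6) = pointFunctions X k := by
  ext v
  refine forall_congr' fun x ↦ ?_
  rw [pow_add, ellipticRho_pow_six, mul_one]

variable [Finite X]

lemma tendsto_pointSeries {k : ℕ} (hk : 6 ≤ k) {v : X → ℂ} (hv : v ∈ pointFunctions X k) (x : X) :
    Tendsto (fun n : ℕ ↦ ((ellipticRho : ℂ) - conj (ellipticRho : ℂ)) ^ (k + 6 * n) *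
      pointSeries (k + 6 * n) v x ellipticRho) atTop
      (𝓝 (Nat.card (Subgroup.zpowers ellipticU) * v x)) := by
  classical
  have h1 (n : ℕ) : ((ellipticRho : ℂ) - conj (ellipticRho : ℂ)) ^ (k + 6 * n) *
      pointSeries (k + 6 * n) v x ellipticRho =
      ∑' γ : SL(2, ℤ), v (γ • x) * pointRatio γ ^ (k + 6 * n) := by
    rw [pointSeries, ← tsum_mul_left]
    refine tsum_congr fun γ ↦ ?_
    rw [pointRatio, mul_pow]
    ring
  have h2 : (∑' γ : SL(2, ℤ), (Subgroup.zpowers ellipticU : Set SL(2, ℤ)).indicator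
      (fun _ ↦ v x) γ) = Nat.card (Subgroup.zpowers ellipticU) * v x := by
    rw [← tsum_subtype, tsum_const, nsmul_eq_mul]
    rfl
  simp only [h1]
  rw [← h2]
  obtain ⟨U, hU, hUle⟩ := exists_summable_pointSeries le_rfl v |ellipticRho.re| ellipticRho.im_pos
  refine tendsto_tsum_of_dominated_convergence (hU.mul_left
    (‖(ellipticRho : ℂ) - conj (ellipticRho : ℂ)‖ ^ 6)) (fun γ ↦ ?_) (.of_forall fun n γ ↦ ?_)
  · by_cases hγ : γ • ellipticRho = ellipticRho
    · rw [Set.indicator_of_mem (by exact (smul_ellipticRho_iff_mem γ).mp hγ)]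
      refine tendsto_const_nhds.congr fun n ↦ ?_
      have hv' : v ∈ pointFunctions X (k + 6 * n) := by
        induction n with
        | zero => exact hv
        | succ n ih => rwa [mul_add, ← add_assoc, mul_one, pointFunctions_add_six]
      have h0 := ellipticRho_sub_conj_ne_zero
      have h3 := autFactor_ne_zero γ ellipticRho
      rw [pointFunctions_apply hv' hγ, pointRatio, pow_ellipticRho_of_smul_eq hγ,
        _root_.mul_inv_rev, mul_left_comm, mul_inv_cancel₀ h0, mul_one, mul_right_comm, ← mul_pow,
        mul_inv_cancel₀ h3, one_pow, one_mul]
    · rw [Set.indicator_of_notMem fun h ↦ hγ ((smul_ellipticRho_iff_mem γ).mpr h)]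
      have h3 := ((tendsto_pow_atTop_nhds_zero_of_norm_lt_one (norm_pointRatio_lt hγ)).comp
        (tendsto_atTop_mono (fun n ↦ show n ≤ k + 6 * n by omega) tendsto_id)).const_mul (v (γ • x))
      rwa [mul_zero] at h3
  · have h3 := hUle γ x ellipticRho ⟨le_rfl, le_rfl⟩
    calc ‖v (γ • x) * pointRatio γ ^ (k + 6 * n)‖ ≤ ‖v (γ • x)‖ * ‖pointRatio γ‖ ^ 6 := by
          rw [norm_mul, norm_pow]
          gcongr ?_ * ?_
          exact pow_le_pow_of_le_one (norm_nonneg _) (norm_pointRatio_le γ) (by omega)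
      _ = ‖(ellipticRho : ℂ) - conj (ellipticRho : ℂ)‖ ^ 6 *
          ‖v (γ • x) * (pointFactor γ ellipticRho)⁻¹ ^ 6‖ := by
          rw [pointRatio, norm_mul, norm_mul, norm_pow, mul_pow]
          ring
      _ ≤ _ := by gcongr

variable (X) in
/-- Evaluation at the elliptic point. -/
noncomputable def pointEval (k : ℤ) : formFamily X k →ₗ[ℂ] X → ℂ where
  toFun F x := F.1 x ellipticRho
  map_add' _ _ := rfl
  map_smul' _ _ := rfl

lemma eventually_finrank_pointFunctions_le {k : ℕ} (hk : 6 ≤ k) : ∀ᶠ n : ℕ in atTop,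
    Module.finrank ℂ (pointFunctions X k) ≤
      Module.finrank ℂ (LinearMap.range (pointEval X (k + 6 * n : ℕ))) := by
  have := Fintype.ofFinite X
  let b := Module.finBasis ℂ (pointFunctions X k)
  have hc : (Nat.card (Subgroup.zpowers ellipticU) : ℂ) ≠ 0 := by
    have := isOfFinOrder_ellipticU.finite_zpowers
    have : Finite (Subgroup.zpowers ellipticU) := this
    exact_mod_cast Nat.card_pos.ne'
  have hb : LinearIndependent ℂ fun i ↦ (Nat.card (Subgroup.zpowers ellipticU) : ℂ) • (b i : X → ℂ) := by
    have h1 := b.linearIndependent.map' (pointFunctions X k).subtype (Submodule.ker_subtype _)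
    exact h1.units_smul fun _ ↦ Units.mk0 _ hc
  have ht : Tendsto (fun (n : ℕ) i ↦ pointEval X (k + 6 * n : ℕ)
      (((ellipticRho : ℂ) - conj (ellipticRho : ℂ)) ^ (k + 6 * n) •
        ⟨pointSeries (k + 6 * n) (b i : X → ℂ), pointSeries_mem (by omega) _⟩)) atTop
      (𝓝 fun i ↦ (Nat.card (Subgroup.zpowers ellipticU) : ℂ) • (b i : X → ℂ)) := by
    refine tendsto_pi_nhds.mpr fun i ↦ tendsto_pi_nhds.mpr fun x ↦ ?_
    exact tendsto_pointSeries hk (b i).2 x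
  filter_upwards [ht.eventually hb.eventually] with n hn
  have h1 : LinearIndependent ℂ fun i ↦ (⟨_, LinearMap.mem_range_self _
      (((ellipticRho : ℂ) - conj (ellipticRho : ℂ)) ^ (k + 6 * n) •
        ⟨pointSeries (k + 6 * n) (b i : X → ℂ), pointSeries_mem (by omega) _⟩)⟩ :
      LinearMap.range (pointEval X (k + 6 * n : ℕ))) :=
    LinearIndependent.of_comp (LinearMap.range (pointEval X (k + 6 * n : ℕ))).subtype hn
  simpa using h1.fintype_card_le_finrank

lemma eisenstein_four_apply_ellipticRho :
    ModularForm.E (k := 4) (by norm_num) ellipticRho = 0 := by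
  have h := apply_smul_of_slash_eq ((ModularForm.E (k := 4) (by norm_num)).slash_action_eq' _
    ⟨ellipticU, rfl⟩) ellipticRho
  have h1 : (ellipticRho : ℂ) ^ 4 = -ellipticRho := by
    linear_combination (ellipticRho ^ 2 + ellipticRho : ℂ) * ellipticRho_sq
  rw [ellipticU_smul, autFactor_ellipticU] at h
  have h2 : (ellipticRho : ℂ) + 1 ≠ 0 := fun h ↦ by
    have := congr_arg Complex.im h
    simp at this
    exact ellipticRho.im_ne_zero this
  have h3 : ((ellipticRho : ℂ) + 1) * ModularForm.E (k := 4) (by norm_num) ellipticRho = 0 := by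
    have h4 : (ellipticRho : ℂ) ^ ((4 : ℕ) : ℤ) = -ellipticRho := by exact_mod_cast h1
    rw [h4] at h
    linear_combination h
  exact (mul_eq_zero.mp h3).resolve_left h2

omit [Finite X] in
lemma finrank_formFamily_le_ker_pointEval (k : ℤ) [Module.Finite ℂ (formFamily X (k + 4))] :
    Module.finrank ℂ (formFamily X k) ≤
      Module.finrank ℂ (LinearMap.ker (pointEval X (k + 4))) := by
  let e := ModularForm.E (k := 4) (by norm_num)
  let φ : formFamily X k →ₗ[ℂ] LinearMap.ker (pointEval X (k + 4)) :=
    { toFun := fun F ↦ ⟨⟨F.1 * fun _ ↦ ⇑e, mul_mem_formFamily F.2 (modularForm_mem_formFamily e)⟩,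
        funext fun x ↦ mul_eq_zero_of_right _ eisenstein_four_apply_ellipticRho⟩
      map_add' := fun F G ↦ Subtype.ext <| Subtype.ext <| add_mul F.1 G.1 _
      map_smul' := fun c F ↦ Subtype.ext <| Subtype.ext <| smul_mul_assoc c F.1 _ }
  refine LinearMap.finrank_le_finrank_of_injective (f := φ) ?_
  refine (injective_iff_map_eq_zero φ).mpr fun F hF ↦ ?_
  refine Subtype.ext <| funext fun x ↦ ?_
  have h1 : F.1 x * ⇑e = 0 := congr_fun (congr_arg (fun G ↦ G.1.1) hF) x
  refine ((UpperHalfPlane.mul_eq_zero_iff (F.2.1.1 x) e.holo').mp h1).resolve_right fun h ↦ ?_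
  exact EisensteinSeries.E_ne_zero (k := 4) (by norm_num) ⟨2, rfl⟩ (DFunLike.coe_injective h)

lemma finrank_formFamily_add_finrank_pointFunctions_le (hneg : ∀ l < 0, formFamily X l = ⊥) {k : ℕ}
    (hk : Odd k) (hk3 : 3 ≤ k) : Module.finrank ℂ (formFamily X k) +
      Module.finrank ℂ (pointFunctions X (k + 4)) ≤ Module.finrank ℂ (formFamily X (k + 4)) := by
  obtain ⟨n, hn⟩ := (eventually_finrank_pointFunctions_le (X := X)
    (show 6 ≤ k + 4 by omega)).exists_forall_of_atTop
  have h1 := hn (2 * n) (by omega)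
  have hodd : Odd ((k : ℤ) + 12 * n + 4) := by
    have : Odd (k : ℤ) := by exact_mod_cast hk
    grind
  have hfin := finite_formFamily hneg hodd
  have h2 := finrank_formFamily_le_ker_pointEval (X := X) (k + 12 * n)
  have h3 := LinearMap.finrank_range_add_finrank_ker (pointEval X ((k : ℤ) + 12 * n + 4))
  have e1 : (((k + 4) + 6 * (2 * n) : ℕ) : ℤ) = (k : ℤ) + 12 * n + 4 := by push_cast; ring
  rw [e1] at h1
  have h4 (l : ℤ) (hl : Odd l) (hl3 : 3 ≤ l) (n : ℕ) :
      Module.finrank ℂ (formFamily X (l + 12 * n)) =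
        Module.finrank ℂ (formFamily X l) + n * Module.finrank ℂ (oddFunctions X) := by
    induction n with
    | zero => rw [Nat.cast_zero, mul_zero, add_zero, zero_mul, add_zero]
    | succ n ih =>
      have h5 : l + 12 * (n + 1 : ℕ) = l + 12 * n + 12 := by push_cast; ring
      rw [h5, finrank_formFamily_add_twelve_eq (k := l + 12 * n) hneg (by omega) (by grind), ih]
      ring
  have hko : Odd (k : ℤ) := by exact_mod_cast hk
  have h5 := h4 k hko (by omega) n
  have h6 := h4 (k + 4) (by grind) (by omega) n
  have e2 : (k : ℤ) + 12 * n + 4 = k + 4 + 12 * n := by ring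
  rw [e2] at h1 h2 h3
  omega

end EllipticEvaluation

section CharacterFunctions

open MulAction

variable {G X : Type*} [Group G] [MulAction G X]

variable (X) in
/-- Functions that transform under a group action by a character. -/
def charFunctions (χ : G →* ℂ) : Submodule ℂ (X → ℂ) where
  carrier := {v | ∀ g x, v (g • x) = χ g * v x}
  add_mem' hv hw g x := by rw [Pi.add_apply, Pi.add_apply, hv g x, hw g x, mul_add]
  zero_mem' g x := by simp
  smul_mem' c v hv g x := by rw [Pi.smul_apply, Pi.smul_apply, hv g x, smul_eq_mul, smul_eq_mul]; ring

/-- The character is trivial on the stabilizers of the points of the orbit. -/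
def IsGoodOrbit (χ : G →* ℂ) (ω : orbitRel.Quotient G X) : Prop :=
  ∀ x, (Quotient.mk'' x : orbitRel.Quotient G X) = ω → ∀ g : G, g • x = x → χ g = 1

lemma mk_smul_eq (g : G) (x : X) :
    (Quotient.mk'' (g • x) : orbitRel.Quotient G X) = Quotient.mk'' x :=
  Quotient.sound' (mem_orbit x g)

lemma exists_smul_eq_of_mk_eq {x y : X} (h : (Quotient.mk'' x : orbitRel.Quotient G X) =
    Quotient.mk'' y) : ∃ g : G, g • y = x := Quotient.exact' h

lemma finrank_charFunctions [Finite X] (χ : G →* ℂ) : Module.finrank ℂ (charFunctions X χ) =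
    Nat.card {ω : orbitRel.Quotient G X // IsGoodOrbit χ ω} := by
  classical
  have : Finite (orbitRel.Quotient G X) := inferInstanceAs (Finite (Quotient _))
  have hχ (g : G) : χ g ≠ 0 := ((Group.isUnit g).map χ).ne_zero
  have := Fintype.ofFinite {ω : orbitRel.Quotient G X // IsGoodOrbit χ ω}
  rw [Nat.card_eq_fintype_card, ← Module.finrank_fintype_fun_eq_card ℂ]
  let φ : charFunctions X χ →ₗ[ℂ] {ω : orbitRel.Quotient G X // IsGoodOrbit χ ω} → ℂ :=
    { toFun := fun v ω ↦ v.1 ω.1.out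
      map_add' := fun _ _ ↦ rfl
      map_smul' := fun _ _ ↦ rfl }
  choose g hg using fun x : X ↦ exists_smul_eq_of_mk_eq (G := G)
    (Quotient.out_eq' (Quotient.mk'' x : orbitRel.Quotient G X)).symm
  refine (LinearEquiv.ofBijective φ ⟨(injective_iff_map_eq_zero φ).mpr fun v hv ↦ ?_,
    fun c ↦ ?_⟩).finrank_eq
  · refine Subtype.ext <| funext fun x ↦ ?_
    by_cases hx : IsGoodOrbit χ (Quotient.mk'' x : orbitRel.Quotient G X)
    · have h1 : v.1 (Quotient.out _) = 0 := congr_fun hv ⟨_, hx⟩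
      rw [← hg x, v.2, h1, mul_zero]
      rfl
    · simp only [IsGoodOrbit, not_forall] at hx
      obtain ⟨y, hy, h, hh, hne⟩ := hx
      obtain ⟨h', rfl⟩ := exists_smul_eq_of_mk_eq hy
      have h1 := v.2 h (h' • x)
      rw [hh, v.2 h' x] at h1
      have h2 : (χ h - 1) * (χ h' * v.1 x) = 0 := by linear_combination -h1
      simpa [sub_eq_zero, hne, hχ] using h2
  · let c' : orbitRel.Quotient G X → ℂ := fun ω ↦ if h : IsGoodOrbit χ ω then c ⟨ω, h⟩ else 0
    have key (ω) (hω : IsGoodOrbit χ ω) (x : X) (hx : Quotient.mk'' x = ω) (h h' : G)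
        (hh : h • x = h' • x) : χ h = χ h' := by
      have h1 := hω x hx (h'⁻¹ * h) (by rw [mul_smul, hh, inv_smul_smul])
      have h2 : χ h = χ h' * χ (h'⁻¹ * h) := by rw [← map_mul, mul_inv_cancel_left]
      rw [h2, h1, mul_one]
    refine ⟨⟨fun x ↦ χ (g x) * c' (Quotient.mk'' x), fun h x ↦ ?_⟩, funext fun ω ↦ ?_⟩
    · beta_reduce
      rw [mk_smul_eq]
      by_cases hω : IsGoodOrbit χ (Quotient.mk'' x : orbitRel.Quotient G X)
      · have h1 := hg (h • x)
        rw [mk_smul_eq] at h1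
        rw [key _ hω _ (Quotient.out_eq' _) (g (h • x)) (h * g x) (by rw [h1, mul_smul, hg x]),
          map_mul, mul_assoc]
      · simp [c', hω]
    · have h1 := hg ω.1.out
      change χ (g ω.1.out) * c' (Quotient.mk'' ω.1.out) = c ω
      rw [Quotient.out_eq'] at h1 ⊢
      rw [key _ ω.2 _ (Quotient.out_eq' _) (g ω.1.out) 1 (by rw [h1, one_smul]), map_one, one_mul]
      exact dif_pos ω.2

end CharacterFunctions

section DoubleCoset

open MulAction

variable {G Ω : Type*} [Group G] [MulAction G Ω] {Γ H : Subgroup G} {a : Ω}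

lemma card_orbit_sets_eq (hH : ∀ g : G, g • a = a ↔ g ∈ H) {Q : Ω → Prop}
    (hQ : ∀ s, Q s → ∃ g : G, g • a = s) {R : orbitRel.Quotient H (G ⧸ Γ) → Prop}
    (hR : ∀ γ : G, R (Quotient.mk'' (γ : G ⧸ Γ)) ↔ Q (γ⁻¹ • a)) :
    Nat.card {O : Set Ω // ∃ s, Q s ∧ O = {y | ∃ γ ∈ Γ, γ • s = y}} = Nat.card {ω // R ω} := by
  let f : orbitRel.Quotient H (G ⧸ Γ) → Set Ω :=
    fun ω ↦ {y | ∃ γ : G, Quotient.mk'' (γ : G ⧸ Γ) = ω ∧ γ⁻¹ • a = y}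
  have hf (γ : G) : f (Quotient.mk'' (γ : G ⧸ Γ)) = {y | ∃ g ∈ Γ, g • γ⁻¹ • a = y} := by
    ext y
    constructor
    · rintro ⟨δ, hδ, rfl⟩
      obtain ⟨h, hh⟩ := exists_smul_eq_of_mk_eq hδ
      have h1 : ((h : G) * γ : G ⧸ Γ) = δ := hh
      rw [QuotientGroup.eq] at h1
      refine ⟨_, inv_mem h1, ?_⟩
      have h2 := (hH _).mpr h.2
      rw [← mul_smul, _root_.mul_inv_rev, inv_inv, mul_assoc, mul_assoc, mul_inv_cancel, mul_one,
        mul_smul, h2]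
    · rintro ⟨g, hg, rfl⟩
      refine ⟨γ * g⁻¹, congr_arg _ ?_, by rw [_root_.mul_inv_rev, inv_inv, mul_smul]⟩
      rw [QuotientGroup.mk_mul_of_mem _ (inv_mem hg)]
  refine (Nat.card_eq_of_bijective (fun ω : {ω // R ω} ↦ (⟨f ω.1, ?_⟩ :
    {O : Set Ω // ∃ s, Q s ∧ O = {y | ∃ γ ∈ Γ, γ • s = y}})) ⟨?_, ?_⟩).symm
  · obtain ⟨ω, hω⟩ := ω
    induction ω using Quotient.inductionOn' with | _ x
    induction x using QuotientGroup.induction_on with | _ γ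
    exact ⟨_, (hR γ).mp hω, hf γ⟩
  · rintro ⟨ω, hω⟩ ⟨ω', hω'⟩ h
    have h1 : f ω = f ω' := congr_arg Subtype.val h
    induction ω using Quotient.inductionOn' with | _ x
    induction x using QuotientGroup.induction_on with | _ γ
    have h2 : γ⁻¹ • a ∈ f ω' := h1 ▸ ⟨γ, rfl, rfl⟩
    obtain ⟨δ, rfl, h3⟩ := h2
    have h4 : γ * δ⁻¹ ∈ H := by rw [← hH, mul_smul, h3, smul_inv_smul]
    refine Subtype.ext ?_
    have h5 := mk_smul_eq (⟨_, h4⟩ : H) (δ : G ⧸ Γ)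
    have h6 : (⟨_, h4⟩ : H) • (δ : G ⧸ Γ) = γ := by
      change ((γ * δ⁻¹ * δ : G) : G ⧸ Γ) = γ
      rw [inv_mul_cancel_right]
    rw [h6] at h5
    exact h5
  · rintro ⟨O, s, hs, rfl⟩
    obtain ⟨g, rfl⟩ := hQ s hs
    refine ⟨⟨Quotient.mk'' ((g⁻¹ : G) : G ⧸ Γ), (hR _).mpr (by rwa [inv_inv])⟩, Subtype.ext ?_⟩
    change f _ = _
    rw [hf, inv_inv]

end DoubleCoset

section Counting

open ModularGroup MulAction

variable {X : Type} [MulAction SL(2, ℤ) X]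

lemma ellipticU_pow_six : ellipticU ^ 6 = 1 := by
  rw [show 6 = 3 * 2 from rfl, pow_mul, ellipticU_pow_three, neg_one_sq]

/-- The automorphy factor at the elliptic point as a character of its stabilizer. -/
noncomputable def pointChar : Subgroup.zpowers ellipticU →* ℂ where
  toFun g := autFactor g ellipticRho
  map_one' := autFactor_one _
  map_mul' g h := by
    rw [Subgroup.coe_mul, autFactor_mul, (smul_ellipticRho_iff_mem _).mpr h.2]

lemma exists_pow_eq (g : Subgroup.zpowers ellipticU) : ∃ n : ℕ, ellipticU ^ n = g :=
  (isOfFinOrder_ellipticU.mem_powers_iff_mem_zpowers).mpr g.2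

lemma pointFunctions_eq (k : ℕ) : pointFunctions X k = charFunctions X (pointChar ^ k) := by
  ext v
  refine ⟨fun hv g x ↦ pointFunctions_apply hv ((smul_ellipticRho_iff_mem _).mpr g.2) x,
    fun hv x ↦ ?_⟩
  have h := hv ⟨ellipticU, Subgroup.mem_zpowers _⟩ x
  rw [MonoidHom.pow_apply] at h
  rw [← autFactor_ellipticU]
  exact h

lemma eq_or_eq_of_mem_plusMinusOne {g : SL(2, ℤ)} (hg : g ∈ plusMinusOne) : g = 1 ∨ g = -1 := by
  obtain ⟨n, rfl⟩ := hg
  exact (Int.even_or_odd n).imp (fun h ↦ h.neg_one_zpow) (fun h ↦ h.neg_one_zpow)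

lemma card_plusMinusOne : Nat.card plusMinusOne = 2 := by
  have h : orderOf (-1 : SL(2, ℤ)) = 2 := orderOf_eq_prime (neg_one_sq) (by decide)
  rw [plusMinusOne, Nat.card_zpowers, h]

lemma oddFunctions_eq : oddFunctions X = charFunctions X
    ((pointChar.comp (Subgroup.inclusion (H := plusMinusOne)
      (Subgroup.zpowers_le.mpr ⟨3, ellipticU_pow_three⟩)))) := by
  ext v
  constructor
  · rintro hv ⟨g, hg⟩ x
    rcases eq_or_eq_of_mem_plusMinusOne hg with rfl | rfl
    · change v ((1 : SL(2, ℤ)) • x) = autFactor 1 ellipticRho * v x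
      rw [one_smul, autFactor_one, one_mul]
    · refine (hv x).trans ?_
      change _ = autFactor (-1) ellipticRho * v x
      rw [autFactor_neg, autFactor_one, neg_one_mul]
  · intro hv x
    have h := hv ⟨-1, Subgroup.mem_zpowers _⟩ x
    refine h.trans ?_
    change autFactor (-1) ellipticRho * v x = _
    rw [autFactor_neg, autFactor_one, neg_one_mul]

variable (hX : ∀ x : X, (-1 : SL(2, ℤ)) • x ≠ x)

include hX in
lemma exists_sq_pow_eq {x : X} {g : Subgroup.zpowers ellipticU} (hg : g • x = x) :
    ∃ j : ℕ, (ellipticU ^ 2) ^ j = g := by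
  obtain ⟨n, hn⟩ := exists_pow_eq g
  rcases Nat.even_or_odd n with ⟨j, hj⟩ | h
  · exact ⟨j, by rw [← hn, hj, ← two_mul, pow_mul]⟩
  · refine absurd ?_ (hX x)
    have h1 : (-1 : SL(2, ℤ)) = g ^ 3 := by
      rw [← hn, ← pow_mul, mul_comm, pow_mul, ellipticU_pow_three, h.neg_one_pow]
    have h2 : g ∈ stabilizer (Subgroup.zpowers ellipticU) x := hg
    rw [h1]
    exact pow_mem h2 3

include hX in
lemma two_mul_finrank_oddFunctions [Finite X] :
    2 * Module.finrank ℂ (oddFunctions X) = Nat.card X := by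
  have hfree (g : plusMinusOne) (x : X) (h : g • x = x) : g = 1 :=
    Subtype.ext <| (eq_or_eq_of_mem_plusMinusOne g.2).resolve_right fun h1 ↦ hX x <| by
      rw [← h1]; exact h
  have h1 (x : X) : stabilizer plusMinusOne x = ⊥ :=
    (Subgroup.eq_bot_iff_forall _).mpr fun g hg ↦ hfree g x hg
  rw [oddFunctions_eq, finrank_charFunctions, Nat.card_congr (selfEquivOrbitsQuotientProd h1),
    Nat.card_prod, card_plusMinusOne, mul_comm]
  congr 1
  refine Nat.card_congr (Equiv.subtypeUnivEquiv fun ω x _ g hg ↦ ?_)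
  rw [hfree g x hg, map_one]

/-- The orbits of the stabilizer of the elliptic point whose points have a stabilizer of order
three. -/
def IsFixedOrbit (ω : orbitRel.Quotient (Subgroup.zpowers ellipticU) X) : Prop :=
  ∀ x, (Quotient.mk'' x : orbitRel.Quotient (Subgroup.zpowers ellipticU) X) = ω →
    ellipticU ^ 2 • x = x

lemma isFixedOrbit_mk (x : X) :
    IsFixedOrbit (Quotient.mk'' x : orbitRel.Quotient (Subgroup.zpowers ellipticU) X) ↔
      ellipticU ^ 2 • x = x := by
  refine ⟨fun h ↦ h x rfl, fun h y hy ↦ ?_⟩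
  obtain ⟨g, rfl⟩ := exists_smul_eq_of_mk_eq hy
  obtain ⟨n, hn⟩ := exists_pow_eq g
  change ellipticU ^ 2 • (g : SL(2, ℤ)) • x = (g : SL(2, ℤ)) • x
  rw [← hn, ← mul_smul, ← pow_add, add_comm, pow_add, mul_smul, h]

lemma ellipticU_sq_pow_three : (ellipticU ^ 2) ^ 3 = 1 := by
  rw [← pow_mul, ellipticU_pow_six]

lemma ellipticU_sq_ne_one : ellipticU ^ 2 ≠ 1 := by decide

include hX in
lemma eq_one_of_smul_eq {x : X} (hx : ellipticU ^ 2 • x ≠ x) {g : Subgroup.zpowers ellipticU}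
    (hg : g • x = x) : g = 1 := by
  obtain ⟨j, hj⟩ := exists_sq_pow_eq hX hg
  refine Subtype.ext (hj.symm.trans ?_)
  by_contra h
  refine hx ?_
  have h3 : j ^ 2 % 3 = 1 := by
    have : j % 3 ≠ 0 := fun h0 ↦ h <| by
      obtain ⟨i, rfl⟩ := Nat.dvd_of_mod_eq_zero h0
      rw [pow_mul, ellipticU_sq_pow_three, one_pow]
      rfl
    have h12 : j % 3 = 1 ∨ j % 3 = 2 := by omega
    rcases h12 with h12 | h12 <;> simp [Nat.pow_mod, h12]
  have h4 : (ellipticU ^ 2) ^ (j ^ 2) = ellipticU ^ 2 := by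
    rw [← Nat.div_add_mod (j ^ 2) 3, h3, pow_add, pow_mul, ellipticU_sq_pow_three, one_pow, one_mul,
      pow_one]
  have h5 : (g : SL(2, ℤ)) ∈ stabilizer SL(2, ℤ) x := hg
  have h6 := pow_mem h5 j
  rwa [← hj, ← pow_mul, ← sq, h4] at h6

include hX in
lemma card_stabilizer_of_ne {x : X} (hx : ellipticU ^ 2 • x ≠ x) :
    Nat.card (stabilizer (Subgroup.zpowers ellipticU) x) = 1 := by
  have h : stabilizer (Subgroup.zpowers ellipticU) x = ⊥ :=
    (Subgroup.eq_bot_iff_forall _).mpr fun g hg ↦ eq_one_of_smul_eq hX hx hg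
  rw [h, Subgroup.card_bot]

include hX in
lemma card_stabilizer_of_eq {x : X} (hx : ellipticU ^ 2 • x = x) :
    Nat.card (stabilizer (Subgroup.zpowers ellipticU) x) = 3 := by
  let u : Subgroup.zpowers ellipticU := ⟨ellipticU ^ 2, ⟨2, rfl⟩⟩
  have hu : orderOf u = 3 := by
    rw [← Subgroup.orderOf_coe]
    exact orderOf_eq_prime ellipticU_sq_pow_three ellipticU_sq_ne_one
  have h : stabilizer (Subgroup.zpowers ellipticU) x = Subgroup.zpowers u := by
    refine le_antisymm (fun g hg ↦ ?_) (Subgroup.zpowers_le.mpr hx)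
    obtain ⟨j, hj⟩ := exists_sq_pow_eq hX hg
    exact ⟨j, Subtype.ext (by simpa [u] using hj)⟩
  rw [h, Nat.card_zpowers, hu]

lemma card_zpowers_ellipticU : Nat.card (Subgroup.zpowers ellipticU) = 6 := by
  rw [Nat.card_zpowers]
  refine orderOf_eq_of_pow_and_pow_div_prime (by norm_num) ellipticU_pow_six fun p hp hdvd ↦ ?_
  have h : p = 2 ∨ p = 3 := by
    have := (hp.dvd_mul (m := 2) (n := 3)).mp hdvd
    exact this.imp (Nat.prime_dvd_prime_iff_eq hp Nat.prime_two).mp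
      (Nat.prime_dvd_prime_iff_eq hp Nat.prime_three).mp
  rcases h with rfl | rfl <;> decide

variable (X) in
/-- The number of orbits of the stabilizer of the elliptic point. -/
noncomputable def numOrbits : ℕ := Nat.card (orbitRel.Quotient (Subgroup.zpowers ellipticU) X)

variable (X) in
/-- The number of orbits of the stabilizer of the elliptic point that are not free modulo
`-1`. -/
noncomputable def numFixedOrbits : ℕ :=
  Nat.card {ω : orbitRel.Quotient (Subgroup.zpowers ellipticU) X // IsFixedOrbit ω}

include hX in
lemma three_mul_numOrbits [Finite X] :
    3 * numOrbits X = Module.finrank ℂ (oddFunctions X) + 2 * numFixedOrbits X := by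
  classical
  have : Finite (Subgroup.zpowers ellipticU) := Nat.finite_of_card_ne_zero
    (by rw [card_zpowers_ellipticU]; norm_num)
  have : Finite (orbitRel.Quotient (Subgroup.zpowers ellipticU) X) :=
    inferInstanceAs (Finite (Quotient _))
  have := Fintype.ofFinite (Subgroup.zpowers ellipticU)
  have := Fintype.ofFinite X
  have := Fintype.ofFinite (orbitRel.Quotient (Subgroup.zpowers ellipticU) X)
  have h := card_eq_sum_card_group_div_card_stabilizer (Subgroup.zpowers ellipticU) X
  have hω (ω : orbitRel.Quotient (Subgroup.zpowers ellipticU) X) :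
      Fintype.card (Subgroup.zpowers ellipticU) / Fintype.card (stabilizer (Subgroup.zpowers
        ellipticU) ω.out) + (if IsFixedOrbit ω then 4 else 0) = 6 := by
    rw [← Nat.card_eq_fintype_card, ← Nat.card_eq_fintype_card, card_zpowers_ellipticU]
    have h1 := isFixedOrbit_mk ω.out
    rw [Quotient.out_eq'] at h1
    split_ifs with h2
    · rw [card_stabilizer_of_eq hX (h1.mp h2)]
    · rw [card_stabilizer_of_ne hX (h1.not.mp h2)]
  have h2 := Finset.sum_congr (rfl : Finset.univ = Finset.univ) fun ω _ ↦ hω ω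
  rw [Finset.sum_add_distrib, ← h, ← Finset.sum_filter, Finset.sum_const, Finset.sum_const,
    ← Fintype.card_subtype, Finset.card_univ, ← Nat.card_eq_fintype_card,
    ← Nat.card_eq_fintype_card, ← Nat.card_eq_fintype_card, ← two_mul_finrank_oddFunctions hX] at h2
  simp only [smul_eq_mul] at h2
  unfold numOrbits numFixedOrbits
  omega

lemma pointChar_pow (k n : ℕ) {g : Subgroup.zpowers ellipticU} (h : ellipticU ^ n = g) :
    (pointChar ^ k) g = (ellipticRho : ℂ) ^ (n * k) := by
  rw [MonoidHom.pow_apply, pow_mul, ← autFactor_ellipticU_pow, h]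
  rfl

include hX in
lemma finrank_pointFunctions_of_dvd [Finite X] {k : ℕ} (hk : 3 ∣ k) :
    Module.finrank ℂ (pointFunctions X k) = numOrbits X := by
  rw [pointFunctions_eq, finrank_charFunctions]
  refine Nat.card_congr (Equiv.subtypeUnivEquiv fun ω x _ g hg ↦ ?_)
  obtain ⟨j, hj⟩ := exists_sq_pow_eq hX hg
  obtain ⟨i, rfl⟩ := hk
  rw [← pow_mul] at hj
  rw [pointChar_pow _ _ hj, show 2 * j * (3 * i) = 6 * (j * i) by ring, pow_mul,
    ellipticRho_pow_six, one_pow]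

include hX in
lemma finrank_pointFunctions_of_not_dvd [Finite X] {k : ℕ} (hk : ¬3 ∣ k) :
    Module.finrank ℂ (pointFunctions X k) + numFixedOrbits X = numOrbits X := by
  classical
  have : Finite (orbitRel.Quotient (Subgroup.zpowers ellipticU) X) :=
    inferInstanceAs (Finite (Quotient _))
  have := Fintype.ofFinite (orbitRel.Quotient (Subgroup.zpowers ellipticU) X)
  have h (ω : orbitRel.Quotient (Subgroup.zpowers ellipticU) X) :
      IsGoodOrbit (pointChar ^ k) ω ↔ ¬IsFixedOrbit ω := by
    induction ω using Quotient.inductionOn' with | _ x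
    rw [isFixedOrbit_mk]
    constructor
    · intro h h1
      have h2 := h x rfl ⟨ellipticU ^ 2, ⟨2, rfl⟩⟩ h1
      rw [pointChar_pow k 2 rfl, pow_mul] at h2
      have h3 : orderOf ((ellipticRho : ℂ) ^ 2) = 3 := by
        refine orderOf_eq_prime (by rw [← pow_mul, ellipticRho_pow_six]) fun h ↦ ?_
        rw [ellipticRho_sq] at h
        have := congr_arg Complex.re h
        have h4 := ellipticRho_re
        simp at this
        rw [h4] at this
        norm_num at this
      exact hk (h3 ▸ orderOf_dvd_of_pow_eq_one h2)
    · intro h y hy g hg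
      have hy1 : ellipticU ^ 2 • y ≠ y := by
        rwa [← isFixedOrbit_mk x, ← hy, isFixedOrbit_mk] at h
      rw [eq_one_of_smul_eq hX hy1 hg, map_one]
  rw [pointFunctions_eq, finrank_charFunctions, numFixedOrbits, numOrbits,
    Nat.card_congr (Equiv.subtypeEquivRight h), add_comm, ← Nat.card_sum]
  exact Nat.card_congr (Equiv.sumCompl _)

end Counting

section Elliptic

open ModularGroup MulAction

variable {Γ : Subgroup SL(2, ℤ)} (hΓ : -1 ∉ Γ)

include hΓ in
lemma neg_one_smul_ne (x : SL(2, ℤ) ⧸ Γ) : (-1 : SL(2, ℤ)) • x ≠ x := by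
  induction x using QuotientGroup.induction_on with | _ γ
  intro h
  have h1 : ((-1 * γ : SL(2, ℤ)) : SL(2, ℤ) ⧸ Γ) = γ := h
  rw [eq_comm, QuotientGroup.eq, neg_one_mul, mul_neg, inv_mul_cancel] at h1
  exact hΓ h1

include hΓ in
lemma card_quotient_eq_two_mul_nuZero : Nat.card (SL(2, ℤ) ⧸ Γ) = 2 * nuZero Γ := by
  have h1 : nuZero Γ = (Γ ⊔ plusMinusOne).index := by
    rw [nuZero, Subgroup.index_map, QuotientGroup.ker_mk', MonoidHom.range_eq_top.mpr
      (QuotientGroup.mk'_surjective _), Subgroup.index_top, mul_one]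
  have h2 : Γ.relIndex (Γ ⊔ plusMinusOne) = 2 := by
    refine Subgroup.relIndex_eq_two_iff.mpr ⟨-1, Subgroup.mem_sup_right
      (Subgroup.mem_zpowers _), fun b hb ↦ ?_⟩
    obtain ⟨y, hy, z, hz, rfl⟩ := Subgroup.mem_sup_of_normal_right.mp hb
    have hn : -y ∉ Γ := fun h ↦ hΓ <| by
      have := mul_mem h (inv_mem hy)
      rwa [neg_mul, mul_inv_cancel] at this
    rcases eq_or_eq_of_mem_plusMinusOne hz with rfl | rfl
    · exact Or.inr ⟨by simpa, by simpa⟩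
    · exact Or.inl ⟨by simpa, by simpa⟩
  have h3 := Subgroup.relIndex_mul_index (le_sup_left : Γ ≤ Γ ⊔ plusMinusOne)
  rw [h2, ← h1] at h3
  exact h3.symm

include hΓ in
lemma finrank_oddFunctions_eq_nuZero [Γ.FiniteIndex] :
    Module.finrank ℂ (oddFunctions (SL(2, ℤ) ⧸ Γ)) = nuZero Γ := by
  have h := two_mul_finrank_oddFunctions (neg_one_smul_ne hΓ)
  rw [card_quotient_eq_two_mul_nuZero hΓ] at h
  omega

lemma eq_or_eq_of_toPSL_eq_one {g : SL(2, ℤ)} (hg : toPSL g = 1) : g = 1 ∨ g = -1 := by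
  have h : Matrix.SpecialLinearGroup.map (Int.castRingHom ℝ) g ∈ Subgroup.center SL(2, ℝ) :=
    (QuotientGroup.eq_one_iff _).mp hg
  obtain ⟨r, hr, h⟩ := Matrix.SpecialLinearGroup.mem_center_iff.mp h
  have he (i j) : Matrix.scalar (Fin 2) r i j = (g i j : ℝ) := by rw [h]; rfl
  have h00 := he 0 0
  have h01 := he 0 1
  have h10 := he 1 0
  have h11 := he 1 1
  simp at h00 h01 h10 h11
  rw [Fintype.card_fin, sq_eq_one_iff] at hr
  rcases hr with rfl | rfl
  · left
    ext i j
    fin_cases i <;> fin_cases j <;> simp_all <;> norm_cast at * <;> simp_all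
  · right
    ext i j
    fin_cases i <;> fin_cases j <;> simp_all <;> norm_cast at * <;> simp_all

include hΓ in
lemma isEllipticPointOfOrder_three_iff (z : ℍ) : IsEllipticPointOfOrder Γ 3 z ↔
    Nat.card (Γ ⊓ stabilizer SL(2, ℤ) z : Subgroup SL(2, ℤ)) = 3 := by
  have h : Nat.card (Subgroup.map toPSL (Γ ⊓ stabilizer SL(2, ℤ) z)) =
      Nat.card (Γ ⊓ stabilizer SL(2, ℤ) z : Subgroup SL(2, ℤ)) := by
    refine Nat.card_image_of_injOn
      (s := ((Γ ⊓ stabilizer SL(2, ℤ) z : Subgroup SL(2, ℤ)) : Set SL(2, ℤ))) fun a ha b hb hab ↦ ?_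
    have h1 : toPSL (a⁻¹ * b) = 1 := by rw [map_mul, map_inv, hab, inv_mul_cancel]
    have h2 : a⁻¹ * b ∈ Γ := mul_mem (inv_mem ha.1) hb.1
    rcases eq_or_eq_of_toPSL_eq_one h1 with h3 | h3
    · exact inv_mul_eq_one.mp h3
    · exact absurd (h3 ▸ h2) hΓ
  rw [IsEllipticPointOfOrder, h]
  refine and_iff_right_of_imp fun h1 ↦ ?_
  have : Fact (Nat.Prime 3) := ⟨Nat.prime_three⟩
  exact isCyclic_of_prime_card (h.trans h1)

lemma trace_eq_neg_one_of_pow_three_eq_one {g : SL(2, ℤ)} (h : g ^ 3 = 1) (hne : g ≠ 1) :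
    g 0 0 + g 1 1 = -1 := by
  have h1 : g * g = g⁻¹ := by rw [eq_inv_iff_mul_eq_one, ← h, pow_three', ]
  have hm (i j) : (g * g) i j = g⁻¹ i j := by rw [h1]
  have h00 : g 0 0 * g 0 0 + g 0 1 * g 1 0 = g 1 1 := by
    simpa [Matrix.mul_apply, Matrix.adjugate_fin_two] using hm 0 0
  have h01 : g 0 0 * g 0 1 + g 0 1 * g 1 1 = -g 0 1 := by
    simpa [Matrix.mul_apply, Matrix.adjugate_fin_two] using hm 0 1
  have h10 : g 1 0 * g 0 0 + g 1 1 * g 1 0 = -g 1 0 := by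
    simpa [Matrix.mul_apply, Matrix.adjugate_fin_two] using hm 1 0
  have h11 : g 1 0 * g 0 1 + g 1 1 * g 1 1 = g 0 0 := by
    simpa [Matrix.mul_apply, Matrix.adjugate_fin_two] using hm 1 1
  have hd := g.det_coe
  rw [Matrix.det_fin_two] at hd
  by_contra ht
  have hb : g 0 1 = 0 := by
    have : g 0 1 * (g 0 0 + g 1 1 + 1) = 0 := by linear_combination h01
    exact (mul_eq_zero.mp this).resolve_right fun h ↦ ht (by linear_combination h)
  have hc : g 1 0 = 0 := by
    have : g 1 0 * (g 0 0 + g 1 1 + 1) = 0 := by linear_combination h10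
    exact (mul_eq_zero.mp this).resolve_right fun h ↦ ht (by linear_combination h)
  rw [hb, zero_mul, sub_zero] at hd
  rw [hb, zero_mul, add_zero] at h00
  have ha : g 0 0 = 1 := (Int.eq_one_or_neg_one_of_mul_eq_one hd).resolve_right fun h ↦ by
    rw [h] at h00 hd
    linarith
  refine hne ?_
  rw [ha] at h00
  ext i j
  fin_cases i <;> fin_cases j <;> simp [ha, hb, hc, ← h00]

lemma exists_smul_ellipticRho_eq {z : ℍ} {g : SL(2, ℤ)} (h : g ^ 3 = 1) (hne : g ≠ 1)
    (hg : g • z = z) : ∃ γ : SL(2, ℤ), γ • ellipticRho = z := by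
  obtain ⟨δ, hδ⟩ := exists_smul_mem_fd z
  set w := δ • z with hw
  suffices ∃ γ : SL(2, ℤ), γ • ellipticRho = w by
    obtain ⟨γ, hγ⟩ := this
    exact ⟨δ⁻¹ * γ, by rw [mul_smul, hγ, hw, inv_smul_smul]⟩
  set e := δ * g * δ⁻¹ with he
  have he1 : e • w = w := by rw [he, hw, mul_smul, inv_smul_smul, mul_smul, hg]
  have he3 : e ^ 3 = 1 := by rw [he, conj_pow, h, mul_one, mul_inv_cancel]
  have hne : e ≠ 1 := fun h1 ↦ hne (conj_eq_one_iff.mp h1)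
  have ht : (e 0 0 : ℝ) + e 1 1 = -1 := by
    exact_mod_cast trace_eq_neg_one_of_pow_three_eq_one he3 hne
  have hd : (e 0 0 : ℝ) * e 1 1 - e 0 1 * e 1 0 = 1 := by
    have := e.det_coe
    rw [Matrix.det_fin_two] at this
    exact_mod_cast this
  have h1 : (e 0 0 : ℂ) * w + e 0 1 = w * (e 1 0 * w + e 1 1) := by
    have h2 := coe_smul_eq_div e w
    rw [he1, eq_div_iff] at h2
    · exact h2.symm
    · exact autFactor_ne_zero e w
  have hre := congr_arg Complex.re h1
  have him := congr_arg Complex.im h1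
  simp at hre him
  have hy := w.im_pos
  have hy3 := three_le_four_mul_im_sq_of_mem_fd hδ
  have h2 : 2 * (e 1 0 : ℝ) * w.re = e 0 0 - e 1 1 := by
    apply mul_right_cancel₀ hy.ne'
    linear_combination -him
  have h3 : (e 0 1 : ℝ) = -e 1 0 * (w.re ^ 2 + w.im ^ 2) := by
    linear_combination hre + w.re * h2
  have h4 : 4 * (e 1 0 : ℝ) ^ 2 * w.im ^ 2 = 3 := by
    have h5 : ((e 0 0 : ℝ) + e 1 1) ^ 2 = 4 - 4 * (e 1 0 : ℝ) ^ 2 * w.im ^ 2 := by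
      linear_combination 4 * hd - (e 0 0 - e 1 1 + 2 * (e 1 0 : ℝ) * w.re) * h2 + 4 * e 1 0 * h3
    rw [ht] at h5
    linarith
  have hc : (e 1 0 : ℝ) ^ 2 = 1 := by
    have hc0 : e 1 0 ≠ 0 := fun h0 ↦ by rw [h0] at h4; norm_num at h4
    have hc1 : (1 : ℝ) ≤ (e 1 0 : ℝ) ^ 2 := by
      exact_mod_cast Int.one_le_abs (pow_ne_zero 2 hc0) |>.trans_eq (abs_sq _)
    nlinarith
  rw [hc] at h4
  have hx : w.re ^ 2 = (1 / 2) ^ 2 := by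
    have h5 := hδ.1
    rw [Complex.normSq_apply] at h5
    have h6 := abs_le.mp hδ.2
    simp at h5
    nlinarith
  have hyy : w.im = √3 / 2 := by
    have : (w.im * 2) = √3 := by
      rw [eq_comm, Real.sqrt_eq_iff_mul_self_eq (by norm_num) (by positivity)]
      linarith
    linarith
  rcases sq_eq_sq_iff_eq_or_eq_neg.mp hx with hx | hx
  · refine ⟨1, ?_⟩
    rw [one_smul]
    exact UpperHalfPlane.ext (Complex.ext hx.symm hyy.symm)
  · refine ⟨T⁻¹, ?_⟩
    rw [inv_smul_eq_iff, UpperHalfPlane.modular_T_smul]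
    refine UpperHalfPlane.ext (Complex.ext ?_ ?_)
    · simp [hx, ellipticRho_re]; norm_num
    · simp [hyy, ellipticRho_im]

include hΓ in
lemma numEllipticOrbits_three_eq :
    numEllipticOrbits Γ 3 = numFixedOrbits (SL(2, ℤ) ⧸ Γ) := by
  refine card_orbit_sets_eq (a := ellipticRho) smul_ellipticRho_iff_mem (fun z hz ↦ ?_) fun γ ↦ ?_
  · rw [isEllipticPointOfOrder_three_iff hΓ] at hz
    have : Nontrivial (Γ ⊓ stabilizer SL(2, ℤ) z : Subgroup SL(2, ℤ)) := by
      have : Finite (Γ ⊓ stabilizer SL(2, ℤ) z : Subgroup SL(2, ℤ)) :=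
        Nat.finite_of_card_ne_zero (by rw [hz]; norm_num)
      exact Finite.one_lt_card_iff_nontrivial.mp (by rw [hz]; norm_num)
    obtain ⟨g, hg⟩ := exists_ne (1 : (Γ ⊓ stabilizer SL(2, ℤ) z : Subgroup SL(2, ℤ)))
    have h3 : g ^ 3 = 1 := by rw [← hz, pow_card_eq_one']
    exact exists_smul_ellipticRho_eq (by exact_mod_cast congr_arg Subtype.val h3)
      (fun h ↦ hg (Subtype.ext h)) g.2.2
  · refine (isFixedOrbit_mk _).trans ?_
    rw [isEllipticPointOfOrder_three_iff hΓ]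
    have h : Nat.card (Γ ⊓ stabilizer SL(2, ℤ) (γ⁻¹ • ellipticRho) : Subgroup SL(2, ℤ)) =
        Nat.card (stabilizer (Subgroup.zpowers ellipticU) (γ : SL(2, ℤ) ⧸ Γ)) := by
      refine Nat.card_congr
        { toFun := fun g ↦ ⟨⟨γ * g * γ⁻¹, ?_⟩, ?_⟩
          invFun := fun u ↦ ⟨γ⁻¹ * u * γ, ?_, ?_⟩
          left_inv := fun g ↦ Subtype.ext (by simp [mul_assoc])
          right_inv := fun u ↦ Subtype.ext (Subtype.ext (by simp [mul_assoc])) }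
      · have h : (g : SL(2, ℤ)) • γ⁻¹ • ellipticRho = γ⁻¹ • ellipticRho := g.2.2
        rw [← smul_ellipticRho_iff_mem, mul_smul, mul_smul, h, smul_inv_smul]
      · have h := g.2.1
        rw [mem_stabilizer_iff]
        change ((γ * g * γ⁻¹ * γ : SL(2, ℤ)) : SL(2, ℤ) ⧸ Γ) = γ
        rw [inv_mul_cancel_right, QuotientGroup.mk_mul_of_mem _ h]
      · have h : ((u.1 * γ : SL(2, ℤ)) : SL(2, ℤ) ⧸ Γ) = γ := u.2
        rw [eq_comm, QuotientGroup.eq, ← mul_assoc] at h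
        exact h
      · have h := (smul_ellipticRho_iff_mem _).mpr u.1.2
        change (γ⁻¹ * u * γ) • γ⁻¹ • ellipticRho = γ⁻¹ • ellipticRho
        rw [mul_smul, mul_smul, smul_inv_smul, h]
    rw [h]
    refine ⟨card_stabilizer_of_eq (neg_one_smul_ne hΓ), fun h1 ↦ ?_⟩
    by_contra h2
    have h3 := (card_stabilizer_of_ne (neg_one_smul_ne hΓ) h2).symm.trans h1
    norm_num at h3

end Elliptic

section Cusps

open ModularGroup MulAction

lemma isGoodOrbit_mk {G X : Type*} [Group G] [MulAction G X] (χ : G →* ℂ) (x : X) :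
    IsGoodOrbit χ (Quotient.mk'' x : orbitRel.Quotient G X) ↔ ∀ g : G, g • x = x → χ g = 1 := by
  refine ⟨fun h ↦ h x rfl, fun h y hy g hg ↦ ?_⟩
  obtain ⟨a, rfl⟩ := exists_smul_eq_of_mk_eq hy
  have h1 := h (a⁻¹ * g * a) (by rw [mul_smul, mul_smul, hg, inv_smul_smul])
  rwa [map_mul, mul_comm, ← map_mul, mul_inv_cancel_left] at h1

lemma slOnePoint_eq_smul (γ : SL(2, ℤ)) (x : OnePoint ℚ) :
    slOnePoint γ x = Matrix.SpecialLinearGroup.mapGL ℚ γ • x := by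
  cases x with
  | infty => simp [slOnePoint, OnePoint.smul_infty_eq_ite]
  | coe q => simp [slOnePoint, OnePoint.smul_some_eq_ite]

/-- The action of `SL(2, ℤ)` on the cusps. -/
noncomputable abbrev cuspAction : MulAction SL(2, ℤ) (OnePoint ℚ) where
  smul := slOnePoint
  one_smul x := (slOnePoint_eq_smul 1 x).trans (by rw [map_one, one_smul])
  mul_smul γ δ x := (slOnePoint_eq_smul (γ * δ) x).trans <| by
    rw [map_mul, mul_smul, ← slOnePoint_eq_smul, ← slOnePoint_eq_smul]
    rfl

/-- The subgroup of upper triangular matrices. -/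
def upperTriangular : Subgroup SL(2, ℤ) where
  carrier := {γ | γ 1 0 = 0}
  one_mem' := rfl
  mul_mem' {γ δ} hγ hδ := by
    have h : (γ * δ) 1 0 = γ 1 0 * δ 0 0 + γ 1 1 * δ 1 0 := by simp [Matrix.mul_apply]
    rw [Set.mem_ofPred_eq] at *
    rw [h, hγ, hδ, zero_mul, mul_zero, add_zero]
  inv_mem' {γ} hγ := by
    rw [Set.mem_ofPred_eq] at *
    simp [Matrix.adjugate_fin_two, hγ]

lemma mem_upperTriangular {γ : SL(2, ℤ)} : γ ∈ upperTriangular ↔ γ 1 0 = 0 := Iff.rfl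

/-- The lower right entry as a character of the upper triangular matrices. -/
def upperTriangularChar : upperTriangular →* ℂ where
  toFun γ := ((γ : SL(2, ℤ)) 1 1 : ℤ)
  map_one' := by simp
  map_mul' γ δ := by
    have h : ((γ : SL(2, ℤ)) * (δ : SL(2, ℤ))) 1 1 = (γ : SL(2, ℤ)) 1 0 * (δ : SL(2, ℤ)) 0 1 +
      (γ : SL(2, ℤ)) 1 1 * (δ : SL(2, ℤ)) 1 1 := by simp [Matrix.mul_apply]
    rw [Subgroup.coe_mul, h, mem_upperTriangular.mp γ.2, zero_mul, zero_add, Int.cast_mul]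

lemma mul_eq_one_of_mem_upperTriangular {γ : SL(2, ℤ)} (hγ : γ ∈ upperTriangular) :
    γ 0 0 * γ 1 1 = 1 := by
  have h := γ.det_coe
  rwa [Matrix.det_fin_two, mem_upperTriangular.mp hγ, mul_zero, sub_zero] at h

lemma eq_T_zpow {γ : SL(2, ℤ)} (hγ : γ ∈ upperTriangular) (h : γ 1 1 = 1) :
    γ = T ^ (γ 0 1) := by
  have h1 := mul_eq_one_of_mem_upperTriangular hγ
  rw [h, mul_one] at h1
  refine Subtype.ext ?_
  rw [coe_T_zpow]
  ext i j
  fin_cases i <;> fin_cases j <;> simp [h, h1, mem_upperTriangular.mp hγ]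

lemma T_zpow_mem_upperTriangular (n : ℤ) : T ^ n ∈ upperTriangular := by
  rw [mem_upperTriangular, coe_T_zpow]
  rfl

lemma eigenFunctions_zero_eq {X : Type} [MulAction SL(2, ℤ) X] (N : ℕ) :
    eigenFunctions X N 0 = charFunctions X upperTriangularChar := by
  ext v
  constructor
  · rintro ⟨hodd, hT⟩ ⟨g, hg⟩ x
    have hT1 (x : X) : v (T • x) = v x := by rw [← hT x, pow_zero, mul_one]
    have hTn (n : ℤ) (x : X) : v (T ^ n • x) = v x := by
      induction n with
      | zero => rw [zpow_zero, one_smul]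
      | succ n ih => rw [add_comm, _root_.zpow_one_add, mul_smul, hT1, ih]
      | pred n ih =>
        rw [← ih, ← hT1 (T ^ (-(n : ℤ) - 1) • x), ← mul_smul, ← _root_.zpow_one_add,
          add_sub_cancel]
    change v (g • x) = (g 1 1 : ℂ) * v x
    rcases Int.eq_one_or_neg_one_of_mul_eq_one
      ((mul_comm _ _).trans (mul_eq_one_of_mem_upperTriangular hg)) with h | h
    · rw [eq_T_zpow hg h, hTn, ← eq_T_zpow hg h, h, Int.cast_one, one_mul]
    · have hg' : -g ∈ upperTriangular := by
        rw [mem_upperTriangular] at hg ⊢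
        simp [hg]
      have h1 := hTn ((-g) 0 1) x
      rw [← eq_T_zpow hg' (by simp [h])] at h1
      have h2 := hodd (-g • x)
      rw [← mul_smul, neg_one_mul, neg_neg, h1] at h2
      rw [h2, h]
      simp
  · intro hv
    refine ⟨fun x ↦ ?_, fun x ↦ ?_⟩
    · refine (hv ⟨-1, by simp [mem_upperTriangular]⟩ x).trans ?_
      simp [upperTriangularChar]
    · refine (congr_arg (· * _) (hv ⟨T, T_zpow_mem_upperTriangular 1⟩ x)).trans ?_
      simp [upperTriangularChar, ModularGroup.T]

lemma trace_conj (γ g : SL(2, ℤ)) :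
    (γ * g * γ⁻¹) 0 0 + (γ * g * γ⁻¹) 1 1 = g 0 0 + g 1 1 := by
  rw [← Matrix.trace_fin_two, ← Matrix.trace_fin_two, Matrix.SpecialLinearGroup.coe_mul,
    Matrix.trace_mul_comm, ← Matrix.SpecialLinearGroup.coe_mul, inv_mul_cancel_left]

variable {Γ : Subgroup SL(2, ℤ)}

lemma slOnePoint_infty_eq_iff (γ : SL(2, ℤ)) : slOnePoint γ ∞ = ∞ ↔ γ ∈ upperTriangular := by
  simp [slOnePoint, mem_upperTriangular]

lemma slOnePoint_inv_iff (γ g : SL(2, ℤ)) : slOnePoint g (slOnePoint γ⁻¹ ∞) = slOnePoint γ⁻¹ ∞ ↔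
    γ * g * γ⁻¹ ∈ upperTriangular := by
  let _ := cuspAction
  rw [← slOnePoint_infty_eq_iff]
  change g • γ⁻¹ • (∞ : OnePoint ℚ) = γ⁻¹ • ∞ ↔ (γ * g * γ⁻¹) • (∞ : OnePoint ℚ) = ∞
  rw [mul_smul, mul_smul, eq_inv_smul_iff]

lemma isRegularCusp_iff [Γ.FiniteIndex] (γ : SL(2, ℤ)) : IsRegularCusp Γ (slOnePoint γ⁻¹ ∞) ↔
    ∀ g ∈ Γ, γ * g * γ⁻¹ ∈ upperTriangular → (γ * g * γ⁻¹) 1 1 = 1 := by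
  have hset : {g : SL(2, ℤ) | g ∈ Γ ∧ slOnePoint g (slOnePoint γ⁻¹ ∞) = slOnePoint γ⁻¹ ∞} =
      {g | g ∈ Γ ∧ γ * g * γ⁻¹ ∈ upperTriangular} := by
    ext g
    rw [Set.mem_ofPred_eq, Set.mem_ofPred_eq, slOnePoint_inv_iff]
  rw [IsRegularCusp, hset]
  constructor
  · rintro ⟨p, hp1, htr, hp⟩ g hg hgu
    have hpm : p ∈ {g | g ∈ Γ ∧ γ * g * γ⁻¹ ∈ upperTriangular} :=
      hp ▸ Subgroup.mem_zpowers p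
    have hgm : g ∈ (Subgroup.zpowers p : Set SL(2, ℤ)) := hp ▸ ⟨hg, hgu⟩
    obtain ⟨n, hn⟩ := hgm
    have h1 := mul_eq_one_of_mem_upperTriangular hpm.2
    have h2 := trace_conj γ p
    rw [htr] at h2
    have h3 : (γ * p * γ⁻¹) 1 1 = 1 := by
      rcases Int.eq_one_or_neg_one_of_mul_eq_one ((mul_comm _ _).trans h1) with h | h
      · exact h
      · rw [h] at h1 h2; omega
    rw [← hn]
    beta_reduce
    rw [← conj_zpow, eq_T_zpow hpm.2 h3, ← _root_.zpow_mul, coe_T_zpow]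
    rfl
  · intro h
    set t := γ⁻¹ * T * γ with ht
    have htn (n : ℤ) : γ * t ^ n * γ⁻¹ = T ^ n := by
      rw [← conj_zpow, ht]
      group
    have hK : ((Γ ⊓ Subgroup.zpowers t : Subgroup SL(2, ℤ)) : Set SL(2, ℤ)) =
        {g | g ∈ Γ ∧ γ * g * γ⁻¹ ∈ upperTriangular} := by
      ext g
      refine and_congr_right fun hg ↦ ⟨?_, fun hu ↦ ?_⟩
      · rintro ⟨n, rfl⟩
        beta_reduce
        rw [htn]
        exact T_zpow_mem_upperTriangular n
      · refine ⟨(γ * g * γ⁻¹) 0 1, ?_⟩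
        beta_reduce
        rw [← mul_left_cancel_iff (a := γ), ← mul_right_cancel_iff (a := γ⁻¹), htn,
          ← eq_T_zpow hu (h g hg hu)]
    have hcyc : IsCyclic (Γ ⊓ Subgroup.zpowers t : Subgroup SL(2, ℤ)) :=
      Subgroup.isCyclic_of_le (inf_le_right)
    obtain ⟨p, hp⟩ := (Subgroup.isCyclic_iff_exists_zpowers_eq_top _).mp hcyc
    have hpm : p ∈ Γ ⊓ Subgroup.zpowers t := hp ▸ Subgroup.mem_zpowers p
    refine ⟨p, ?_, ?_, by rw [← hK, hp]⟩
    · rintro rfl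
      rw [Subgroup.zpowers_one_eq_bot] at hp
      obtain ⟨n, hn, -, hm⟩ := Subgroup.exists_pow_mem_of_index_ne_zero
        (Subgroup.FiniteIndex.index_ne_zero (H := Γ)) t
      have h1 : t ^ n ∈ Γ ⊓ Subgroup.zpowers t := ⟨hm, n, zpow_natCast _ _⟩
      rw [← hp, Subgroup.mem_bot] at h1
      have h2 := htn n
      rw [zpow_natCast, h1, mul_one, mul_inv_cancel] at h2
      have h3 := coe_T_zpow n
      rw [← h2] at h3
      have h4 := congr_fun (congr_fun h3 0) 1
      simp at h4
      omega
    · obtain ⟨n, rfl⟩ := hpm.2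
      beta_reduce
      rw [← trace_conj γ, htn, coe_T_zpow]
      simp

lemma finrank_eigenFunctions_eq [Γ.FiniteIndex] (N : ℕ) :
    Module.finrank ℂ (eigenFunctions (SL(2, ℤ) ⧸ Γ) N 0) = numRegularCuspOrbits Γ := by
  let _ := cuspAction
  rw [eigenFunctions_zero_eq, finrank_charFunctions]
  refine (card_orbit_sets_eq (a := (∞ : OnePoint ℚ)) slOnePoint_infty_eq_iff (fun s _ ↦ ?_)
    fun γ ↦ ?_).symm
  · obtain ⟨g, hg⟩ := OnePoint.exists_mem_SL2 ℤ s
    exact ⟨g, (slOnePoint_eq_smul g ∞).trans hg⟩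
  · refine (isGoodOrbit_mk _ _).trans ((isRegularCusp_iff γ).trans ⟨fun h b hb ↦ ?_,
      fun h g hg hu ↦ ?_⟩).symm
    · have h1 : ((b.1 * γ : SL(2, ℤ)) : SL(2, ℤ) ⧸ Γ) = γ := hb
      rw [eq_comm, QuotientGroup.eq] at h1
      have h2 : γ * (γ⁻¹ * (b.1 * γ)) * γ⁻¹ = b := by group
      have h3 := h _ h1 (by rw [h2]; exact b.2)
      rw [h2] at h3
      change ((b.1 1 1 : ℤ) : ℂ) = 1
      rw [h3, Int.cast_one]
    · have h1 := h ⟨_, hu⟩ <| by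
        change ((γ * g * γ⁻¹ * γ : SL(2, ℤ)) : SL(2, ℤ) ⧸ Γ) = γ
        rw [inv_mul_cancel_right, QuotientGroup.mk_mul_of_mem _ hg]
      exact Int.cast_injective (α := ℂ) (h1.trans Int.cast_one.symm)

end Cusps

section Dimension

lemma linear_recursion_of_step {m a : ℕ → ℕ} {n o e : ℕ} (ho : 3 * o = n + 2 * e)
    (ha3 : ∀ k, 3 ∣ k → a k = o) (ha : ∀ k, ¬3 ∣ k → a k + e = o)
    (hstep : ∀ k, Odd k → 3 ≤ k → m k + a (k + 4) ≤ m (k + 4))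
    (hperiod : ∀ k, Odd k → 3 ≤ k → m (k + 12) = m k + n) {k : ℕ} (hk : Odd k) (hk3 : 3 ≤ k) :
    12 * (m (k + 4) : ℤ) = 12 * m k + 4 * n + 12 * (((k + 4) / 3 - k / 3 : ℤ)) * e - 16 * e := by
  have h1 := hstep k hk hk3
  have h2 := hstep (k + 4) (by grind) (by omega)
  have h3 := hstep (k + 8) (by grind) (by omega)
  have h4 := hperiod k hk hk3
  have key : a (k + 4) + a (k + 8) + a (k + 12) = n ∧
      12 * (a (k + 4) : ℤ) = 4 * n + 12 * (((k + 4) / 3 - k / 3 : ℤ)) * e - 16 * e := by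
    rcases (show k % 3 = 0 ∨ k % 3 = 1 ∨ k % 3 = 2 by omega) with h | h | h
    · have b1 := ha (k + 4) (by omega)
      have b2 := ha (k + 8) (by omega)
      have b3 := ha3 (k + 12) (by omega)
      have hd : (((k + 4) / 3 - k / 3 : ℤ)) = 1 := by omega
      rw [hd]
      omega
    · have b1 := ha (k + 4) (by omega)
      have b2 := ha3 (k + 8) (by omega)
      have b3 := ha (k + 12) (by omega)
      have hd : (((k + 4) / 3 - k / 3 : ℤ)) = 1 := by omega
      rw [hd]
      omega
    · have b1 := ha3 (k + 4) (by omega)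
      have b2 := ha (k + 8) (by omega)
      have b3 := ha (k + 12) (by omega)
      have hd : (((k + 4) / 3 - k / 3 : ℤ)) = 2 := by omega
      rw [hd]
      omega
  rw [add_assoc] at h2 h3
  norm_num at h2 h3
  obtain ⟨h5, h6⟩ := key
  have h7 : m (k + 4) = m k + a (k + 4) := by omega
  rw [h7]
  push_cast
  linarith

lemma dimension_formula_of_step {m a : ℕ → ℕ} {n o e r : ℕ} (ho : 3 * o = n + 2 * e)
    (ha3 : ∀ k, 3 ∣ k → a k = o) (ha : ∀ k, ¬3 ∣ k → a k + e = o)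
    (hstep : ∀ k, Odd k → 3 ≤ k → m k + a (k + 4) ≤ m (k + 4))
    (hperiod : ∀ k, Odd k → 3 ≤ k → m (k + 12) = m k + n)
    (h7 : 2 * m 7 = n + r) (h5 : m 5 + m 9 = n + r) {k : ℕ} (hk : Odd k) (hk3 : 3 ≤ k) :
    12 * (m k : ℤ) = (k - 1) * n + 12 * (k / 3 : ℤ) * e - 4 * (k - 1) * e + 6 * r := by
  have hrec {k : ℕ} := linear_recursion_of_step ho ha3 ha hstep hperiod (k := k)
  have hind (k₀ : ℕ) (hk₀ : Odd k₀) (hk₀3 : 3 ≤ k₀)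
      (h0 : 12 * (m k₀ : ℤ) = (k₀ - 1) * n + 12 * (k₀ / 3 : ℤ) * e - 4 * (k₀ - 1) * e + 6 * r)
      (j : ℕ) : 12 * (m (k₀ + 4 * j) : ℤ) = (((k₀ + 4 * j : ℕ) : ℤ) - 1) * n +
        12 * (((k₀ + 4 * j : ℕ) : ℤ) / 3) * e - 4 * (((k₀ + 4 * j : ℕ) : ℤ) - 1) * e + 6 * r := by
    induction j with
    | zero => simpa using h0
    | succ j ih =>
      have h := hrec (k := k₀ + 4 * j) (by grind) (by omega)
      rw [mul_add_one, ← add_assoc, h, ih]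
      push_cast
      ring
  have e3 := hrec (k := 3) (by decide) le_rfl
  have e5 := hrec (k := 5) (by decide) (by norm_num)
  norm_num at e3 e5
  rcases (show k % 4 = 1 ∨ k % 4 = 3 by grind) with h | h
  · have h1 := hind 5 (by decide) (by norm_num) (by norm_num; linarith) ((k - 5) / 4)
    rwa [show 5 + 4 * ((k - 5) / 4) = k by omega] at h1
  · have h1 := hind 3 (by decide) le_rfl (by norm_num; linarith) ((k - 3) / 4)
    rwa [show 3 + 4 * ((k - 3) / 4) = k by omega] at h1

variable {Γ : Subgroup SL(2, ℤ)} [Γ.FiniteIndex]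

lemma finrank_formFamily_eq_add_numRegularCuspOrbits {k : ℤ} (hk : 3 ≤ k) (hko : Odd k) :
    Module.finrank ℂ (formFamily (SL(2, ℤ) ⧸ Γ) k) =
      Module.finrank ℂ (cuspFamily (SL(2, ℤ) ⧸ Γ) k) + numRegularCuspOrbits Γ := by
  obtain ⟨N, hN, hT⟩ := exists_T_pow_smul_eq (SL(2, ℤ) ⧸ Γ)
  rw [finrank_formFamily_eq_add hN hT (fun l hl ↦ formFamily_eq_bot_of_neg hl) hk hko,
    finrank_eigenFunctions_eq]

lemma twelve_mul_finrank_formFamily (hΓ : -1 ∉ Γ) {k : ℕ} (hk : Odd k) (hk3 : 3 ≤ k) :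
    12 * (Module.finrank ℂ (formFamily (SL(2, ℤ) ⧸ Γ) k) : ℤ) = (k - 1) * nuZero Γ +
      12 * (k / 3 : ℤ) * numEllipticOrbits Γ 3 - 4 * (k - 1) * numEllipticOrbits Γ 3 +
      6 * numRegularCuspOrbits Γ := by
  have hX := neg_one_smul_ne hΓ
  have hneg (l : ℤ) (hl : l < 0) : formFamily (SL(2, ℤ) ⧸ Γ) l = ⊥ := formFamily_eq_bot_of_neg hl
  have hodd := finrank_oddFunctions_eq_nuZero hΓ
  have hcast {k : ℕ} (h : Odd k) : Odd (k : ℤ) := by exact_mod_cast h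
  rw [numEllipticOrbits_three_eq hΓ]
  have hdual (k l : ℤ) (hk : Odd k) (hk2 : k < 12) (hl2 : l < 12) (hl3 : 3 ≤ l)
      (hkl : k + l = 14) : Module.finrank ℂ (formFamily (SL(2, ℤ) ⧸ Γ) k) +
      Module.finrank ℂ (formFamily (SL(2, ℤ) ⧸ Γ) l) = nuZero Γ + numRegularCuspOrbits Γ := by
    have h1 := finrank_add_finrank_cuspFamily_le hneg hk hk2 hl2 hkl
    have h2 := finrank_oddFunctions_le hneg hk hk2
    rw [show 14 - k = l by omega] at h2
    rw [finrank_formFamily_eq_add_numRegularCuspOrbits (k := l) hl3 (by grind)]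
    omega
  have h7 := hdual 7 7 (by decide) (by norm_num) (by norm_num) (by norm_num) (by norm_num)
  have h59 := hdual 5 9 (by decide) (by norm_num) (by norm_num) (by norm_num) (by norm_num)
  have hstep (k : ℕ) (h : Odd k) (h3 : 3 ≤ k) :=
    finrank_formFamily_add_finrank_pointFunctions_le hneg h h3
  have hperiod (k : ℕ) (h : Odd k) (h3 : 3 ≤ k) :=
    finrank_formFamily_add_twelve_eq hneg (k := k) (by exact_mod_cast h3) (hcast h)
  rw [← two_mul] at h7
  rw [hodd] at hperiod
  refine dimension_formula_of_step
    (m := fun k ↦ Module.finrank ℂ (formFamily (SL(2, ℤ) ⧸ Γ) (k : ℤ)))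
    (a := fun k ↦ Module.finrank ℂ (pointFunctions (SL(2, ℤ) ⧸ Γ) k))
    (hodd ▸ three_mul_numOrbits hX)
    (fun k h ↦ finrank_pointFunctions_of_dvd hX h)
    (fun k h ↦ finrank_pointFunctions_of_not_dvd hX h)
    (fun k h h3 ↦ ?_) (fun k h h3 ↦ ?_) ?_ ?_ hk hk3
  · rw [Nat.cast_add]
    exact hstep k h h3
  · rw [Nat.cast_add]
    exact hperiod k h h3
  · rw [Nat.cast_ofNat]
    exact h7
  · rw [Nat.cast_ofNat, Nat.cast_ofNat]
    exact h59

end Dimension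

/-- **Dimension formula for modular and cusp forms of odd weight** (Shimura).
Let `Γ'` be a finite-index subgroup of `SL(2, ℤ)` and let `k ≥ 3` be odd. If `−I ∉ Γ'` then
`dim S_k(Γ') = ((k−1)/12)·ν₀(Γ') + (⌊k/3⌋ − (k−1)/3)·ν₃(Γ') − ν_∞^reg(Γ')/2` and
`dim M_k(Γ') = dim S_k(Γ') + ν_∞^reg(Γ')`; moreover if `−I ∈ Γ'` then `M_k(Γ') = {0}`. -/
theorem dim_modular_forms_odd_weight (Γ' : Subgroup SL(2, ℤ)) [Γ'.FiniteIndex]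
    (k : ℤ) (hk : 3 ≤ k) (hko : Odd k) :
    ((-1 : SL(2, ℤ)) ∉ Γ' →
      (Module.finrank ℂ (CuspForm Γ' k) : ℚ) =
        (k - 1) / 12 * nuZero Γ'
          + ((⌊(k : ℚ) / 3⌋ : ℚ) - (k - 1) / 3) * numEllipticOrbits Γ' 3
          - (numRegularCuspOrbits Γ' : ℚ) / 2 ∧
      Module.finrank ℂ (ModularForm Γ' k) =
        Module.finrank ℂ (CuspForm Γ' k) + numRegularCuspOrbits Γ') ∧
    ((-1 : SL(2, ℤ)) ∈ Γ' → ∀ f : ModularForm Γ' k, f = 0) := by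
  refine ⟨fun hΓ ↦ ?_, fun hΓ f ↦ ?_⟩
  · have h := finrank_formFamily_eq_add_numRegularCuspOrbits (Γ := Γ') hk hko
    rw [finrank_modularForm_eq, finrank_cuspForm_eq]
    refine ⟨?_, h⟩
    obtain ⟨n, rfl⟩ := Int.eq_ofNat_of_zero_le (show 0 ≤ k by omega)
    have h1 := twelve_mul_finrank_formFamily hΓ (k := n) (by exact_mod_cast hko)
      (by exact_mod_cast hk)
    rw [h] at h1
    have h2 := Rat.floor_intCast_div_natCast (n : ℤ) 3
    rw [Nat.cast_ofNat, Nat.cast_ofNat] at h2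
    rw [h2]
    have h3 := congr_arg (Int.cast : ℤ → ℚ) h1
    push_cast at h3 ⊢
    linarith
  · refine ModularForm.eq_zero_of_neg_one_mem ?_ hko f
    exact ⟨-1, hΓ, by ext i j; simp⟩
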